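/- arXiv:2009.02953 — 2 statements merged into one kernel-verified Lean document; each statement's English description precedes it below -/
import Mathlib

section
/- Let 𝒞 be a class of graphs closed under induced topological minors, i.e., whenever the r-subdivision of a graph H (for some integer r ≥ 0) is isomorphic to an induced subgraph of some G ∈ 𝒞, then H ∈ 𝒞 (in particular 𝒞 is hereditary). Then 𝒞 is weakly χ_p-bounded for every positive integer p if and only if 𝒞 is χ-bounded. -/
open SimpleGraph

/-! ## Basic containment relations between graphs -/

/-- `H` is isomorphic to a (not necessarily induced) subgraph of `G`. -/
def IsSubgraphOf {V W : Type*} (H : SimpleGraph V) (G : SimpleGraph W) : Prop :=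
  ∃ f : H →g G, Function.Injective f

/-- `H` is isomorphic to an induced subgraph of `G`. -/
def IsInducedSubgraphOf {V W : Type*} (H : SimpleGraph V) (G : SimpleGraph W) : Prop :=
  Nonempty (H ↪g G)

/-- The clique number `ω(G)`: the largest `m` such that `K_m` is a subgraph of `G`. -/
noncomputable def omegaNum {V : Type*} (G : SimpleGraph V) : ℕ :=
  sSup {m | IsSubgraphOf (⊤ : SimpleGraph (Fin m)) G}

/-- The chromatic number `χ(G)` (as a natural number). -/
noncomputable def chi {V : Type*} (G : SimpleGraph V) : ℕ :=
  sInf {N | G.Colorable N}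

/-! ## Tree-depth and the invariants `χ_p` -/

/-- A forest order: a partial order in which the down-set of every element is a chain.
Such orders are exactly the ancestor orders of rooted forests. -/
def IsForestOrder {V : Type*} (r : V → V → Prop) : Prop :=
  (∀ v, r v v) ∧ (∀ u v, r u v → r v u → u = v) ∧
  (∀ u v w, r u v → r v w → r u w) ∧
  (∀ u v w, r u w → r v w → r u v ∨ r v u)

/-- `G` has tree-depth at most `h`: `G` is a subgraph of the closure of a rooted forest
of height at most `h` (height = maximum number of vertices on a root-to-leaf path). -/
def TreeDepthLE {V : Type*} (G : SimpleGraph V) (h : ℕ) : Prop :=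
  ∃ r : V → V → Prop, IsForestOrder r ∧
    (∀ u v, G.Adj u v → r u v ∨ r v u) ∧
    (∀ v, {u | r u v}.ncard ≤ h)

/-- The tree-depth `td(G)`. -/
noncomputable def treeDepth {V : Type*} (G : SimpleGraph V) : ℕ :=
  sInf {h | TreeDepthLE G h}

/-- `χ_p(G)`: the least number of colors of a vertex coloring such that every set `I` of at
most `p` colors induces a subgraph of tree-depth at most `|I|`. -/
noncomputable def chiP {V : Type*} (G : SimpleGraph V) (p : ℕ) : ℕ :=
  sInf {N | ∃ c : V → Fin N, ∀ I : Finset (Fin N), I.card ≤ p →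
    TreeDepthLE (G.induce {v | c v ∈ I}) I.card}

/-! ## Star colorings -/

/-- A star coloring: a proper coloring with no path on `4` vertices using only two colors. -/
def IsStarColoring {V α : Type*} (G : SimpleGraph V) (c : V → α) : Prop :=
  (∀ u v, G.Adj u v → c u ≠ c v) ∧
  ∀ x y z w : V, G.Adj x y → G.Adj y z → G.Adj z w →
    x ≠ z → y ≠ w → x ≠ w → ¬(c x = c z ∧ c y = c w)

/-- The star chromatic number `χ_s(G)`. -/
noncomputable def starChi {V : Type*} (G : SimpleGraph V) : ℕ :=
  sInf {N | ∃ c : V → Fin N, IsStarColoring G c}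

/-! ## Subdivisions -/

/-- The edges of a graph on `Fin n`, presented as increasingly ordered pairs. -/
def Edges {n : ℕ} (H : SimpleGraph (Fin n)) : Type :=
  {p : Fin n × Fin n // p.1 < p.2 ∧ H.Adj p.1 p.2}

/-- Base relation of the subdivision of `H`, where the edge `e` receives `t e` internal
vertices. -/
def subdivRel {n : ℕ} (H : SimpleGraph (Fin n)) (t : Edges H → ℕ) :
    (Fin n ⊕ Σ e : Edges H, Fin (t e)) → (Fin n ⊕ Σ e : Edges H, Fin (t e)) → Prop
  | Sum.inl u, Sum.inl v => ∃ h : u < v ∧ H.Adj u v, t ⟨(u, v), h⟩ = 0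
  | Sum.inl u, Sum.inr ⟨e, i⟩ =>
      (u = e.1.1 ∧ (i : ℕ) = 0) ∨ (u = e.1.2 ∧ (i : ℕ) + 1 = t e)
  | Sum.inr ⟨e, i⟩, Sum.inr ⟨e', j⟩ => e = e' ∧ (i : ℕ) + 1 = (j : ℕ)
  | _, _ => False

/-- The subdivision of `H` in which each edge `e` is replaced by a path with exactly `t e`
internal vertices. In particular `Subdiv H (fun _ => r)` is the `r`-subdivision `H^{(r)}`,
and the `(≤ r)`-subdivisions of `H` are the graphs `Subdiv H t` with `t e ≤ r` for all `e`. -/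
def Subdiv {n : ℕ} (H : SimpleGraph (Fin n)) (t : Edges H → ℕ) :
    SimpleGraph (Fin n ⊕ Σ e : Edges H, Fin (t e)) :=
  SimpleGraph.fromRel (subdivRel H t)

/-- `H ∈ TM_r(G)`: some `(≤ r)`-subdivision of `H` is a subgraph of `G`. -/
def MemTM {W : Type*} (r : ℕ) (G : SimpleGraph W) {n : ℕ} (H : SimpleGraph (Fin n)) : Prop :=
  ∃ t : Edges H → ℕ, (∀ e, t e ≤ r) ∧ IsSubgraphOf (Subdiv H t) G

/-- `H ∈ ITM_r^e(G)`: the exact `r`-subdivision of `H` is an induced subgraph of `G`. -/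
def MemITM {W : Type*} (r : ℕ) (G : SimpleGraph W) {n : ℕ} (H : SimpleGraph (Fin n)) : Prop :=
  IsInducedSubgraphOf (Subdiv H (fun _ => r)) G

/-- `ω(TM_r(G))`: the supremum of the clique numbers of the graphs in `TM_r(G)`. -/
noncomputable def omegaTM {W : Type*} (r : ℕ) (G : SimpleGraph W) : ℕ :=
  sSup {m | ∃ (k : ℕ) (H : SimpleGraph (Fin k)), MemTM r G H ∧ omegaNum H = m}

/-- The biclique number `bω(G)`: the largest `s` with `K_{s,s}` a subgraph of `G`. -/
noncomputable def bomega {V : Type*} (G : SimpleGraph V) : ℕ :=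
  sSup {s | IsSubgraphOf (completeBipartiteGraph (Fin s) (Fin s)) G}

/-- The average degree `d̄(G) = 2|E(G)|/|V(G)|`. -/
noncomputable def avgDeg {n : ℕ} (G : SimpleGraph (Fin n)) : ℝ :=
  2 * (G.edgeSet.ncard : ℝ) / n

/-! ## Classes of graphs -/

/-- A class of (finite, simple) graphs: for each `n`, a set of graphs on `Fin n`.
Classes are implicitly closed under isomorphism via the relations used below. -/
def GraphClass := ∀ n : ℕ, Set (SimpleGraph (Fin n))

/-- A hereditary class: closed under induced subgraphs (hence under isomorphism). -/
def Hereditary (C : GraphClass) : Prop :=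
  ∀ ⦃n m : ℕ⦄ (G : SimpleGraph (Fin n)) (H : SimpleGraph (Fin m)),
    G ∈ C n → IsInducedSubgraphOf H G → H ∈ C m

/-- A monotone class: closed under subgraphs (hence under isomorphism). -/
def MonotoneClass (C : GraphClass) : Prop :=
  ∀ ⦃n m : ℕ⦄ (G : SimpleGraph (Fin n)) (H : SimpleGraph (Fin m)),
    G ∈ C n → IsSubgraphOf H G → H ∈ C m

/-- `H ∈ TM_r(𝒞)`. -/
def MemTMClass (r : ℕ) (C : GraphClass) {m : ℕ} (H : SimpleGraph (Fin m)) : Prop :=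
  ∃ (n : ℕ) (G : SimpleGraph (Fin n)), G ∈ C n ∧ MemTM r G H

/-- `H ∈ ITM_r^e(𝒞)`. -/
def MemITMClass (r : ℕ) (C : GraphClass) {m : ℕ} (H : SimpleGraph (Fin m)) : Prop :=
  ∃ (n : ℕ) (G : SimpleGraph (Fin n)), G ∈ C n ∧ MemITM r G H

/-- `𝒞` is `χ`-bounded: `χ(H) ≤ f(ω(H))` for every induced subgraph `H` of a graph of `𝒞`. -/
def ChiBounded (C : GraphClass) : Prop :=
  ∃ f : ℕ → ℕ, ∀ ⦃n : ℕ⦄ (G : SimpleGraph (Fin n)), G ∈ C n →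
    ∀ ⦃m : ℕ⦄ (H : SimpleGraph (Fin m)), IsInducedSubgraphOf H G →
      chi H ≤ f (omegaNum H)

/-- `𝒞` has bounded expansion: for every `r`, `d̄(TM_r(𝒞)) < ∞`. -/
def BoundedExpansion (C : GraphClass) : Prop :=
  ∀ r : ℕ, ∃ d : ℝ, ∀ ⦃m : ℕ⦄ (H : SimpleGraph (Fin m)), MemTMClass r C H → avgDeg H ≤ d

/-- `𝒞` has `ω`-bounded expansion. -/
def OmegaBoundedExpansion (C : GraphClass) : Prop :=
  ∃ f : ℕ → ℕ → ℝ, ∀ ⦃n : ℕ⦄ (G : SimpleGraph (Fin n)), G ∈ C n →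
    ∀ (r : ℕ) ⦃m : ℕ⦄ (H : SimpleGraph (Fin m)), MemTM r G H →
      avgDeg H ≤ f (omegaNum G) r

/-- `𝒞` is nowhere dense: for every `r`, `ω(TM_r(𝒞)) < ∞`. -/
def NowhereDense (C : GraphClass) : Prop :=
  ∀ r : ℕ, ∃ c : ℕ, ∀ ⦃m : ℕ⦄ (H : SimpleGraph (Fin m)), MemTMClass r C H → omegaNum H ≤ c

/-- `𝒞` is strongly `χ_p`-bounded: `χ_p(G) ≤ f_p(ω(G))` on `𝒞`. -/
def StronglyChiPBounded (C : GraphClass) (p : ℕ) : Prop :=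
  ∃ f : ℕ → ℕ, ∀ ⦃n : ℕ⦄ (G : SimpleGraph (Fin n)), G ∈ C n → chiP G p ≤ f (omegaNum G)

/-- `𝒞` is weakly `χ_p`-bounded: `χ_p(G) ≤ g_p(ω(TM_{p-1}(G)))` on `𝒞`. -/
def WeaklyChiPBounded (C : GraphClass) (p : ℕ) : Prop :=
  ∃ g : ℕ → ℕ, ∀ ⦃n : ℕ⦄ (G : SimpleGraph (Fin n)), G ∈ C n → chiP G p ≤ g (omegaTM (p - 1) G)

/-! ## Directed graphs, orientations and restricted dualities -/

/-- Existence of a homomorphism between directed graphs presented as binary relations. -/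
def DigraphHomEx {n m : ℕ} (A : Fin n → Fin n → Prop) (B : Fin m → Fin m → Prop) : Prop :=
  ∃ f : Fin n → Fin m, ∀ u v, A u v → B (f u) (f v)

/-- `A` is an orientation of the graph `G`. -/
def IsOrientationOf {n : ℕ} (A : Fin n → Fin n → Prop) (G : SimpleGraph (Fin n)) : Prop :=
  (∀ u v, ¬(A u v ∧ A v u)) ∧ (∀ u v, G.Adj u v ↔ (A u v ∨ A v u))

/-- A directed graph is acyclic if it has no directed cycle. -/
def IsAcyclicDigraph {n : ℕ} (A : Fin n → Fin n → Prop) : Prop :=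
  ∀ v, ¬ Relation.TransGen A v v

/-- The directed graph `F` has a restricted dual for the class of all orientations of the
graphs of `𝒞`. -/
def HasRestrictedDualForOrientations (C : GraphClass) {nF : ℕ}
    (F : Fin nF → Fin nF → Prop) : Prop :=
  ∃ (m : ℕ) (D : Fin m → Fin m → Prop),
    ¬ DigraphHomEx F D ∧
    ∀ ⦃n : ℕ⦄ (A : Fin n → Fin n → Prop) (G : SimpleGraph (Fin n)),
      G ∈ C n → IsOrientationOf A G →
      (¬ DigraphHomEx F A ↔ DigraphHomEx A D)

/-! ## Holes -/

/-- The number `h_g(G)` of holes of length `g` in `G`, i.e. of vertex subsets inducing a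
cycle on `g` vertices. -/
noncomputable def holeCount {n : ℕ} (g : ℕ) (G : SimpleGraph (Fin n)) : ℕ :=
  {S : Set (Fin n) | Nonempty (G.induce S ≃g SimpleGraph.cycleGraph g)}.ncard

/-- `G` is even hole-free: it has no induced cycle of even length at least `4`. -/
def EvenHoleFree {n : ℕ} (G : SimpleGraph (Fin n)) : Prop :=
  ∀ g : ℕ, 4 ≤ g → Even g → holeCount g G = 0

section
open scoped Classical

/-- A system of induced paths in `G`, each with `r` internal vertices, joining the pairs in `E`
of the independent set `Y`, with no further adjacencies between the paths. -/
structure PathSys {V : Type*} [LinearOrder V] (G : SimpleGraph V) (r : ℕ) (Y : Finset V)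
    (E : Finset (V × V)) (x : V × V → ℕ → V) : Prop where
  lt : ∀ e ∈ E, e.1 < e.2
  mem1 : ∀ e ∈ E, e.1 ∈ Y
  mem2 : ∀ e ∈ E, e.2 ∈ Y
  start : ∀ e ∈ E, x e 0 = e.1
  finish : ∀ e ∈ E, x e (r + 1) = e.2
  geo : ∀ e ∈ E, ∀ i j, i < j → j ≤ r + 1 → x e i ≠ x e j ∧ (G.Adj (x e i) (x e j) ↔ j = i + 1)
  indep : ∀ y ∈ Y, ∀ z ∈ Y, ¬ G.Adj y z
  off : ∀ e ∈ E, ∀ y ∈ Y, y ≠ e.1 → y ≠ e.2 → ∀ i, 1 ≤ i → i ≤ r →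
    y ≠ x e i ∧ ¬ G.Adj y (x e i)
  cross : ∀ e ∈ E, ∀ e' ∈ E, e ≠ e' → ∀ i j, 1 ≤ i → i ≤ r → 1 ≤ j → j ≤ r →
    x e i ≠ x e' j ∧ ¬ G.Adj (x e i) (x e' j)

/-- The graph with vertex set `Y` and edge set `E`, transported to `Fin`. -/
def graphOf {V : Type*} [LinearOrder V] (Y : Finset V) (E : Finset (V × V)) :
    SimpleGraph (Fin Y.card) :=
  SimpleGraph.fromRel fun i j => (Y.orderEmbOfFin rfl i, Y.orderEmbOfFin rfl j) ∈ E

theorem PathSys.mono {V : Type*} [LinearOrder V] {G : SimpleGraph V} {r : ℕ} {Y : Finset V}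
    {E E' : Finset (V × V)} {x : V × V → ℕ → V} (h : PathSys G r Y E x) (hE : E' ⊆ E) :
    PathSys G r Y E' x where
  lt e he := h.lt e (hE he)
  mem1 e he := h.mem1 e (hE he)
  mem2 e he := h.mem2 e (hE he)
  start e he := h.start e (hE he)
  finish e he := h.finish e (hE he)
  geo e he := h.geo e (hE he)
  indep := h.indep
  off e he := h.off e (hE he)
  cross e he e' he' := h.cross e (hE he) e' (hE he')

theorem PathSys.subdiv {V : Type*} [LinearOrder V] {G : SimpleGraph V} {r : ℕ} {Y : Finset V}
    {E : Finset (V × V)} {x : V × V → ℕ → V} (h : PathSys G r Y E x) (hr : 1 ≤ r) :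
    IsInducedSubgraphOf (Subdiv (graphOf Y E) (fun _ => r)) G := by
  set ι := Y.orderEmbOfFin rfl with hι
  have hιY : ∀ i, ι i ∈ Y := fun i => Finset.orderEmbOfFin_mem _ _ _
  have hE : ∀ e : Edges (graphOf Y E), (ι e.1.1, ι e.1.2) ∈ E := by
    rintro ⟨⟨u, v⟩, huv, hadj⟩
    simp only [graphOf, SimpleGraph.fromRel_adj] at hadj
    rcases hadj.2 with h1 | h1
    · exact h1
    · have := h.lt _ h1
      simp only [OrderEmbedding.lt_iff_lt] at this
      exact absurd huv (not_lt.2 this.le)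
  let φ : (Fin Y.card ⊕ Σ e : Edges (graphOf Y E), Fin r) → V := fun a => match a with
    | Sum.inl i => ι i
    | Sum.inr ⟨e, i⟩ => x (ι e.1.1, ι e.1.2) (i + 1)
  have hlr : ∀ (u : Fin Y.card) (e : Edges (graphOf Y E)) (i : Fin r),
      ι u ≠ x (ι e.1.1, ι e.1.2) (i + 1) ∧ (G.Adj (ι u) (x (ι e.1.1, ι e.1.2) (i + 1)) ↔
        ((u = e.1.1 ∧ (i : ℕ) = 0) ∨ (u = e.1.2 ∧ (i : ℕ) + 1 = r))) := by
    intro u e i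
    have he := hE e
    have hne : e.1.1 ≠ e.1.2 := e.2.1.ne
    have hi := i.2
    by_cases h1 : u = e.1.1
    · subst h1
      have := h.geo _ he 0 (i + 1) (by omega) (by omega)
      rw [h.start _ he] at this
      refine ⟨this.1, this.2.trans ?_⟩
      simp [hne]
    · by_cases h2 : u = e.1.2
      · subst h2
        have := h.geo _ he (i + 1) (r + 1) (by omega) (by omega)
        rw [h.finish _ he] at this
        refine ⟨this.1.symm, ?_⟩
        rw [G.adj_comm, this.2]
        simp [hne.symm]
        omega
      · have := h.off _ he (ι u) (hιY u) (by simpa using h1) (by simpa using h2) (i + 1)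
          (by omega) (by omega)
        refine ⟨this.1, ?_⟩
        simp [this.2, h1, h2]
  have hrr : ∀ (e e' : Edges (graphOf Y E)) (i j : Fin r), (e = e' → (i : ℕ) < j) →
      x (ι e.1.1, ι e.1.2) (i + 1) ≠ x (ι e'.1.1, ι e'.1.2) (j + 1) ∧
      (G.Adj (x (ι e.1.1, ι e.1.2) (i + 1)) (x (ι e'.1.1, ι e'.1.2) (j + 1)) ↔
        (e = e' ∧ (i : ℕ) + 1 = j)) := by
    intro e e' i j hij
    have hi := i.2
    have hj := j.2
    by_cases hee : e = e'
    · subst hee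
      have := h.geo _ (hE e) (i + 1) (j + 1) (by have := hij rfl; omega) (by omega)
      refine ⟨this.1, this.2.trans ?_⟩
      simp
      omega
    · have hne : (ι e.1.1, ι e.1.2) ≠ (ι e'.1.1, ι e'.1.2) := by
        intro hh
        simp only [Prod.mk.injEq, EmbeddingLike.apply_eq_iff_eq] at hh
        exact hee (Subtype.ext (Prod.ext hh.1 hh.2))
      have := h.cross _ (hE e) _ (hE e') hne (i + 1) (j + 1) (by omega) (by omega) (by omega)
        (by omega)
      refine ⟨this.1, ?_⟩
      simp [this.2, hee]
  have key : ∀ a b, a ≠ b → φ a ≠ φ b ∧ (G.Adj (φ a) (φ b) ↔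
      (subdivRel (graphOf Y E) (fun _ => r) a b ∨ subdivRel (graphOf Y E) (fun _ => r) b a)) := by
    rintro (u | ⟨e, i⟩) (v | ⟨e', j⟩) hab
    · refine ⟨by simpa [φ] using hab, ?_⟩
      have : ¬ r = 0 := by omega
      simp [φ, h.indep _ (hιY u) _ (hιY v), subdivRel, this]
    · have := hlr u e' j
      refine ⟨this.1, this.2.trans ?_⟩
      simp [subdivRel]
    · have := hlr v e i
      refine ⟨this.1.symm, (G.adj_comm _ _).trans (this.2.trans ?_)⟩
      simp [subdivRel]
    · by_cases hc : e = e' → (i : ℕ) < j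
      · have := hrr e e' i j hc
        refine ⟨this.1, this.2.trans ?_⟩
        simp only [subdivRel]
        constructor
        · exact Or.inl
        · rintro (hh | hh)
          · exact hh
          · have := hc hh.1.symm
            omega
      · push Not at hc
        obtain ⟨rfl, hji⟩ := hc
        have hji' : (j : ℕ) < i := by
          rcases hji.lt_or_eq with h1 | h1
          · exact h1
          · exact absurd (by rw [Fin.ext h1]) hab
        have := hrr e e j i (fun _ => hji')
        refine ⟨this.1.symm, (G.adj_comm _ _).trans (this.2.trans ?_)⟩
        simp only [subdivRel]
        constructor
        · exact Or.inr
        · rintro (hh | hh)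
          · omega
          · exact hh
  refine ⟨⟨⟨φ, fun a b hab => by_contra fun hne => (key a b hne).1 hab⟩, ?_⟩⟩
  intro a b
  change G.Adj (φ a) (φ b) ↔ _
  rw [Subdiv, SimpleGraph.fromRel_adj]
  by_cases hab : a = b
  · subst hab; simp
  · rw [(key a b hab).2]
    simp [hab]

/-- `H` and all its spanning subgraphs belong to the class. -/
def Full (C : GraphClass) {m : ℕ} (H : SimpleGraph (Fin m)) : Prop :=
  ∀ H' ≤ H, H' ∈ C m

theorem exists_graphOf_eq {V : Type*} [LinearOrder V] {Y : Finset V} {E : Finset (V × V)}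
    {H : SimpleGraph (Fin Y.card)} (hH : H ≤ graphOf Y E) :
    ∃ E' ⊆ E, graphOf Y E' = H := by
  refine ⟨E.filter fun e => ∃ i j, H.Adj i j ∧ e = (Y.orderEmbOfFin rfl i, Y.orderEmbOfFin rfl j),
    Finset.filter_subset _ _, ?_⟩
  ext i j
  simp only [graphOf, SimpleGraph.fromRel_adj, Finset.mem_filter, Prod.mk.injEq,
    EmbeddingLike.apply_eq_iff_eq]
  constructor
  · rintro ⟨hij, ⟨_, a, b, hab, rfl, rfl⟩ | ⟨_, a, b, hab, rfl, rfl⟩⟩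
    · exact hab
    · exact hab.symm
  · intro hij
    have h1 := hH hij
    simp only [graphOf, SimpleGraph.fromRel_adj] at h1
    refine ⟨h1.1, h1.2.imp (fun h => ⟨h, i, j, hij, rfl, rfl⟩)
      fun h => ⟨h, j, i, hij.symm, rfl, rfl⟩⟩

theorem PathSys.full {C : GraphClass}
    (hClosed : ∀ (r : ℕ) ⦃n m : ℕ⦄ (G : SimpleGraph (Fin n)) (H : SimpleGraph (Fin m)),
      G ∈ C n → IsInducedSubgraphOf (Subdiv H (fun _ => r)) G → H ∈ C m)
    {n : ℕ} {G : SimpleGraph (Fin n)} (hG : G ∈ C n) {r : ℕ} (hr : 1 ≤ r) {Y : Finset (Fin n)}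
    {E : Finset (Fin n × Fin n)} {x : Fin n × Fin n → ℕ → Fin n} (h : PathSys G r Y E x) :
    Full C (graphOf Y E) := by
  intro H hH
  obtain ⟨E', hE', rfl⟩ := exists_graphOf_eq hH
  exact hClosed r G _ hG ((h.mono hE').subdiv hr)

theorem isSubgraphOf_top_iff {V : Type*} {H : SimpleGraph V} {m : ℕ} :
    IsSubgraphOf (⊤ : SimpleGraph (Fin m)) H ↔ ¬ H.CliqueFree m := by
  rw [SimpleGraph.cliqueFree_iff, not_isEmpty_iff]
  constructor
  · rintro ⟨f, hf⟩
    exact ⟨⟨f, hf⟩⟩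
  · rintro ⟨f⟩
    exact ⟨f.toHom, f.injective⟩

theorem omegaNum_le_of_cliqueFree {V : Type*} {H : SimpleGraph V} {k : ℕ}
    (h : H.CliqueFree (k + 1)) : omegaNum H ≤ k := by
  refine csSup_le' fun m hm => ?_
  by_contra hlt
  exact isSubgraphOf_top_iff.1 hm (h.mono (by omega))

theorem colorable_chi {V : Type*} [Finite V] (H : SimpleGraph V) : H.Colorable (chi H) :=
  have := Fintype.ofFinite V
  Nat.sInf_mem (s := {N | H.Colorable N}) ⟨_, H.colorable_of_fintype⟩

theorem cliqueFree_three_of_lt {V : Type*} [LinearOrder V] {H : SimpleGraph V}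
    (h : ∀ a b c, a < b → b < c → H.Adj a b → H.Adj a c → ¬ H.Adj b c) : H.CliqueFree 3 := by
  intro s hs
  rw [SimpleGraph.is3Clique_iff] at hs
  obtain ⟨a, b, c, hab, hac, hbc, -⟩ := hs
  rcases lt_or_gt_of_ne hab.ne with h1 | h1 <;> rcases lt_or_gt_of_ne hac.ne with h2 | h2 <;>
    rcases lt_or_gt_of_ne hbc.ne with h3 | h3
  · exact h a b c h1 h3 hab hac hbc
  · exact h a c b h2 h3 hac hab hbc.symm
  · exact lt_asymm (h1.trans h3) h2
  · exact h c a b h2 h1 hac.symm hbc.symm hab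
  · exact h b a c h1 h2 hab.symm hbc hac
  · exact lt_asymm (h1.trans h2) h3
  · exact h b c a h3 h2 hbc hab.symm hac.symm
  · exact h c b a h3 h1 hbc.symm hac.symm hab.symm

/-- If all triangle-free spanning subgraphs are `t`-colorable, then `K_k`-free graphs have bounded
chromatic number. -/
theorem exists_colorable_of_cliqueFree (t k : ℕ) : ∃ M : ℕ, ∀ {m : ℕ} (H : SimpleGraph (Fin m)),
    (∀ H' ≤ H, H'.CliqueFree 3 → H'.Colorable t) → H.CliqueFree (k + 2) → H.Colorable M := by
  induction k with
  | zero =>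
    refine ⟨1, fun H _ hf => ⟨SimpleGraph.Coloring.mk (fun _ => 0) ?_⟩⟩
    intro v w hvw
    rw [zero_add, SimpleGraph.cliqueFree_two] at hf
    simp [hf] at hvw
  | succ k ih =>
    obtain ⟨M, hM⟩ := ih
    refine ⟨t ^ M, fun {m} H hT hf => ?_⟩
    let Hv : Fin m → SimpleGraph (Fin m) := fun v =>
      { Adj := fun a b => H.Adj a b ∧ (v < a ∧ H.Adj v a) ∧ (v < b ∧ H.Adj v b)
        symm := ⟨fun a b h => ⟨h.1.symm, h.2.2, h.2.1⟩⟩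
        loopless := ⟨fun a h => H.loopless.irrefl _ h.1⟩ }
    have hle : ∀ v, Hv v ≤ H := fun v a b h => h.1
    have hcol : ∀ v, (Hv v).Colorable M := by
      intro v
      refine hM _ (fun H' hH' => hT H' (hH'.trans (hle v))) ?_
      intro s hs
      refine hf (insert v s) ?_
      refine (hs.mono (hle v)).insert ?_
      intro b hb
      have : 1 < s.card := by rw [hs.card_eq]; omega
      obtain ⟨a, ha, hab⟩ := Finset.exists_mem_ne this b
      exact (hs.isClique hb ha hab.symm).2.1.2
    let κ := fun v => (hcol v).some
    let Hi : Fin M → SimpleGraph (Fin m) := fun i =>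
      SimpleGraph.fromRel fun v w => v < w ∧ H.Adj v w ∧ κ v w = i
    have hi : ∀ i, (Hi i).Colorable t := by
      intro i
      refine hT _ ?_ ?_
      · intro a b h
        rcases h.2 with h | h
        · exact h.2.1
        · exact h.2.1.symm
      · refine cliqueFree_three_of_lt fun a b c hab hbc h1 h2 h3 => ?_
        have key : ∀ a b, a < b → (Hi i).Adj a b → H.Adj a b ∧ κ a b = i := by
          intro a b hab h
          rcases h.2 with h | h
          · exact h.2
          · exact absurd h.1 (lt_asymm hab)
        have k1 := key _ _ hab h1
        have k2 := key _ _ (hab.trans hbc) h2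
        have k3 := key _ _ hbc h3
        exact (κ a).valid (v := b) (w := c) ⟨k3.1, ⟨hab, k1.1⟩, hab.trans hbc, k2.1⟩
          (k1.2.trans k2.2.symm)
    let ν := fun i => (hi i).some
    have : H.Coloring (Fin M → Fin t) := by
      refine SimpleGraph.Coloring.mk (fun v i => ν i v) ?_
      have key : ∀ v w, v < w → H.Adj v w → (fun i => ν i v) ≠ fun i => ν i w := by
        intro v w hlt hvw heq
        refine (ν (κ v w)).valid (v := v) (w := w) ⟨hlt.ne, Or.inl ⟨hlt, hvw, rfl⟩⟩ ?_
        exact congrFun heq _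
      intro v w hvw
      rcases lt_or_gt_of_ne hvw.ne with h | h
      · exact key v w h hvw
      · exact (key w v h hvw.symm).symm
    have h2 := this.colorable
    simpa using h2

theorem shift_bound {N t : ℕ} (col : {p : Fin N × Fin N // p.1 < p.2} → Fin t)
    (h : ∀ p q, p.1.2 = q.1.1 → col p ≠ col q) : N ≤ 2 ^ t := by
  let S : Fin N → Finset (Fin t) := fun i =>
    Finset.univ.filter fun a => ∃ j, ∃ hij : i < j, col ⟨(i, j), hij⟩ = a
  have hS : ∀ i j, i < j → S i ≠ S j := by
    intro i j hij heq
    have h1 : col ⟨(i, j), hij⟩ ∈ S i := by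
      simp only [S, Finset.mem_filter, Finset.mem_univ, true_and]
      exact ⟨j, hij, rfl⟩
    rw [heq] at h1
    simp only [S, Finset.mem_filter, Finset.mem_univ, true_and] at h1
    obtain ⟨k, hk, h2⟩ := h1
    exact h ⟨(i, j), hij⟩ ⟨(j, k), hk⟩ rfl h2.symm
  have hinj : Function.Injective S := by
    intro i j hij
    rcases lt_trichotomy i j with h1 | h1 | h1
    · exact absurd hij (hS _ _ h1)
    · exact h1
    · exact absurd hij.symm (hS _ _ h1)
  simpa using Fintype.card_le_of_injective S hinj

theorem exists_cliqueFree (t : ℕ) : ∃ K : ℕ, ∀ {m : ℕ} (H : SimpleGraph (Fin m)),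
    (∀ H' ≤ H, H'.CliqueFree 3 → H'.Colorable t) → H.CliqueFree K := by
  let N := 2 ^ t + 1
  let P := {p : Fin N × Fin N // p.1 < p.2}
  refine ⟨Fintype.card P, fun {m} H hT => ?_⟩
  by_contra hK
  rw [SimpleGraph.cliqueFree_iff, not_isEmpty_iff] at hK
  obtain ⟨g⟩ := hK
  let e : P → Fin m := fun p => g (Fintype.equivFin P p)
  have he : ∀ p q, p ≠ q → H.Adj (e p) (e q) := by
    intro p q hpq
    refine g.toHom.map_adj ?_
    simpa using hpq
  have hinj : Function.Injective e := by
    intro p q h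
    by_contra hpq
    exact (he p q hpq).ne h
  let H' : SimpleGraph (Fin m) := SimpleGraph.fromRel fun u v => ∃ p q, u = e p ∧ v = e q ∧
    p.1.2 = q.1.1
  have hH'H : H' ≤ H := by
    intro u v huv
    rcases huv.2 with ⟨p, q, rfl, rfl, hpq⟩ | ⟨p, q, rfl, rfl, hpq⟩
    · exact he _ _ fun h => huv.1 (congrArg e h)
    · exact he _ _ fun h => huv.1 (congrArg e h)
  have hadj : ∀ p q, H'.Adj (e p) (e q) → p.1.2 = q.1.1 ∨ q.1.2 = p.1.1 := by
    intro p q h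
    rcases h.2 with ⟨p', q', h1, h2, h3⟩ | ⟨p', q', h1, h2, h3⟩
    · rw [hinj h1, hinj h2]; exact Or.inl h3
    · rw [hinj h1, hinj h2]; exact Or.inr h3
  have hrange : ∀ u v, H'.Adj u v → ∃ p, u = e p := by
    intro u v h
    rcases h.2 with ⟨p', q', h1, h2, h3⟩ | ⟨p', q', h1, h2, h3⟩
    · exact ⟨_, h1⟩
    · exact ⟨_, h2⟩
  have h3 : H'.CliqueFree 3 := by
    intro s hs
    rw [SimpleGraph.is3Clique_iff] at hs
    obtain ⟨a, b, c, hab, hac, hbc, -⟩ := hs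
    obtain ⟨p, rfl⟩ := hrange _ _ hab
    obtain ⟨q, rfl⟩ := hrange _ _ hbc
    obtain ⟨r, rfl⟩ := hrange _ _ hbc.symm
    have hp := p.2
    have hq := q.2
    have hr := r.2
    have h1 := hadj _ _ hab
    have h2 := hadj _ _ hac
    have h3 := hadj _ _ hbc
    simp only [Fin.ext_iff, Fin.lt_def] at h1 h2 h3 hp hq hr
    omega
  obtain ⟨κ⟩ := hT H' hH'H h3
  have := shift_bound (N := N) (fun p => κ (e p)) (fun p q hpq => by
    refine κ.valid ⟨?_, Or.inl ⟨p, q, rfl, rfl, hpq⟩⟩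
    intro h
    have h1 := hinj h
    have h2 := p.2
    rw [hpq, h1] at h2
    exact lt_irrefl _ h2)
  omega

theorem exists_colorable_of_full {C : GraphClass} (hC : ChiBounded C) :
    ∃ M : ℕ, ∀ {m : ℕ} (H : SimpleGraph (Fin m)), Full C H → H.Colorable M := by
  obtain ⟨f, hf⟩ := hC
  let t := max (f 0) (max (f 1) (f 2))
  obtain ⟨K, hK⟩ := exists_cliqueFree t
  obtain ⟨M, hM⟩ := exists_colorable_of_cliqueFree t K
  refine ⟨M, fun H hH => ?_⟩
  have hT : ∀ H' ≤ H, H'.CliqueFree 3 → H'.Colorable t := by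
    intro H' hH' h3
    refine (colorable_chi H').mono ((hf H' (hH H' hH') H' ⟨SimpleGraph.Embedding.refl⟩).trans ?_)
    have := omegaNum_le_of_cliqueFree h3
    interval_cases omegaNum H' <;> simp [t]
  exact hM H hT ((hK H hT).mono (by omega))

/-- The edges of `Q` inside `X`, as increasing pairs. -/
noncomputable def edgesIn {V : Type*} [LinearOrder V] (Q : SimpleGraph V) (X : Finset V) :
    Finset (V × V) :=
  (X ×ˢ X).filter fun e => e.1 < e.2 ∧ Q.Adj e.1 e.2

/-- The degree of `v` into `X`. -/
noncomputable def degIn {V : Type*} (Q : SimpleGraph V) (X : Finset V) (v : V) : ℕ :=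
  (X.filter (Q.Adj v)).card

/-- Every vertex set `X` spans at most `C * |X|` edges. -/
def Sparse {V : Type*} [LinearOrder V] (Q : SimpleGraph V) (C : ℕ) : Prop :=
  ∀ X : Finset V, (edgesIn Q X).card ≤ C * X.card

theorem mem_edgesIn {V : Type*} [LinearOrder V] {Q : SimpleGraph V} {X : Finset V} {e : V × V} :
    e ∈ edgesIn Q X ↔ e.1 ∈ X ∧ e.2 ∈ X ∧ e.1 < e.2 ∧ Q.Adj e.1 e.2 := by
  simp [edgesIn, and_assoc]

theorem sum_degIn {V : Type*} [LinearOrder V] (Q : SimpleGraph V) (X : Finset V) :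
    ∑ v ∈ X, degIn Q X v = 2 * (edgesIn Q X).card := by
  have h1 : ∑ v ∈ X, degIn Q X v = ((X ×ˢ X).filter fun e => Q.Adj e.1 e.2).card := by
    rw [Finset.card_filter, Finset.sum_product]
    refine Finset.sum_congr rfl fun v _ => ?_
    rw [degIn, Finset.card_filter]
  have h2 : ((X ×ˢ X).filter fun e => Q.Adj e.1 e.2) =
      edgesIn Q X ∪ (edgesIn Q X).image Prod.swap := by
    ext ⟨a, b⟩
    simp only [Finset.mem_filter, Finset.mem_product, Finset.mem_union, mem_edgesIn,
      Finset.mem_image, Prod.exists, Prod.swap_prod_mk, Prod.mk.injEq]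
    constructor
    · rintro ⟨⟨ha, hb⟩, hab⟩
      rcases lt_or_gt_of_ne hab.ne with h | h
      · exact Or.inl ⟨ha, hb, h, hab⟩
      · exact Or.inr ⟨b, a, ⟨hb, ha, h, hab.symm⟩, rfl, rfl⟩
    · rintro (⟨ha, hb, h, hab⟩ | ⟨c, d, ⟨ha, hb, h, hab⟩, rfl, rfl⟩)
      · exact ⟨⟨ha, hb⟩, hab⟩
      · exact ⟨⟨hb, ha⟩, hab.symm⟩
  rw [h1, h2, Finset.card_union_of_disjoint, Finset.card_image_of_injective _ Prod.swap_injective]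
  · ring
  · rw [Finset.disjoint_left]
    rintro ⟨a, b⟩ hab hba
    simp only [Finset.mem_image, mem_edgesIn, Prod.exists, Prod.swap_prod_mk,
      Prod.mk.injEq] at hab hba
    obtain ⟨c, d, h, rfl, rfl⟩ := hba
    exact lt_asymm hab.2.2.1 h.2.2.1

theorem card_edgesIn_le_erase {V : Type*} [LinearOrder V] (Q : SimpleGraph V) (X : Finset V)
    (v : V) :
    (edgesIn Q X).card ≤ (edgesIn Q (X.erase v)).card + degIn Q X v := by
  have : edgesIn Q X ⊆ edgesIn Q (X.erase v) ∪
      (X.filter (Q.Adj v)).image fun w => (min v w, max v w) := by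
    rintro ⟨a, b⟩ h
    rw [mem_edgesIn] at h
    obtain ⟨ha, hb, hab, hadj⟩ := h
    rw [Finset.mem_union]
    by_cases hav : a = v
    · subst hav
      right
      simp only [Finset.mem_image, Finset.mem_filter]
      exact ⟨b, ⟨hb, hadj⟩, by simp only [min_eq_left hab.le, max_eq_right hab.le]⟩
    · by_cases hbv : b = v
      · subst hbv
        right
        simp only [Finset.mem_image, Finset.mem_filter]
        exact ⟨a, ⟨ha, hadj.symm⟩, by simp only [min_eq_right hab.le, max_eq_left hab.le]⟩
      · left
        rw [mem_edgesIn]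
        exact ⟨Finset.mem_erase.2 ⟨hav, ha⟩, Finset.mem_erase.2 ⟨hbv, hb⟩, hab, hadj⟩
  refine (Finset.card_le_card this).trans ((Finset.card_union_le _ _).trans ?_)
  exact Nat.add_le_add_left Finset.card_image_le _

theorem exists_order_of_sparse {V : Type*} [LinearOrder V] [Fintype V] {Q : SimpleGraph V} {C : ℕ}
    (h : Sparse Q C) : ∃ f : V → ℕ, Function.Injective f ∧
      ∀ v, (Finset.univ.filter fun u => Q.Adj u v ∧ f u < f v).card ≤ 2 * C := by
  have key : ∀ k (X : Finset V), X.card = k → ∃ f : V → ℕ, Set.InjOn f X ∧ (∀ v ∈ X, f v < k) ∧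
      ∀ v ∈ X, (X.filter fun u => Q.Adj u v ∧ f u < f v).card ≤ 2 * C := by
    intro k
    induction k with
    | zero =>
      intro X hX
      rw [Finset.card_eq_zero] at hX
      subst hX
      exact ⟨fun _ => 0, by simp⟩
    | succ k ih =>
      intro X hX
      have : ∃ v ∈ X, degIn Q X v ≤ 2 * C := by
        by_contra! hcon
        have h1 : ∑ v ∈ X, 2 * C < ∑ v ∈ X, degIn Q X v :=
          Finset.sum_lt_sum_of_nonempty (Finset.card_pos.1 (by omega)) hcon
        rw [sum_degIn, Finset.sum_const, smul_eq_mul] at h1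
        have := h X
        nlinarith
      obtain ⟨v, hv, hdeg⟩ := this
      have hcard : (X.erase v).card = k := by rw [Finset.card_erase_of_mem hv]; omega
      obtain ⟨f, hf1, hf2, hf3⟩ := ih (X.erase v) hcard
      have hne : ∀ u ∈ X, u ≠ v → Function.update f v k u = f u ∧ f u < k := by
        intro u hu huv
        exact ⟨Function.update_of_ne huv _ _, hf2 u (Finset.mem_erase.2 ⟨huv, hu⟩)⟩
      refine ⟨Function.update f v k, ?_, ?_, ?_⟩
      · intro a ha b hb hab
        by_cases hav : a = v
        · by_cases hbv : b = v
          · rw [hav, hbv]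
          · have := hne b hb hbv
            rw [this.1, hav, Function.update_self] at hab
            omega
        · have h1 := hne a ha hav
          by_cases hbv : b = v
          · rw [h1.1, hbv, Function.update_self] at hab
            omega
          · have h2 := hne b hb hbv
            rw [h1.1, h2.1] at hab
            exact hf1 (Finset.mem_erase.2 ⟨hav, ha⟩) (Finset.mem_erase.2 ⟨hbv, hb⟩) hab
      · intro u hu
        by_cases huv : u = v
        · rw [huv, Function.update_self]; omega
        · have := hne u hu huv
          omega
      · intro u hu
        by_cases huv : u = v
        · refine (Finset.card_le_card ?_).trans hdeg
          intro w hw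
          simp only [Finset.mem_filter] at hw ⊢
          exact ⟨hw.1, huv ▸ hw.2.1.symm⟩
        · refine (Finset.card_le_card ?_).trans (hf3 u (Finset.mem_erase.2 ⟨huv, hu⟩))
          intro w hw
          simp only [Finset.mem_filter] at hw ⊢
          have h1 := hne u hu huv
          by_cases hwv : w = v
          · rw [hwv, Function.update_self] at hw
            omega
          · have h2 := hne w hw.1 hwv
            rw [h1.1, h2.1] at hw
            exact ⟨Finset.mem_erase.2 ⟨hwv, hw.1⟩, hw.2⟩
  obtain ⟨f, hf1, -, hf3⟩ := key _ Finset.univ rfl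
  exact ⟨f, fun a b hab => hf1 (Finset.mem_coe.2 (Finset.mem_univ a))
    (Finset.mem_coe.2 (Finset.mem_univ b)) hab, fun v => hf3 v (Finset.mem_univ v)⟩

theorem exists_greedy {V : Type*} [Fintype V] (f : V → ℕ) (N : V → Finset V) (B : ℕ)
    (hN : ∀ v, ∀ u ∈ N v, f u < f v) (hB : ∀ v, (N v).card ≤ B) :
    ∃ ψ : V → Fin (B + 1), ∀ v, ∀ u ∈ N v, ψ u ≠ ψ v := by
  have key : ∀ k, ∃ ψ : V → Fin (B + 1), ∀ v, f v < k → ∀ u ∈ N v, ψ u ≠ ψ v := by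
    intro k
    induction k with
    | zero => exact ⟨fun _ => 0, fun v hv => absurd hv (by omega)⟩
    | succ k ih =>
      obtain ⟨ψ, hψ⟩ := ih
      have : ∀ v, ∃ x, x ∉ (N v).image ψ := by
        intro v
        by_contra! hcon
        have h1 : (N v).image ψ = Finset.univ := Finset.eq_univ_iff_forall.2 hcon
        have h2 := Finset.card_image_le (s := N v) (f := ψ)
        rw [h1, Finset.card_univ, Fintype.card_fin] at h2
        have := hB v
        omega
      choose x hx using this
      refine ⟨fun v => if f v = k then x v else ψ v, fun v hv u hu => ?_⟩
      have huv := hN v u hu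
      have hu' : f u ≠ k := by omega
      simp only [hu', if_false]
      split_ifs with h
      · exact fun heq => hx v (Finset.mem_image.2 ⟨u, hu, heq⟩)
      · exact hψ v (by omega) u hu
  obtain ⟨ψ, hψ⟩ := key (Finset.univ.sup f + 1)
  exact ⟨ψ, fun v => hψ v (Nat.lt_succ_of_le (Finset.le_sup (Finset.mem_univ v)))⟩

theorem fair_sampling {V ι : Type*} [Fintype V] [DecidableEq V]
    (E : Finset ι) (In Out : ι → Finset V)
    (m N : ℕ) (hdisj : ∀ e ∈ E, Disjoint (In e) (Out e))
    (hcard : ∀ e ∈ E, (In e).card + (Out e).card ≤ m)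
    (h : ∀ Z : Finset V, (E.filter fun e => In e ⊆ Z ∧ Disjoint (Out e) Z).card ≤ N) :
    E.card ≤ 2 ^ m * N := by
  have h1 : ∀ e ∈ E, 2 ^ Fintype.card V ≤ 2 ^ m *
      ((Finset.univ : Finset (Finset V)).filter fun Z => In e ⊆ Z ∧ Disjoint (Out e) Z).card := by
    intro e he
    have h2 : ((Finset.univ : Finset (Finset V)).filter fun Z => In e ⊆ Z ∧ Disjoint (Out e) Z) =
        Finset.Icc (In e) (Out e)ᶜ := by
      ext Z
      simp only [Finset.mem_filter, Finset.mem_univ, true_and, Finset.mem_Icc]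
      rw [← Finset.subset_compl_iff_disjoint_left]
    rw [h2, Finset.card_Icc_finset (Finset.subset_compl_iff_disjoint_right.2 (hdisj e he)),
      Finset.card_compl, ← pow_add]
    refine Nat.pow_le_pow_right (by norm_num) ?_
    have := hcard e he
    omega
  have h3 : ∑ e ∈ E, ((Finset.univ : Finset (Finset V)).filter fun Z =>
      In e ⊆ Z ∧ Disjoint (Out e) Z).card ≤ 2 ^ Fintype.card V * N := by
    simp_rw [Finset.card_filter]
    rw [Finset.sum_comm]
    calc _ ≤ ∑ Z : Finset V, N := Finset.sum_le_sum fun Z _ => by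
            rw [← Finset.card_filter]; exact h Z
      _ = _ := by simp
  have h4 : E.card * 2 ^ Fintype.card V ≤ 2 ^ m * (2 ^ Fintype.card V * N) := by
    calc E.card * 2 ^ Fintype.card V = ∑ e ∈ E, 2 ^ Fintype.card V := by simp
      _ ≤ ∑ e ∈ E, 2 ^ m * _ := Finset.sum_le_sum h1
      _ = 2 ^ m * _ := (Finset.mul_sum _ _ _).symm
      _ ≤ _ := Nat.mul_le_mul_left _ h3
  have h5 : 0 < 2 ^ Fintype.card V := by positivity
  nlinarith

theorem bernoulli_nat (q b c : ℕ) (h : c + b = q + 1) : (q + 1) ^ b * c ≤ q ^ b * (q + 1) := by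
  induction b generalizing c with
  | zero => simp at h; simp [h]
  | succ b ih =>
    have h1 := ih (c + 1) (by omega)
    have h2 : (q + 1) * c ≤ q * (c + 1) := by nlinarith
    calc (q + 1) ^ (b + 1) * c = (q + 1) ^ b * ((q + 1) * c) := by ring
      _ ≤ (q + 1) ^ b * (q * (c + 1)) := Nat.mul_le_mul_left _ h2
      _ = q * ((q + 1) ^ b * (c + 1)) := by ring
      _ ≤ q * (q ^ b * (q + 1)) := Nat.mul_le_mul_left _ h1
      _ = _ := by ring

theorem card_sampling {V : Type*} [Fintype V] [DecidableEq V] (q : ℕ) (A B : Finset V)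
    (h : Disjoint A B) :
    ((Finset.univ : Finset (V → Fin (q + 1))).filter fun g =>
      (∀ v ∈ A, g v = 0) ∧ ∀ v ∈ B, g v ≠ 0).card * (q + 1) ^ (A.card + B.card) =
      (q + 1) ^ Fintype.card V * q ^ B.card := by
  have h1 : ((Finset.univ : Finset (V → Fin (q + 1))).filter fun g =>
      (∀ v ∈ A, g v = 0) ∧ ∀ v ∈ B, g v ≠ 0) = Fintype.piFinset fun v =>
        if v ∈ A then {0} else if v ∈ B then {0}ᶜ else Finset.univ := by
    ext g
    simp only [Finset.mem_filter, Finset.mem_univ, true_and, Fintype.mem_piFinset]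
    constructor
    · rintro ⟨hA, hB⟩ v
      split_ifs with h1 h2
      · simpa using hA v h1
      · simpa using hB v h2
      · simp
    · intro hg
      refine ⟨fun v hv => ?_, fun v hv => ?_⟩
      · have := hg v
        rw [if_pos hv] at this
        simpa using this
      · have := hg v
        rw [if_neg (fun h' => Finset.disjoint_left.1 h h' hv), if_pos hv] at this
        simpa using this
  have h2 : (q + 1) ^ (A.card + B.card) = ∏ v : V, if v ∈ A ∪ B then (q + 1) else 1 := by
    rw [Finset.prod_ite_mem, Finset.univ_inter, Finset.prod_const, Finset.card_union_of_disjoint h]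
  have h3 : q ^ B.card = ∏ v : V, if v ∈ B then q else 1 := by
    rw [Finset.prod_ite_mem, Finset.univ_inter, Finset.prod_const]
  have h4 : (q + 1) ^ Fintype.card V = ∏ v : V, (q + 1) := by simp
  rw [h1, Fintype.card_piFinset, h2, h3, h4, ← Finset.prod_mul_distrib, ← Finset.prod_mul_distrib]
  refine Finset.prod_congr rfl fun v _ => ?_
  have : v ∈ A → v ∉ B := fun h' => Finset.disjoint_left.1 h h'
  by_cases hA : v ∈ A
  · simp [hA, this hA]
  · by_cases hB : v ∈ B
    · simp [hA, hB, Finset.card_compl, mul_comm]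
    · simp [hA, hB]

theorem biased_sampling {V ι : Type*} [Fintype V] [DecidableEq V]
    (E : Finset ι) (In Out : ι → Finset V)
    (X : Finset V) (m q D : ℕ) (hdisj : ∀ e ∈ E, Disjoint (In e) (Out e))
    (hIn : ∀ e ∈ E, (In e).card = 2)
    (hcard : ∀ e ∈ E, (Out e).card ≤ m) (hm : 2 * m ≤ q + 1)
    (h : ∀ Z : Finset V, (E.filter fun e => In e ⊆ Z ∧ Disjoint (Out e) Z).card ≤
      D * (X ∩ Z).card) :
    E.card ≤ 2 * (q + 1) * D * X.card := by
  let Z : (V → Fin (q + 1)) → Finset V := fun g => Finset.univ.filter fun v => g v = 0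
  let n := Fintype.card V
  have h1 : ∀ e ∈ E, (q + 1) ^ n ≤ 2 * (q + 1) ^ 2 *
      ((Finset.univ : Finset (V → Fin (q + 1))).filter fun g =>
        In e ⊆ Z g ∧ Disjoint (Out e) (Z g)).card := by
    intro e he
    have h2 := card_sampling q (In e) (Out e) (hdisj e he)
    have h3 : ((Finset.univ : Finset (V → Fin (q + 1))).filter fun g =>
        In e ⊆ Z g ∧ Disjoint (Out e) (Z g)) =
        (Finset.univ : Finset (V → Fin (q + 1))).filter fun g =>
          (∀ v ∈ In e, g v = 0) ∧ ∀ v ∈ Out e, g v ≠ 0 := by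
      ext g
      simp only [Finset.mem_filter, Finset.mem_univ, true_and, Finset.subset_iff,
        Finset.disjoint_left, Z, ne_eq]
    rw [h3]
    set c := ((Finset.univ : Finset (V → Fin (q + 1))).filter fun g =>
          (∀ v ∈ In e, g v = 0) ∧ ∀ v ∈ Out e, g v ≠ 0).card
    rw [hIn e he] at h2
    set b := (Out e).card
    have hb : b ≤ m := hcard e he
    have h4 := bernoulli_nat q b (q + 1 - b) (by omega)
    have h5 : (q + 1) ^ b ≤ 2 * q ^ b := by
      have h6 : (q + 1) ^ b * (q + 1) ≤ (2 * q ^ b) * (q + 1) := by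
        calc (q + 1) ^ b * (q + 1) ≤ (q + 1) ^ b * (2 * (q + 1 - b)) :=
              Nat.mul_le_mul_left _ (by omega)
          _ = 2 * ((q + 1) ^ b * (q + 1 - b)) := by ring
          _ ≤ 2 * (q ^ b * (q + 1)) := Nat.mul_le_mul_left _ h4
          _ = _ := by ring
      exact Nat.le_of_mul_le_mul_right h6 (by omega)
    have h6 : (q + 1) ^ n * (q + 1) ^ b ≤ (2 * (q + 1) ^ 2 * c) * (q + 1) ^ b := by
      calc (q + 1) ^ n * (q + 1) ^ b ≤ (q + 1) ^ n * (2 * q ^ b) := Nat.mul_le_mul_left _ h5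
        _ = 2 * ((q + 1) ^ n * q ^ b) := by ring
        _ = 2 * (c * (q + 1) ^ (2 + b)) := by rw [h2]
        _ = _ := by rw [pow_add]; ring
    exact Nat.le_of_mul_le_mul_right h6 (by positivity)
  have h3 : (q + 1) * ∑ e ∈ E, ((Finset.univ : Finset (V → Fin (q + 1))).filter fun g =>
        In e ⊆ Z g ∧ Disjoint (Out e) (Z g)).card ≤ D * (X.card * (q + 1) ^ n) := by
    simp_rw [Finset.card_filter]
    rw [Finset.sum_comm]
    have h4 : ∑ g : V → Fin (q + 1), ∑ e ∈ E,
        (if In e ⊆ Z g ∧ Disjoint (Out e) (Z g) then 1 else 0) ≤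
        ∑ g : V → Fin (q + 1), D * (X ∩ Z g).card := Finset.sum_le_sum fun g _ => by
            rw [← Finset.card_filter]; exact h (Z g)
    have h5 : (q + 1) * ∑ g : V → Fin (q + 1), (X ∩ Z g).card = X.card * (q + 1) ^ n := by
      have h6 : ∀ g, (X ∩ Z g).card = ∑ v ∈ X, if g v = 0 then 1 else 0 := by
        intro g
        rw [← Finset.card_filter]
        congr 1
        ext v
        simp [Z]
      simp_rw [h6]
      rw [Finset.sum_comm, Finset.mul_sum]
      rw [Finset.sum_congr rfl (g := fun _ => (q + 1) ^ n), Finset.sum_const, smul_eq_mul]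
      intro v _
      have := card_sampling q {v} ∅ (by simp)
      simp only [Finset.mem_singleton, forall_eq, Finset.notMem_empty, false_imp_iff,
        implies_true, and_true, Finset.card_singleton, Finset.card_empty, add_zero, pow_one,
        pow_zero, mul_one] at this
      rw [← Finset.card_filter, mul_comm, this]
    calc _ ≤ (q + 1) * ∑ g : V → Fin (q + 1), D * (X ∩ Z g).card := Nat.mul_le_mul_left _ h4
      _ = D * ((q + 1) * ∑ g : V → Fin (q + 1), (X ∩ Z g).card) := by
          rw [← Finset.mul_sum]; ring
      _ = _ := by rw [h5]
  have h4 : E.card * (q + 1) ^ n ≤ 2 * (q + 1) ^ 2 * ∑ e ∈ E,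
      ((Finset.univ : Finset (V → Fin (q + 1))).filter fun g =>
        In e ⊆ Z g ∧ Disjoint (Out e) (Z g)).card := by
    rw [Finset.mul_sum]
    calc E.card * (q + 1) ^ n = ∑ e ∈ E, (q + 1) ^ n := by simp
      _ ≤ _ := Finset.sum_le_sum h1
  have h5 : E.card * (q + 1) ^ n ≤ (2 * (q + 1) * D * X.card) * (q + 1) ^ n := by
    calc _ ≤ _ := h4
      _ = 2 * (q + 1) * ((q + 1) * ∑ e ∈ E,
      ((Finset.univ : Finset (V → Fin (q + 1))).filter fun g =>
        In e ⊆ Z g ∧ Disjoint (Out e) (Z g)).card) := by ring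
      _ ≤ 2 * (q + 1) * (D * (X.card * (q + 1) ^ n)) := Nat.mul_le_mul_left _ h3
      _ = _ := by ring
  exact Nat.le_of_mul_le_mul_right h5 (by positivity)

theorem exists_pow_gap (c L : ℕ) (hL : 1 ≤ L) : ∃ K : ℕ, c * (L - 1) ^ K < L ^ K := by
  have hL' : (0 : ℝ) < L := by exact_mod_cast hL
  obtain ⟨K, hK⟩ := exists_pow_lt_of_lt_one (x := 1 / ((c : ℝ) + 1)) (by positivity)
    (y := ((L - 1 : ℕ) : ℝ) / L) (by rw [div_lt_one hL']; exact_mod_cast (by omega))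
  refine ⟨K, ?_⟩
  rw [div_pow, div_lt_div_iff₀ (by positivity) (by positivity)] at hK
  have h2 : (L - 1) ^ K * (c + 1) < 1 * L ^ K := by exact_mod_cast hK
  nlinarith [Nat.zero_le ((L - 1) ^ K)]

/-- If each vertex of `A` has more than `c` neighbours in `B`, one can select for each vertex of
`A` a pair of its neighbours so that few `c`-colorings of `B` are proper on all pairs. -/
theorem exists_pairs {V : Type*} [LinearOrder V] (H : SimpleGraph V) (c : ℕ) (hc : 1 ≤ c)
    (B A : Finset V)
    (hdeg : ∀ a ∈ A, c + 1 ≤ degIn H B a) :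
    ∃ p : V → V × V, (∀ a ∈ A, (p a).1 ∈ B ∧ (p a).2 ∈ B ∧ (p a).1 < (p a).2 ∧
        H.Adj (p a).1 a ∧ H.Adj a (p a).2) ∧
      ∃ S : Finset (B → Fin c), (∀ κ, κ ∈ S ↔ ∀ a ∈ A, ∀ x y : B, p a = (↑x, ↑y) → κ x ≠ κ y) ∧
        S.card * ((c + 1) ^ 2) ^ A.card ≤ c ^ B.card * ((c + 1) ^ 2 - 1) ^ A.card := by
  induction A using Finset.induction_on with
  | empty =>
    exact ⟨fun a => (a, a), by simp, Finset.univ, by simp, by simp⟩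
  | insert a A ha ih =>
    obtain ⟨p, hp, S, hS, hcard⟩ := ih fun x hx => hdeg x (Finset.mem_insert_of_mem hx)
    set L := (c + 1) ^ 2 with hL
    have hda := hdeg a (Finset.mem_insert_self _ _)
    obtain ⟨T, hT, hTc⟩ := Finset.exists_subset_card_eq hda
    have hTB : ∀ x ∈ T, x ∈ B ∧ H.Adj a x := fun x hx => Finset.mem_filter.1 (hT hx)
    let P := (T ×ˢ T).filter fun e => e.1 < e.2
    let Mono : V × V → Finset (B → Fin c) := fun e => S.filter fun κ =>
      ∃ x y : B, e = (↑x, ↑y) ∧ κ x = κ y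
    have hPc : P.card ≤ L := by
      refine (Finset.card_filter_le _ _).trans ?_
      rw [Finset.card_product, hTc, hL, sq]
    have hmono : ∀ κ : B → Fin c, ∃ e ∈ P, ∃ x y : B, e = (↑x, ↑y) ∧ κ x = κ y := by
      intro κ
      have : ∃ x ∈ T.attach, ∃ y ∈ T.attach,
          x ≠ y ∧ κ ⟨x, (hTB x x.2).1⟩ = κ ⟨y, (hTB y y.2).1⟩ := by
        refine Finset.exists_ne_map_eq_of_card_lt_of_maps_to (t := (Finset.univ : Finset (Fin c)))
          ?_ (fun x _ => Finset.mem_univ _)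
        rw [Finset.card_attach, hTc, Finset.card_univ, Fintype.card_fin]
        omega
      obtain ⟨x, -, y, -, hxy, hκ⟩ := this
      rcases lt_or_gt_of_ne hxy with h | h
      · exact ⟨(x, y), by simp [P]; exact h, ⟨x, (hTB x x.2).1⟩, ⟨y, (hTB y y.2).1⟩, rfl, hκ⟩
      · exact ⟨(y, x), by simp [P]; exact h, ⟨y, (hTB y y.2).1⟩, ⟨x, (hTB x x.2).1⟩, rfl, hκ.symm⟩
    have hsum : S.card ≤ ∑ e ∈ P, (Mono e).card := by
      have : S ⊆ P.biUnion Mono := by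
        intro κ hκ
        obtain ⟨e, he, h⟩ := hmono κ
        exact Finset.mem_biUnion.2 ⟨e, he, Finset.mem_filter.2 ⟨hκ, h⟩⟩
      exact (Finset.card_le_card this).trans Finset.card_biUnion_le
    have hPne : P.Nonempty := by
      obtain ⟨e, he, _⟩ := hmono fun _ => ⟨0, hc⟩
      exact ⟨e, he⟩
    have hex : ∃ e ∈ P, S.card ≤ L * (Mono e).card := by
      by_contra! hcon
      have h1 : ∑ e ∈ P, L * (Mono e).card < ∑ e ∈ P, S.card :=
        Finset.sum_lt_sum_of_nonempty hPne hcon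
      rw [← Finset.mul_sum, Finset.sum_const, smul_eq_mul] at h1
      have h2 := Nat.mul_le_mul_right S.card hPc
      have h3 := Nat.mul_le_mul_left L hsum
      omega
    obtain ⟨e, he, heS⟩ := hex
    have heP : e.1 ∈ T ∧ e.2 ∈ T ∧ e.1 < e.2 := by
      simpa [P, and_assoc] using he
    have hup : ∀ x ∈ A, Function.update p a e x = p x := fun x hx =>
      Function.update_of_ne (by rintro rfl; exact ha hx) _ _
    refine ⟨Function.update p a e, ?_, Finset.univ.filter fun κ => ∀ b ∈ insert a A, ∀ x y : B,
        Function.update p a e b = (↑x, ↑y) → κ x ≠ κ y, by simp, ?_⟩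
    · intro x hx
      rcases Finset.mem_insert.1 hx with rfl | hx
      · rw [Function.update_self]
        exact ⟨(hTB _ heP.1).1, (hTB _ heP.2.1).1, heP.2.2, (hTB _ heP.1).2.symm,
          (hTB _ heP.2.1).2⟩
      · rw [hup x hx]
        exact hp x hx
    · set S' := (Finset.univ : Finset (B → Fin c)).filter fun κ => ∀ b ∈ insert a A, ∀ x y : B,
        Function.update p a e b = (↑x, ↑y) → κ x ≠ κ y with hS'
      have h1 : S' ⊆ S \ Mono e := by
        intro κ hκ
        simp only [hS', Finset.mem_filter, Finset.mem_univ, true_and] at hκ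
        simp only [Mono, Finset.mem_sdiff, hS, Finset.mem_filter,
          not_and, not_exists]
        refine ⟨fun b hb x y h => hκ b (Finset.mem_insert_of_mem hb) x y (by rw [hup b hb, h]),
          fun _ x y hxy => hκ a (Finset.mem_insert_self _ _) x y
            (by rw [Function.update_self, hxy])⟩
      have h2 : S'.card + (Mono e).card ≤ S.card := by
        have := Finset.card_le_card h1
        rw [Finset.card_sdiff_of_subset (show Mono e ⊆ S from Finset.filter_subset _ _)] at this
        have h3 : (Mono e).card ≤ S.card := Finset.card_filter_le _ _
        omega
      have h3 : S'.card * L ≤ S.card * (L - 1) := by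
        have hL1 : 1 ≤ L := Nat.one_le_pow _ _ (by omega)
        obtain ⟨l, hl⟩ := Nat.exists_eq_add_of_le hL1
        rw [hl] at heS ⊢
        simp only [Nat.add_sub_cancel_left]
        nlinarith
      rw [Finset.card_insert_of_notMem ha]
      calc S'.card * L ^ (A.card + 1) = (S'.card * L) * L ^ A.card := by ring
        _ ≤ (S.card * (L - 1)) * L ^ A.card := Nat.mul_le_mul_right _ h3
        _ = (S.card * L ^ A.card) * (L - 1) := by ring
        _ ≤ (c ^ B.card * (L - 1) ^ A.card) * (L - 1) := Nat.mul_le_mul_right _ hcard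
        _ = _ := by ring

theorem card_bound_false {c L K a b N : ℕ} (hK : c * (L - 1) ^ K < L ^ K) (hab : K * b ≤ a)
    (hb : 1 ≤ b) (hL : 1 ≤ L) (hN : N * L ^ a ≤ c ^ b * (L - 1) ^ a) : N = 0 := by
  by_contra h0
  have h1 : L ^ a ≤ c ^ b * (L - 1) ^ a := (Nat.le_mul_of_pos_left _ (by omega)).trans hN
  obtain ⟨d, rfl⟩ := Nat.exists_eq_add_of_le hab
  have h2 : c ^ b * (L - 1) ^ (K * b + d) = (c * (L - 1) ^ K) ^ b * (L - 1) ^ d := by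
    rw [mul_pow, ← pow_mul, pow_add]; ring
  have h3 : (c * (L - 1) ^ K) ^ b < (L ^ K) ^ b := Nat.pow_lt_pow_left hK (by omega)
  have h4 : (L - 1) ^ d ≤ L ^ d := Nat.pow_le_pow_left (by omega) _
  have h5 : L ^ (K * b + d) = (L ^ K) ^ b * L ^ d := by rw [pow_add, pow_mul]
  rw [h2, h5] at h1
  have h6 : 0 < L ^ d := by positivity
  have h7 := Nat.mul_le_mul_left ((c * (L - 1) ^ K) ^ b) h4
  have h8 := Nat.mul_lt_mul_of_pos_right h3 h6
  omega

theorem exists_min_dense {V : Type*} [LinearOrder V] {Q : SimpleGraph V} {D : ℕ}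
    (h : ¬ Sparse Q D) : ∃ W : Finset V, W.Nonempty ∧ ∀ v ∈ W, D < degIn Q W v := by
  have hex : ∃ k, ∃ W : Finset V, W.card = k ∧ D * W.card < (edgesIn Q W).card := by
    simp only [Sparse, not_forall, not_le] at h
    obtain ⟨W, hW⟩ := h
    exact ⟨_, W, rfl, hW⟩
  obtain ⟨W, hWk, hW⟩ := Nat.find_spec hex
  refine ⟨W, ?_, fun v hv => ?_⟩
  · rw [Finset.nonempty_iff_ne_empty]
    rintro rfl
    simp [edgesIn] at hW
  · by_contra! hdeg
    have h1 := card_edgesIn_le_erase Q W v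
    have h2 := Finset.card_erase_add_one hv
    refine Nat.find_min hex (m := (W.erase v).card) (by omega) ⟨_, rfl, ?_⟩
    rw [← h2] at hW
    nlinarith

theorem exists_dense_split {V : Type*} [LinearOrder V] (H : SimpleGraph V) (c K : ℕ)
    (hc : 1 ≤ c) (W : Finset V) (hW : W.Nonempty)
    (hdeg : ∀ v ∈ W, 4 * (c + 1) * (K + 1) + (c + 1) < degIn H W v) :
    ∃ A B : Finset V, Disjoint A B ∧ 1 ≤ B.card ∧ K * B.card ≤ A.card ∧
      ∀ a ∈ A, c + 1 ≤ degIn H B a := by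
  set t := c + 1 with ht
  set τ := 2 * t * (K + 1) with hτ
  let Φ : Finset V → ℕ := fun B => ∑ a ∈ W, min t (degIn H B a)
  obtain ⟨B, hB, hmax⟩ := Finset.exists_max_image
    (W.powerset.filter fun B => τ * B.card ≤ Φ B) Finset.card ⟨∅, by simp⟩
  simp only [Finset.mem_filter, Finset.mem_powerset, and_imp] at hB hmax
  obtain ⟨hBW, hBΦ⟩ := hB
  set U := W.filter fun a => degIn H B a < t with hU
  have hUb : ∀ b ∈ W \ B, (U.filter (H.Adj b)).card ≤ τ := by
    intro b hb
    rw [Finset.mem_sdiff] at hb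
    by_contra! hcon
    have h1 : Φ B + (U.filter (H.Adj b)).card ≤ Φ (insert b B) := by
      have h2 : (U.filter (H.Adj b)).card =
          ∑ a ∈ W, if (degIn H B a < t ∧ H.Adj b a) then 1 else 0 := by
        rw [← Finset.card_filter, hU, Finset.filter_filter]
      rw [h2, ← Finset.sum_add_distrib]
      refine Finset.sum_le_sum fun a _ => ?_
      have h3 : degIn H B a ≤ degIn H (insert b B) a :=
        Finset.card_le_card (Finset.filter_subset_filter _ (Finset.subset_insert _ _))
      split_ifs with h
      · have h4 : degIn H (insert b B) a = degIn H B a + 1 := by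
          rw [degIn, Finset.filter_insert, if_pos h.2.symm, Finset.card_insert_of_notMem, degIn]
          exact fun h5 => hb.2 (Finset.mem_filter.1 h5).1
        rw [h4, min_eq_right h.1.le]
        omega
      · exact Nat.add_le_of_le_sub' (by omega) (by omega)
    have h5 := hmax (insert b B) (Finset.insert_subset hb.1 hBW) (by
      rw [Finset.card_insert_of_notMem hb.2]
      nlinarith)
    rw [Finset.card_insert_of_notMem hb.2] at h5
    omega
  have hUW : 2 * U.card ≤ W.card := by
    have h1 : ∀ u ∈ U, 2 * τ ≤ ((W \ B).filter (H.Adj u)).card := by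
      intro u hu
      rw [hU, Finset.mem_filter] at hu
      have h2 := hdeg u hu.1
      have h3 : degIn H W u ≤ degIn H B u + ((W \ B).filter (H.Adj u)).card := by
        rw [degIn, degIn]
        refine (Finset.card_le_card ?_).trans (Finset.card_union_le _ _)
        intro x hx
        simp only [Finset.mem_union, Finset.mem_filter, Finset.mem_sdiff] at hx ⊢
        tauto
      have h4 : 4 * t * (K + 1) = 2 * τ := by rw [hτ]; ring
      omega
    have h2 : ∑ u ∈ U, ((W \ B).filter (H.Adj u)).card =
        ∑ b ∈ W \ B, (U.filter (H.Adj b)).card := by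
      simp_rw [Finset.card_filter]
      rw [Finset.sum_comm]
      simp_rw [H.adj_comm]
    have h3 := Finset.sum_le_sum h1
    have h4 := Finset.sum_le_sum hUb
    rw [h2] at h3
    simp only [Finset.sum_const, smul_eq_mul] at h3 h4
    have h5 : (W \ B).card ≤ W.card := Finset.card_le_card Finset.sdiff_subset
    have h6 : 0 < τ := by positivity
    have h7 : (2 * U.card) * τ ≤ W.card * τ := by nlinarith
    exact Nat.le_of_mul_le_mul_right h7 h6
  have hBc : 2 * (K + 1) * B.card ≤ W.card := by
    have h1 : Φ B ≤ W.card * t := by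
      rw [← smul_eq_mul, ← Finset.sum_const]
      exact Finset.sum_le_sum fun a _ => min_le_left _ _
    have h2 : (2 * (K + 1) * B.card) * t ≤ W.card * t := by
      calc _ = τ * B.card := by rw [hτ]; ring
        _ ≤ _ := hBΦ.trans h1
    exact Nat.le_of_mul_le_mul_right h2 (by omega)
  have hA : W.card ≤ (W \ (U ∪ B)).card + U.card + B.card := by
    have h1 : W ⊆ (W \ (U ∪ B)) ∪ (U ∪ B) := by
      intro x hx
      simp only [Finset.mem_union, Finset.mem_sdiff]
      tauto
    have h2 := Finset.card_le_card h1
    have h3 := Finset.card_union_le (W \ (U ∪ B)) (U ∪ B)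
    have h4 := Finset.card_union_le U B
    omega
  have hAdeg : ∀ a ∈ W \ (U ∪ B), t ≤ degIn H B a := by
    intro a ha
    simp only [hU, Finset.mem_sdiff, Finset.mem_union, Finset.mem_filter, not_or, not_and,
      not_lt] at ha
    exact ha.2.1 ha.1
  have hWpos := Finset.card_pos.2 hW
  have hBpos : 1 ≤ B.card := by
    by_contra! h0
    have hB0 : B = ∅ := Finset.card_eq_zero.1 (by omega)
    have : 0 < (W \ (U ∪ B)).card := by omega
    obtain ⟨a, ha⟩ := Finset.card_pos.1 this
    have := hAdeg a ha
    rw [hB0] at this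
    simp [degIn] at this
  refine ⟨W \ (U ∪ B), B, ?_, hBpos, ?_, hAdeg⟩
  · exact Finset.disjoint_left.2 fun x hx hxB =>
      (Finset.mem_sdiff.1 hx).2 (Finset.mem_union_right _ hxB)
  · nlinarith

theorem exists_sparse_of_full {C : GraphClass} (hC : ChiBounded C)
    (hClosed : ∀ (r : ℕ) ⦃n m : ℕ⦄ (G : SimpleGraph (Fin n)) (H : SimpleGraph (Fin m)),
      G ∈ C n → IsInducedSubgraphOf (Subdiv H (fun _ => r)) G → H ∈ C m) :
    ∃ D : ℕ, ∀ {m : ℕ} (H : SimpleGraph (Fin m)), Full C H → Sparse H D := by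
  obtain ⟨M, hM⟩ := exists_colorable_of_full hC
  set c := M + 1 with hc
  obtain ⟨K, hK⟩ := exists_pow_gap c ((c + 1) ^ 2) (Nat.one_le_pow _ _ (by omega))
  refine ⟨4 * (c + 1) * (K + 1) + (c + 1), fun {m} H hH => ?_⟩
  by_contra hns
  obtain ⟨W, hW, hWdeg⟩ := exists_min_dense hns
  obtain ⟨A, B, hAB, hB, hABc, hdeg⟩ := exists_dense_split H c K (by omega) W hW hWdeg
  obtain ⟨p, hp, S, hS, hcount⟩ := exists_pairs H c (by omega) B A hdeg
  have hzero := card_bound_false hK hABc hB (Nat.one_le_pow _ _ (by omega)) hcount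
  rw [Finset.card_eq_zero] at hzero
  let E := A.image p
  have hmid : ∀ e : Fin m × Fin m, ∃ a, e ∈ E → a ∈ A ∧ p a = e := by
    intro e
    by_cases he : e ∈ E
    · obtain ⟨a, ha, hae⟩ := Finset.mem_image.1 he
      exact ⟨a, fun _ => ⟨ha, hae⟩⟩
    · exact ⟨e.1, fun h => absurd h he⟩
  choose mid hmid using hmid
  have hE : ∀ e ∈ E, e.1 ∈ B ∧ e.2 ∈ B ∧ e.1 < e.2 ∧ H.Adj e.1 (mid e) ∧ H.Adj (mid e) e.2 := by
    intro e he
    have h1 := hmid e he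
    have h2 := hp _ h1.1
    rwa [h1.2] at h2
  have hmB : ∀ e ∈ E, mid e ∉ B := fun e he => Finset.disjoint_left.1 hAB (hmid e he).1
  let H' : SimpleGraph (Fin m) := SimpleGraph.fromRel fun u v => ∃ e ∈ E, (u = e.1 ∨ u = e.2) ∧
    v = mid e
  have hH' : H' ≤ H := by
    intro u v huv
    rcases huv.2 with ⟨e, he, rfl | rfl, rfl⟩ | ⟨e, he, rfl | rfl, rfl⟩
    · exact (hE e he).2.2.2.1
    · exact (hE e he).2.2.2.2.symm
    · exact (hE e he).2.2.2.1.symm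
    · exact (hE e he).2.2.2.2
  have hadjB : ∀ u v, H'.Adj u v → u ∈ B → ∃ e ∈ E, (u = e.1 ∨ u = e.2) ∧ v = mid e := by
    intro u v huv hu
    rcases huv.2 with h | ⟨e, he, h1, h2⟩
    · exact h
    · exact absurd (h2 ▸ hu) (hmB e he)
  have hadjB' : ∀ u v, H'.Adj u v → u ∉ B → v ∈ B := by
    intro u v huv hu
    rcases huv.2 with ⟨e, he, h1, h2⟩ | ⟨e, he, h1, h2⟩
    · rcases h1 with rfl | rfl
      · exact absurd (hE e he).1 hu
      · exact absurd (hE e he).2.1 hu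
    · rcases h1 with rfl | rfl
      · exact (hE e he).1
      · exact (hE e he).2.1
  have hinj : ∀ e ∈ E, ∀ e' ∈ E, mid e = mid e' → e = e' := by
    intro e he e' he' h
    rw [← (hmid e he).2, ← (hmid e' he').2, h]
  let x : Fin m × Fin m → ℕ → Fin m :=
    fun e i => if i = 0 then e.1 else if i = 1 then mid e else e.2
  have hPS : PathSys H' 1 B E x :=
    { lt := fun e he => (hE e he).2.2.1
      mem1 := fun e he => (hE e he).1
      mem2 := fun e he => (hE e he).2.1
      start := fun e he => by simp [x]
      finish := fun e he => by simp [x]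
      indep := by
        intro y hy z hz hyz
        obtain ⟨e, he, -, rfl⟩ := hadjB y z hyz hy
        exact hmB e he hz
      geo := by
        intro e he i j hij hj
        have h1 : e.1 ≠ mid e := fun h => hmB e he (h ▸ (hE e he).1)
        have h2 : mid e ≠ e.2 := fun h => hmB e he (h.symm ▸ (hE e he).2.1)
        have h3 : e.1 ≠ e.2 := (hE e he).2.2.1.ne
        have a1 : H'.Adj e.1 (mid e) := ⟨h1, Or.inl ⟨e, he, Or.inl rfl, rfl⟩⟩
        have a2 : H'.Adj (mid e) e.2 := ⟨h2, Or.inr ⟨e, he, Or.inr rfl, rfl⟩⟩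
        have a3 : ¬ H'.Adj e.1 e.2 := fun h => by
          obtain ⟨e', he', -, h5⟩ := hadjB _ _ h (hE e he).1
          exact hmB e' he' (h5 ▸ (hE e he).2.1)
        have hj3 : j < 3 := by omega
        interval_cases j <;> interval_cases i <;> simp [x, h1, h2, h3, a1, a2, a3]
      off := by
        intro e he y hy h1 h2 i hi hi'
        obtain rfl : i = 1 := by omega
        simp only [x, one_ne_zero, if_false, if_true]
        refine ⟨fun h => hmB e he (h ▸ hy), fun h => ?_⟩
        obtain ⟨e', he', h3, h4⟩ := hadjB _ _ h hy
        rw [← hinj e he e' he' h4] at h3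
        exact h3.elim h1 h2
      cross := by
        intro e he e' he' hne i j hi hi' hj hj'
        obtain rfl : i = 1 := by omega
        obtain rfl : j = 1 := by omega
        simp only [x, one_ne_zero, if_false, if_true]
        exact ⟨fun h => hne (hinj e he e' he' h), fun h => hmB e' he' (hadjB' _ _ h (hmB e he))⟩ }
  have hfull := hPS.full hClosed (hH H' hH') le_rfl
  obtain ⟨κ⟩ := (hM _ hfull).mono (Nat.le_succ M)
  refine Finset.notMem_empty (fun b => κ ((B.orderIsoOfFin rfl).symm b)) ?_
  rw [← hzero, hS]
  intro a ha u v hpa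
  have hpE : p a ∈ E := Finset.mem_image_of_mem p ha
  refine κ.valid ?_
  have hlt := (hE _ hpE).2.2.1
  rw [hpa] at hlt hpE
  rw [graphOf, SimpleGraph.fromRel_adj]
  constructor
  · intro h
    have := (B.orderIsoOfFin rfl).symm.injective h
    rw [this] at hlt
    exact lt_irrefl _ hlt
  · left
    simpa [← Finset.coe_orderIsoOfFin_apply] using hpE

/-- Systems of paths in `G` of a common length have linearly many paths. -/
def PathBounded {V : Type*} [LinearOrder V] (G : SimpleGraph V) (D : ℕ) : Prop :=
  ∀ r, 1 ≤ r → ∀ Y E x, PathSys G r Y E x → E.card ≤ D * Y.card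

theorem exists_pathBounded {C : GraphClass} (hC : ChiBounded C)
    (hClosed : ∀ (r : ℕ) ⦃n m : ℕ⦄ (G : SimpleGraph (Fin n)) (H : SimpleGraph (Fin m)),
      G ∈ C n → IsInducedSubgraphOf (Subdiv H (fun _ => r)) G → H ∈ C m) :
    ∃ D : ℕ, ∀ {n : ℕ} (G : SimpleGraph (Fin n)), G ∈ C n → PathBounded G D := by
  obtain ⟨D, hD⟩ := exists_sparse_of_full hC hClosed
  refine ⟨D, fun G hG r hr Y E x h => ?_⟩
  have h1 := hD _ (h.full hClosed hG hr) Finset.univ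
  rw [Finset.card_univ, Fintype.card_fin] at h1
  refine le_trans ?_ h1
  refine (Finset.card_le_card (t := (edgesIn (graphOf Y E) Finset.univ).image fun e =>
    (Y.orderEmbOfFin rfl e.1, Y.orderEmbOfFin rfl e.2)) ?_).trans Finset.card_image_le
  intro e he
  have h2 : e.1 ∈ Set.range (Y.orderEmbOfFin rfl) := by
    rw [Finset.range_orderEmbOfFin]; exact h.mem1 e he
  have h3 : e.2 ∈ Set.range (Y.orderEmbOfFin rfl) := by
    rw [Finset.range_orderEmbOfFin]; exact h.mem2 e he
  obtain ⟨i, hi⟩ := h2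
  obtain ⟨j, hj⟩ := h3
  have hlt := h.lt e he
  rw [← hi, ← hj, OrderEmbedding.lt_iff_lt] at hlt
  refine Finset.mem_image.2 ⟨(i, j), mem_edgesIn.2 ⟨Finset.mem_univ _, Finset.mem_univ _, hlt, ?_⟩,
    Prod.ext hi hj⟩
  rw [graphOf, SimpleGraph.fromRel_adj]
  refine ⟨hlt.ne, Or.inl ?_⟩
  rw [hi, hj]
  exact he

theorem kst {V : Type*} (U Γ : Finset V) (S : V → Finset V) (s L m : ℕ) (hs : 1 ≤ s) (hL : 1 ≤ L)
    (hU : U.card = 2 * s * L) (hS : ∀ a ∈ U, S a ⊆ Γ) (hm : ∀ a ∈ U, m ≤ (S a).card)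
    (hΓ : Γ.card ≤ L * m) (hbig : 2 ^ (2 * s * L + 1) * s ≤ m) :
    ∃ R ⊆ U, ∃ F : Finset V, s ≤ R.card ∧ s ≤ F.card ∧ ∀ a ∈ R, ∀ y ∈ F, y ∈ S a := by
  let d : V → Finset V := fun y => U.filter fun a => y ∈ S a
  have h1 : U.card * m ≤ ∑ y ∈ Γ, (d y).card := by
    calc U.card * m = ∑ a ∈ U, m := by simp
      _ ≤ ∑ a ∈ U, (S a).card := Finset.sum_le_sum hm
      _ = ∑ a ∈ U, ∑ y ∈ Γ, if y ∈ S a then 1 else 0 := by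
          refine Finset.sum_congr rfl fun a ha => ?_
          rw [← Finset.card_filter, Finset.filter_mem_eq_inter, Finset.inter_eq_right.2 (hS a ha)]
      _ = ∑ y ∈ Γ, (d y).card := by
          rw [Finset.sum_comm]
          exact Finset.sum_congr rfl fun y _ => (Finset.card_filter _ _).symm
  set Γ' := Γ.filter fun y => s ≤ (d y).card with hΓ'
  have h2 : ∑ y ∈ Γ, (d y).card ≤ Γ'.card * U.card + Γ.card * s := by
    calc ∑ y ∈ Γ, (d y).card ≤ ∑ y ∈ Γ, ((if s ≤ (d y).card then U.card else 0) + s) := by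
          refine Finset.sum_le_sum fun y _ => ?_
          have : (d y).card ≤ U.card := Finset.card_filter_le _ _
          split_ifs <;> omega
      _ = _ := by
          rw [Finset.sum_add_distrib, ← Finset.sum_filter, Finset.sum_const, Finset.sum_const]
          simp [hΓ']
  have hUpos : 0 < 2 * s * L := by positivity
  have h3 : m ≤ 2 * Γ'.card := by
    rw [hU] at h1 h2
    have h4 : 2 * s * L * m ≤ 2 * s * L * (2 * Γ'.card) := by
      nlinarith [Nat.mul_le_mul_right s hΓ]
    exact Nat.le_of_mul_le_mul_left h4 hUpos
  have hex : ∃ R ∈ U.powerset, s ≤ (Γ'.filter fun y => d y = R).card := by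
    refine Finset.exists_le_card_fiber_of_mul_le_card_of_maps_to
      (fun y _ => Finset.mem_powerset.2 (Finset.filter_subset _ _)) ⟨∅, by simp⟩ ?_
    rw [Finset.card_powerset, hU]
    rw [pow_succ] at hbig
    nlinarith
  obtain ⟨R, hR, hRs⟩ := hex
  refine ⟨R, Finset.mem_powerset.1 hR, Γ'.filter fun y => d y = R, ?_, hRs, ?_⟩
  · obtain ⟨y, hy⟩ := Finset.card_pos.1 (lt_of_lt_of_le hs hRs)
    rw [Finset.mem_filter, hΓ', Finset.mem_filter] at hy
    exact hy.2 ▸ hy.1.2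
  · intro a ha y hy
    rw [← (Finset.mem_filter.1 hy).2] at ha
    exact (Finset.mem_filter.1 ha).2

theorem card_low_rank {V : Type*} (S : Finset V) (g : V → ℕ) (hg : Function.Injective g) (m : ℕ) :
    (S.filter fun b => (S.filter fun b' => g b' < g b).card < m).card ≤ m := by
  conv_rhs => rw [← Finset.card_range m]
  refine Finset.card_le_card_of_injOn (fun b => (S.filter fun b' => g b' < g b).card) ?_ ?_
  · intro b hb
    simp only [Finset.coe_filter, Set.mem_ofPred_eq] at hb
    simpa using hb.2
  · intro a ha b hb hab
    simp only [Finset.coe_filter, Set.mem_ofPred_eq] at ha hb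
    by_contra hne
    have key : ∀ a b, a ∈ S → g a < g b →
        (S.filter fun b' => g b' < g a).card < (S.filter fun b' => g b' < g b).card := by
      intro a b ha hlt
      refine Finset.card_lt_card (Finset.ssubset_iff_of_subset ?_ |>.2 ⟨a, ?_, ?_⟩)
      · intro x hx
        simp only [Finset.mem_filter] at hx ⊢
        exact ⟨hx.1, hx.2.trans hlt⟩
      · simp [ha, hlt]
      · simp
    rcases lt_or_gt_of_ne (hg.ne hne) with h | h
    · exact (key a b ha.1 h).ne hab
    · exact (key b a hb.1 h).ne hab.symm

theorem exists_regular {V : Type*} [LinearOrder V] [Fintype V] {G : SimpleGraph V} {ρ₀ : ℕ}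
    (hρ₀ : 1 ≤ ρ₀) (h : ¬ Sparse G ρ₀) : ∃ ρ, ρ₀ ≤ ρ ∧ ∃ W : Finset V, W.Nonempty ∧
      (∀ v ∈ W, ρ ≤ degIn G W v) ∧ W.card ≤ 2 * (W.filter fun v => degIn G W v ≤ 8 * ρ).card := by
  let Pρ : ℕ → Prop := fun ρ => ∃ W : Finset V, W.Nonempty ∧ ρ * W.card ≤ (edgesIn G W).card
  have hbound : ∀ ρ, Pρ ρ → ρ ≤ Fintype.card (V × V) := by
    rintro ρ ⟨W, hW, hle⟩
    have := Finset.card_pos.2 hW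
    exact (Nat.le_mul_of_pos_right ρ this).trans (hle.trans (Finset.card_le_univ _))
  have h0 : Pρ ρ₀ := by
    simp only [Sparse, not_forall, not_le] at h
    obtain ⟨W, hW⟩ := h
    refine ⟨W, ?_, hW.le⟩
    rw [Finset.nonempty_iff_ne_empty]
    rintro rfl
    simp [edgesIn] at hW
  set ρ := Nat.findGreatest Pρ (Fintype.card (V × V)) with hρ
  have h1 : ρ₀ ≤ ρ := Nat.le_findGreatest (hbound _ h0) h0
  have h2 : Pρ ρ := Nat.findGreatest_spec (hbound _ h0) h0
  have h3 : ∀ W : Finset V, W.Nonempty → (edgesIn G W).card < (ρ + 1) * W.card := by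
    intro W hW
    by_contra! hcon
    have h4 : Pρ (ρ + 1) := ⟨W, hW, hcon⟩
    have := Nat.le_findGreatest (hbound _ h4) h4
    omega
  have hex : ∃ k, ∃ W : Finset V, W.card = k ∧ W.Nonempty ∧ ρ * W.card ≤ (edgesIn G W).card := by
    obtain ⟨W, hW⟩ := h2
    exact ⟨_, W, rfl, hW⟩
  obtain ⟨W, hWk, hWne, hW⟩ := Nat.find_spec hex
  refine ⟨ρ, h1, W, hWne, ?_, ?_⟩
  · intro v hv
    by_contra! hdeg
    have h4 := card_edgesIn_le_erase G W v
    have h5 := Finset.card_erase_add_one hv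
    rcases (W.erase v).eq_empty_or_nonempty with h6 | h6
    · rw [h6, Finset.card_empty] at h5
      rw [h6] at h4
      simp [edgesIn] at h4
      rw [← h5] at hW
      simp only [edgesIn] at hW
      omega
    · refine Nat.find_min hex (m := (W.erase v).card) (by omega) ⟨_, rfl, h6, ?_⟩
      rw [← h5] at hW
      nlinarith
  · have h4 := h3 W hWne
    have h5 := sum_degIn G W
    have h6 : ∑ v ∈ W, (if degIn G W v ≤ 8 * ρ then 0 else 8 * ρ) ≤ ∑ v ∈ W, degIn G W v := by
      refine Finset.sum_le_sum fun v _ => ?_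
      split_ifs <;> omega
    rw [← Finset.sum_filter_add_sum_filter_not W fun v => degIn G W v ≤ 8 * ρ,
      Finset.sum_congr rfl (g := fun _ => 0)
        (by intro v hv; rw [if_pos (Finset.mem_filter.1 hv).2]),
      Finset.sum_congr (s₁ := W.filter fun v => ¬ degIn G W v ≤ 8 * ρ) rfl (g := fun _ => 8 * ρ)
        (by intro v hv; rw [if_neg (Finset.mem_filter.1 hv).2]), h5] at h6
    simp only [Finset.sum_const, smul_eq_mul, mul_zero, zero_add] at h6
    have h7 := Finset.card_filter_add_card_filter_not (s := W) fun v => degIn G W v ≤ 8 * ρ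
    set a := (W.filter fun v => ¬ degIn G W v ≤ 8 * ρ).card
    have h8 : a * (4 * ρ) ≤ W.card * (2 * ρ) := by nlinarith
    have h9 : (2 * a) * (2 * ρ) ≤ W.card * (2 * ρ) := by nlinarith
    have h10 := Nat.le_of_mul_le_mul_right h9 (by omega)
    omega

/-- Two vertices of `B` are joined when they have a common neighbour in `A`. -/
def commonNbr {V : Type*} (G : SimpleGraph V) (A B : Finset V) : SimpleGraph V where
  Adj b b' := b ≠ b' ∧ b ∈ B ∧ b' ∈ B ∧ ∃ a ∈ A, G.Adj a b ∧ G.Adj a b'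
  symm := ⟨fun _ _ h => ⟨h.1.symm, h.2.2.1, h.2.1, h.2.2.2.imp fun _ ha => ⟨ha.1, ha.2.2, ha.2.1⟩⟩⟩
  loopless := ⟨fun _ h => h.1 rfl⟩

theorem sparse_commonNbr {V : Type*} [LinearOrder V] [Fintype V] {G : SimpleGraph V} {D q : ℕ}
    (hG : PathBounded G D) {A B : Finset V} (hA : ∀ a ∈ A, ∀ a' ∈ A, ¬ G.Adj a a')
    (hB : ∀ a ∈ B, ∀ a' ∈ B, ¬ G.Adj a a') (hAB : Disjoint A B)
    (hdeg : ∀ a ∈ A, 2 * degIn G B a ≤ q + 1) :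
    Sparse (commonNbr G A B) (2 * (q + 1) * D) := by
  intro X
  have hex : ∀ e : V × V, ∃ a, e ∈ edgesIn (commonNbr G A B) X →
      a ∈ A ∧ G.Adj a e.1 ∧ G.Adj a e.2 := by
    intro e
    by_cases he : e ∈ edgesIn (commonNbr G A B) X
    · obtain ⟨a, ha⟩ := (mem_edgesIn.1 he).2.2.2.2.2.2
      exact ⟨a, fun _ => ha⟩
    · exact ⟨e.1, fun h => absurd h he⟩
  choose μ hμ using hex
  refine biased_sampling (edgesIn (commonNbr G A B) X) (fun e => {e.1, e.2})
    (fun e => (B.filter (G.Adj (μ e))) \ {e.1, e.2}) X ((q + 1) / 2) q D ?_ ?_ ?_ (by omega) ?_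
  · intro e _
    exact Finset.disjoint_sdiff
  · intro e he
    exact Finset.card_pair (mem_edgesIn.1 he).2.2.1.ne
  · intro e he
    have h1 := hdeg _ (hμ e he).1
    have h2 : ((B.filter (G.Adj (μ e))) \ {e.1, e.2}).card ≤ degIn G B (μ e) :=
      Finset.card_le_card Finset.sdiff_subset
    omega
  · intro Z
    set F := (edgesIn (commonNbr G A B) X).filter fun e => {e.1, e.2} ⊆ Z ∧
      Disjoint ((B.filter (G.Adj (μ e))) \ {e.1, e.2}) Z with hF
    have hFe : ∀ e ∈ F, e.1 ∈ X ∧ e.1 ∈ Z ∧ e.1 ∈ B ∧ e.2 ∈ X ∧ e.2 ∈ Z ∧ e.2 ∈ B ∧ e.1 < e.2 ∧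
        μ e ∈ A ∧ G.Adj (μ e) e.1 ∧ G.Adj (μ e) e.2 ∧
        ∀ y ∈ B, y ∈ Z → G.Adj (μ e) y → y = e.1 ∨ y = e.2 := by
      intro e he
      rw [hF, Finset.mem_filter] at he
      have h1 := hμ e he.1
      have h2 := mem_edgesIn.1 he.1
      refine ⟨h2.1, he.2.1 (by simp), h2.2.2.2.2.1, h2.2.1, he.2.1 (by simp), h2.2.2.2.2.2.1,
        h2.2.2.1, h1.1, h1.2.1, h1.2.2, fun y hyB hyZ hy => ?_⟩
      by_contra hcon
      push Not at hcon
      exact Finset.disjoint_left.1 he.2.2 (Finset.mem_sdiff.2 ⟨Finset.mem_filter.2 ⟨hyB, hy⟩,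
        by simp [hcon]⟩) hyZ
    have hinj : ∀ e ∈ F, ∀ e' ∈ F, μ e = μ e' → e = e' := by
      intro e he e' he' h
      have h1 := hFe e he
      have h2 := hFe e' he'
      have h3 := h2.2.2.2.2.2.2.2.2.2.2 e.1 h1.2.2.1 h1.2.1 (h ▸ h1.2.2.2.2.2.2.2.2.1)
      have h4 := h2.2.2.2.2.2.2.2.2.2.2 e.2 h1.2.2.2.2.2.1 h1.2.2.2.2.1
        (h ▸ h1.2.2.2.2.2.2.2.2.2.1)
      have h5 := h1.2.2.2.2.2.2.1
      have h6 := h2.2.2.2.2.2.2.1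
      rcases h3 with h3 | h3 <;> rcases h4 with h4 | h4
      · exact absurd (h3.trans h4.symm) h5.ne
      · exact Prod.ext h3 h4
      · rw [h3, h4] at h5
        exact absurd h5 (lt_asymm h6)
      · exact absurd (h3.trans h4.symm) h5.ne
    have hne : ∀ a ∈ A, ∀ b ∈ B, b ≠ a := fun a ha b hb h =>
      Finset.disjoint_left.1 hAB ha (h ▸ hb)
    have hPS : PathSys G 1 ((X ∩ Z).filter (· ∈ B)) F
        (fun e i => if i = 0 then e.1 else if i = 1 then μ e else e.2) :=
      { lt := fun e he => (hFe e he).2.2.2.2.2.2.1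
        mem1 := fun e he => by
          have := hFe e he
          simp only [Finset.mem_filter, Finset.mem_inter]
          tauto
        mem2 := fun e he => by
          have := hFe e he
          simp only [Finset.mem_filter, Finset.mem_inter]
          tauto
        start := fun e he => by simp
        finish := fun e he => by simp
        indep := fun y hy z hz => hB y (Finset.mem_filter.1 hy).2 z (Finset.mem_filter.1 hz).2
        geo := by
          intro e he i j hij hj
          have h := hFe e he
          obtain ⟨-, -, h1, -, -, h2, h3, h4, h5, h6, -⟩ := h
          have h7 := hB _ h1 _ h2
          have h8 := h3.ne
          have h9 := h5.symm
          have h10 := hne _ h4 _ h1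
          have h11 := (hne _ h4 _ h2).symm
          have hj3 : j < 3 := by omega
          interval_cases j <;> interval_cases i <;> simp [h6, h7, h8, h9, h10, h11]
        off := by
          intro e he y hy h1 h2 i hi hi'
          obtain rfl : i = 1 := by omega
          have h := hFe e he
          simp only [Finset.mem_filter, Finset.mem_inter] at hy
          simp only [one_ne_zero, if_false, if_true]
          refine ⟨hne _ h.2.2.2.2.2.2.2.1 _ hy.2, fun hadj => ?_⟩
          rcases h.2.2.2.2.2.2.2.2.2.2 y hy.2 hy.1.2 hadj.symm with h3 | h3
          · exact h1 h3
          · exact h2 h3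
        cross := by
          intro e he e' he' hne i j hi hi' hj hj'
          obtain rfl : i = 1 := by omega
          obtain rfl : j = 1 := by omega
          simp only [one_ne_zero, if_false, if_true]
          exact ⟨fun h => hne (hinj e he e' he' h), hA _ (hFe e he).2.2.2.2.2.2.2.1 _
            (hFe e' he').2.2.2.2.2.2.2.1⟩ }
    refine (hG 1 le_rfl _ _ _ hPS).trans (Nat.mul_le_mul_left _ (Finset.card_filter_le _ _))

/-- A graph with boundedly many colors, no large bicliques and linearly bounded path systems is
sparse. -/
theorem exists_sparse (D k s : ℕ) : ∃ d : ℕ, ∀ {V : Type*} [LinearOrder V] [Fintype V]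
    (G : SimpleGraph V), PathBounded G D → (∃ col : V → Fin k, ∀ u v, G.Adj u v → col u ≠ col v) →
    (¬ ∃ A B : Finset V, s ≤ A.card ∧ s ≤ B.card ∧ ∀ a ∈ A, ∀ b ∈ B, G.Adj a b) →
    Sparse G d := by
  set L := 256 * (k + 1) * (D + 1) with hL
  set T := 2 * (s + 1) * L with hT
  set m₀ := 2 * (k * k) * T + 2 ^ (T + 1) * (s + 1) + 1 with hm₀
  refine ⟨2 * (k + 1) * m₀, fun {V} _ _ G hG hcol hK => ?_⟩
  by_contra hns
  obtain ⟨col, hcol⟩ := hcol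
  obtain ⟨ρ, hρ, W, hW, hWdeg, hlow⟩ := exists_regular (Nat.mul_pos (by omega) (by omega)) hns
  set Low := W.filter fun v => degIn G W v ≤ 8 * ρ with hLow
  have hk : 0 < k := by
    obtain ⟨v, _⟩ := hW
    exact Nat.pos_of_ne_zero fun h => by subst h; exact (col v).elim0
  have : Nonempty (Fin k) := ⟨⟨0, hk⟩⟩
  have hρpos : 0 < ρ := lt_of_lt_of_le (Nat.mul_pos (by omega) (by omega)) hρ
  have hmaj : ∀ v, ∃ j : Fin k, v ∈ W →
      ρ ≤ ((W.filter (G.Adj v)).filter fun u => col u = j).card * k := by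
    intro v
    by_cases hv : v ∈ W
    · by_contra! hcon
      have h1 := Finset.card_eq_sum_card_fiberwise (s := W.filter (G.Adj v))
        (t := (Finset.univ : Finset (Fin k))) (f := col)
        (fun _ _ => Finset.mem_coe.2 (Finset.mem_univ _))
      have h2 := Finset.sum_lt_sum_of_nonempty (s := (Finset.univ : Finset (Fin k)))
        Finset.univ_nonempty fun j _ => (hcon j).2
      rw [← Finset.sum_mul, ← h1, Finset.sum_const, Finset.card_univ, Fintype.card_fin,
        smul_eq_mul] at h2
      have h3 := hWdeg v hv
      rw [degIn] at h3
      nlinarith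
    · exact ⟨Classical.arbitrary _, fun h => absurd h hv⟩
  choose maj hmaj using hmaj
  obtain ⟨⟨ci, cj⟩, -, hA⟩ := Finset.exists_le_card_fiber_of_nsmul_le_card_of_maps_to
    (s := Low) (t := (Finset.univ : Finset (Fin k × Fin k))) (f := fun v => (col v, maj v))
    (fun _ _ => Finset.mem_univ _) Finset.univ_nonempty
    (b := ((Low.card : ℚ) / (k * k))) (by
      simp only [Finset.card_univ, Fintype.card_prod, Fintype.card_fin, nsmul_eq_mul]
      push_cast
      rw [mul_div_cancel₀]
      positivity)
  set A := Low.filter fun v => (col v, maj v) = (ci, cj) with hAdef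
  have hAc : Low.card ≤ A.card * (k * k) := by
    rw [div_le_iff₀ (by positivity)] at hA
    exact_mod_cast hA
  set B := W.filter fun v => col v = cj with hB
  have hAm : ∀ a ∈ A, a ∈ W ∧ degIn G W a ≤ 8 * ρ ∧ col a = ci ∧ maj a = cj := by
    intro a ha
    simp only [hAdef, hLow, Finset.mem_filter, Prod.mk.injEq] at ha
    tauto
  have hBm : ∀ b ∈ B, b ∈ W ∧ col b = cj := fun b hb => Finset.mem_filter.1 hb
  have hNge : ∀ a ∈ A, ρ ≤ degIn G B a * k := by
    intro a ha
    have h1 := hmaj a (hAm a ha).1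
    rw [(hAm a ha).2.2.2] at h1
    refine h1.trans (Nat.mul_le_mul_right _ (Finset.card_le_card ?_))
    intro x hx
    simp only [hB, Finset.mem_filter] at hx ⊢
    tauto
  have hNle : ∀ a ∈ A, degIn G B a ≤ 8 * ρ := fun a ha =>
    (Finset.card_le_card (Finset.filter_subset_filter _ (Finset.filter_subset _ _))).trans
      (hAm a ha).2.1
  have hBA : B.card ≤ 2 * (k * k) * A.card := by
    have h1 : B.card ≤ W.card := Finset.card_filter_le _ _
    calc B.card ≤ 2 * Low.card := h1.trans hlow
      _ ≤ 2 * (A.card * (k * k)) := Nat.mul_le_mul_left _ hAc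
      _ = _ := by ring
  have hApos : 0 < A.card := by
    have h1 := Finset.card_pos.2 hW
    by_contra! h0
    have h2 : A.card = 0 := by omega
    rw [h2] at hAc
    omega
  obtain ⟨a₀, ha₀⟩ := Finset.card_pos.1 hApos
  have hnb : ∀ a ∈ A, ∃ b ∈ B, G.Adj a b := by
    intro a ha
    have h1 := hNge a ha
    have h2 : 0 < degIn G B a := Nat.pos_of_ne_zero fun h => by rw [h] at h1; omega
    obtain ⟨b, hb⟩ := Finset.card_pos.1 h2
    exact ⟨b, (Finset.mem_filter.1 hb).1, (Finset.mem_filter.1 hb).2⟩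
  obtain ⟨b₀, hb₀, hab₀⟩ := hnb a₀ ha₀
  have hij : ci ≠ cj := by
    have := hcol _ _ hab₀
    rwa [(hAm _ ha₀).2.2.1, (hBm _ hb₀).2] at this
  have hdis : Disjoint A B := Finset.disjoint_left.2 fun x hx hx' =>
    hij ((hAm x hx).2.2.1.symm.trans (hBm x hx').2)
  have hsp := sparse_commonNbr (q := 16 * ρ - 1) hG
    (fun a ha a' ha' h => hcol _ _ h ((hAm a ha).2.2.1.trans (hAm a' ha').2.2.1.symm))
    (fun a ha a' ha' h => hcol _ _ h ((hBm a ha).2.trans (hBm a' ha').2.symm)) hdis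
    (fun a ha => by have := hNle a ha; omega)
  have hq : 16 * ρ - 1 + 1 = 16 * ρ := by omega
  rw [hq] at hsp
  obtain ⟨g, hg, hback⟩ := exists_order_of_sparse hsp
  let N : V → Finset V := fun a => B.filter (G.Adj a)
  set m := ρ / (2 * k) with hm
  have hm1 : 2 * k * m ≤ ρ := Nat.mul_div_le _ _
  have hm2 : ρ < 2 * k * (m + 1) := by
    have := Nat.lt_mul_div_succ ρ (b := 2 * k) (by omega)
    simpa [hm] using this
  have hm3 : m₀ ≤ m := by
    rw [hm, Nat.le_div_iff_mul_le (Nat.mul_pos two_pos hk)]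
    calc m₀ * (2 * k) ≤ m₀ * (2 * (k + 1)) := Nat.mul_le_mul_left _ (by omega)
      _ = 2 * (k + 1) * m₀ := Nat.mul_comm _ _
      _ ≤ ρ := hρ
  let pred : V → V → Finset V := fun a b => (N a).filter fun b' => g b' < g b
  let U : V → Finset V := fun b => A.filter fun a => b ∈ N a ∧ m ≤ (pred a b).card
  have hcount : A.card * m ≤ ∑ b ∈ B, (U b).card := by
    calc A.card * m = ∑ a ∈ A, m := by simp
      _ ≤ ∑ a ∈ A, (B.filter fun b => b ∈ N a ∧ m ≤ (pred a b).card).card := by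
          refine Finset.sum_le_sum fun a ha => ?_
          have h1 := card_low_rank (N a) g hg m
          have h2 := Finset.card_filter_add_card_filter_not (s := N a)
            fun b => ((N a).filter fun b' => g b' < g b).card < m
          have h3 : 2 * m ≤ (N a).card := by
            have h4 := hNge a ha
            have h5 : (2 * m) * k ≤ (N a).card * k := by
              calc (2 * m) * k = 2 * k * m := by ring
                _ ≤ ρ := hm1
                _ ≤ _ := h4
            exact Nat.le_of_mul_le_mul_right h5 hk
          have h6 : ((N a).filter fun b => ¬ ((N a).filter fun b' => g b' < g b).card < m).card ≤
              (B.filter fun b => b ∈ N a ∧ m ≤ (pred a b).card).card := by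
            refine Finset.card_le_card fun b hb => ?_
            rw [Finset.mem_filter] at hb ⊢
            exact ⟨(Finset.mem_filter.1 hb.1).1, hb.1, not_lt.1 hb.2⟩
          omega
      _ = ∑ b ∈ B, (U b).card := by
          simp_rw [U, Finset.card_filter]
          rw [Finset.sum_comm]
  have hbex : ∃ b ∈ B, T ≤ (U b).card := by
    by_contra! hcon
    have h1 : ∑ b ∈ B, (U b).card ≤ B.card * T := by
      rw [← smul_eq_mul, ← Finset.sum_const]
      exact Finset.sum_le_sum fun b hb => (hcon b hb).le
    have h2 : A.card * m ≤ A.card * (2 * (k * k) * T) := by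
      calc A.card * m ≤ B.card * T := hcount.trans h1
        _ ≤ (2 * (k * k) * A.card) * T := Nat.mul_le_mul_right _ hBA
        _ = _ := by ring
    have h3 := Nat.le_of_mul_le_mul_left h2 hApos
    have : 0 < 2 ^ (T + 1) * (s + 1) := by positivity
    omega
  obtain ⟨b, hb, hbU⟩ := hbex
  obtain ⟨U', hU', hU'c⟩ := Finset.exists_subset_card_eq hbU
  set Γ := Finset.univ.filter fun u => (commonNbr G A B).Adj u b ∧ g u < g b with hΓ
  have hU'm : ∀ a ∈ U', a ∈ A ∧ b ∈ N a ∧ m ≤ (pred a b).card := fun a ha =>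
    Finset.mem_filter.1 (hU' ha)
  obtain ⟨R, hR, F, hRs, hFs, hRF⟩ := kst U' Γ (fun a => pred a b) (s + 1) L m (by omega)
    (by rw [hL]; exact Nat.mul_pos (by omega) (by omega)) hU'c (by
      intro a ha y hy
      have h1 := hU'm a ha
      simp only [pred, N, Finset.mem_filter] at hy h1
      simp only [hΓ, Finset.mem_filter, Finset.mem_univ, true_and]
      refine ⟨⟨?_, hy.1.1, hb, a, h1.1, hy.1.2, h1.2.1.2⟩, hy.2⟩
      rintro rfl
      exact lt_irrefl _ hy.2) (fun a ha => (hU'm a ha).2.2) (by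
      refine (hback b).trans ?_
      have hmpos : 1 ≤ m := le_trans (by omega) hm3
      have h1 : ρ ≤ 4 * k * m := by
        calc ρ ≤ 2 * k * (m + 1) := hm2.le
          _ ≤ 2 * k * (2 * m) := Nat.mul_le_mul_left _ (by omega)
          _ = _ := by ring
      calc 2 * (2 * (16 * ρ) * D) = 64 * D * ρ := by ring
        _ ≤ 64 * D * (4 * k * m) := Nat.mul_le_mul_left _ h1
        _ = 256 * k * D * m := by ring
        _ ≤ L * m := by
          refine Nat.mul_le_mul_right _ ?_
          rw [hL]
          exact Nat.mul_le_mul (by omega) (by omega)) (by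
      rw [← hT]
      exact le_trans (by omega) hm3)
  refine hK ⟨R, F, by omega, by omega, fun a ha y hy => ?_⟩
  have := hRF a ha y hy
  simp only [pred, N, Finset.mem_filter] at this
  exact this.1.2

/-- There is a walk of length `k` from `a` to `b` whose interior vertices satisfy `S`. -/
def Join {V : Type*} (G : SimpleGraph V) (S : V → Prop) (k : ℕ) (a b : V) : Prop :=
  ∃ x : ℕ → V, x 0 = a ∧ x k = b ∧ (∀ i < k, G.Adj (x i) (x (i + 1))) ∧
    ∀ i, 0 < i → i < k → S (x i)

/-- There is a walk from `a` to `b` whose interior vertices satisfy `S`. -/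
def Linked {V : Type*} (G : SimpleGraph V) (S : V → Prop) (a b : V) : Prop :=
  ∃ k, Join G S k a b

section
variable {V : Type*} {G : SimpleGraph V} {S : V → Prop}

theorem Join.mono {S' : V → Prop} (h : ∀ v, S v → S' v) {k : ℕ} {a b : V} (hj : Join G S k a b) :
    Join G S' k a b := by
  obtain ⟨x, h0, hk, hadj, hS⟩ := hj
  exact ⟨x, h0, hk, hadj, fun i h1 h2 => h _ (hS i h1 h2)⟩

theorem Join.zero_iff {a b : V} : Join G S 0 a b ↔ a = b := by
  constructor
  · rintro ⟨x, h0, hk, -, -⟩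
    exact h0.symm.trans hk
  · rintro rfl
    exact ⟨fun _ => a, rfl, rfl, fun i hi => absurd hi (by omega),
      fun i _ hi => absurd hi (by omega)⟩

theorem Join.one_iff {a b : V} : Join G S 1 a b ↔ G.Adj a b := by
  constructor
  · rintro ⟨x, rfl, rfl, h, -⟩
    exact h 0 (by omega)
  · intro h
    refine ⟨fun i => if i = 0 then a else b, by simp, by simp, fun i hi => ?_,
      fun i h1 h2 => by omega⟩
    obtain rfl : i = 0 := by omega
    simpa using h

theorem Join.cons {k : ℕ} {a b d : V} (hab : G.Adj a b) (hb : S b) (h : Join G S k b d) :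
    Join G S (k + 1) a d := by
  obtain ⟨x, h0, hk, hadj, hS⟩ := h
  refine ⟨fun i => if i = 0 then a else x (i - 1), by simp, by simpa using hk, fun i hi => ?_,
    fun i h1 h2 => ?_⟩
  · simp only
    rcases Nat.eq_zero_or_pos i with rfl | hpos
    · simpa [h0] using hab
    · have := hadj (i - 1) (by omega)
      rw [if_neg (by omega), if_neg (by omega)]
      rwa [show i - 1 + 1 = i + 1 - 1 by omega] at this
  · simp only
    rw [if_neg (by omega)]
    rcases Nat.eq_zero_or_pos (i - 1) with h3 | hpos
    · rw [h3, h0]; exact hb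
    · exact hS _ hpos (by omega)

theorem Join.uncons {k : ℕ} {a d : V} (h : Join G S (k + 2) a d) :
    ∃ b, G.Adj a b ∧ S b ∧ Join G S (k + 1) b d := by
  obtain ⟨x, h0, hk, hadj, hS⟩ := h
  exact ⟨x 1, h0 ▸ hadj 0 (by omega), hS 1 (by omega) (by omega), fun i => x (i + 1), rfl, hk,
    fun i hi => hadj _ (by omega), fun i h1 h2 => hS _ (by omega) (by omega)⟩

theorem Join.symm {k : ℕ} {a b : V} (h : Join G S k a b) : Join G S k b a := by
  obtain ⟨x, h0, hk, hadj, hS⟩ := h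
  refine ⟨fun i => x (k - i), by simpa using hk, by simpa using h0, fun i hi => ?_,
    fun i h1 h2 => hS _ (by omega) (by omega)⟩
  have := hadj (k - (i + 1)) (by omega)
  rw [show k - (i + 1) + 1 = k - i by omega] at this
  exact this.symm

theorem Linked.mono {S' : V → Prop} (h : ∀ v, S v → S' v) {a b : V} (hj : Linked G S a b) :
    Linked G S' a b := hj.imp fun _ h' => h'.mono h

theorem Linked.symm {a b : V} (h : Linked G S a b) : Linked G S b a := h.imp fun _ h' => h'.symm

theorem Linked.refl (a : V) : Linked G S a a := ⟨0, Join.zero_iff.2 rfl⟩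

theorem Linked.of_adj {a b : V} (h : G.Adj a b) : Linked G S a b := ⟨1, Join.one_iff.2 h⟩

/-- Induction along walks, from the end. -/
theorem Linked.rec_left {d : V} {M : V → Prop} (base : M d) (adj : ∀ a, G.Adj a d → M a)
    (step : ∀ a b, G.Adj a b → S b → Linked G S b d → M b → M a) {a : V} (h : Linked G S a d) :
    M a := by
  obtain ⟨k, h⟩ := h
  induction k generalizing a with
  | zero => rw [Join.zero_iff] at h; exact h ▸ base
  | succ k ih =>
    rcases k with _ | k
    · rw [Join.one_iff] at h; exact adj a h
    · obtain ⟨b, hab, hb, h'⟩ := h.uncons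
      exact step a b hab hb ⟨_, h'⟩ (ih h')

theorem Linked.cons {a b d : V} (hab : G.Adj a b) (hb : S b) (h : Linked G S b d) :
    Linked G S a d := by
  obtain ⟨k, h⟩ := h
  exact ⟨_, h.cons hab hb⟩

theorem Linked.trans {a b d : V} (hab : Linked G S a b) (hb : S b) (h : Linked G S b d) :
    Linked G S a d :=
  Linked.rec_left (M := fun a => Linked G S a d) h (fun _ h' => h.cons h' hb)
    (fun _ _ h' hS _ hM => hM.cons h' hS) hab

theorem linked_left {x : ℕ → V} {k : ℕ} (hadj : ∀ i < k, G.Adj (x i) (x (i + 1)))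
    (hS : ∀ i, 0 < i → i < k → S (x i)) {i : ℕ} (hi : i ≤ k) : Linked G S (x 0) (x i) :=
  ⟨i, x, rfl, rfl, fun j hj => hadj j (by omega), fun j h1 h2 => hS j h1 (by omega)⟩

theorem join_right {x : ℕ → V} {k : ℕ} (hadj : ∀ i < k, G.Adj (x i) (x (i + 1)))
    (hS : ∀ i, 0 < i → i < k → S (x i)) {i : ℕ} (hi : i ≤ k) : Join G S (k - i) (x i) (x k) :=
  ⟨fun j => x (i + j), by simp, by simp only; congr 1; omega,
    fun j hj => hadj _ (by omega), fun j h1 h2 => hS _ (by omega) (by omega)⟩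

theorem linked_right {x : ℕ → V} {k : ℕ} (hadj : ∀ i < k, G.Adj (x i) (x (i + 1)))
    (hS : ∀ i, 0 < i → i < k → S (x i)) {i : ℕ} (hi : i ≤ k) : Linked G S (x i) (x k) :=
  ⟨_, join_right hadj hS hi⟩

/-- A sequence of vertices forming an induced path of length `k` with interior in `S`. -/
structure Geo (G : SimpleGraph V) (S : V → Prop) (k : ℕ) (a b : V) (x : ℕ → V) : Prop where
  start : x 0 = a
  finish : x k = b
  inner : ∀ i, 0 < i → i < k → S (x i)
  left : ∀ i, i ≤ k → Linked G S a (x i)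
  right : ∀ i, i ≤ k → Linked G S (x i) b
  geo : ∀ i j, i < j → j ≤ k → x i ≠ x j ∧ (G.Adj (x i) (x j) ↔ j = i + 1)

theorem exists_geo {k : ℕ} {a b : V} (h : Join G S k a b) (hmin : ∀ l < k, ¬ Join G S l a b) :
    ∃ x, Geo G S k a b x := by
  obtain ⟨x, h0, hk, hadj, hS⟩ := h
  refine ⟨x, h0, hk, hS, fun i hi => h0 ▸ linked_left hadj hS hi,
    fun i hi => hk ▸ linked_right hadj hS hi, fun i j hij hj => ⟨fun heq => ?_, fun h => ?_,
    fun h => h ▸ hadj i (by omega)⟩⟩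
  · refine hmin (k - (j - i)) (by omega) ⟨fun t => if t ≤ i then x t else x (t + (j - i)),
      by simpa using h0, ?_, fun t ht => ?_, fun t h1 h2 => ?_⟩
    · simp only
      split_ifs with h
      · rw [show k - (j - i) = i by omega, heq, show j = k by omega, hk]
      · rw [show k - (j - i) + (j - i) = k by omega, hk]
    · simp only
      rcases lt_trichotomy t i with h | h | h
      · rw [if_pos h.le, if_pos (by omega)]; exact hadj t (by omega)
      · rw [if_pos h.le, if_neg (by omega), h, heq, show i + 1 + (j - i) = j + 1 by omega]
        exact hadj j (by omega)
      · rw [if_neg (by omega), if_neg (by omega), show t + 1 + (j - i) = t + (j - i) + 1 by omega]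
        exact hadj _ (by omega)
    · simp only
      split_ifs with h
      · exact hS t h1 (by omega)
      · exact hS _ (by omega) (by omega)
  · by_contra hne
    refine hmin (k - (j - i - 1)) (by omega) ⟨fun t => if t ≤ i then x t else x (t + (j - i - 1)),
      by simpa using h0, ?_, fun t ht => ?_, fun t h1 h2 => ?_⟩
    · simp only
      rw [if_neg (by omega), show k - (j - i - 1) + (j - i - 1) = k by omega, hk]
    · simp only
      rcases lt_trichotomy t i with h' | h' | h'
      · rw [if_pos h'.le, if_pos (by omega)]; exact hadj t (by omega)
      · rw [if_pos h'.le, if_neg (by omega), h', show i + 1 + (j - i - 1) = j by omega]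
        exact h
      · rw [if_neg (by omega), if_neg (by omega),
          show t + 1 + (j - i - 1) = t + (j - i - 1) + 1 by omega]
        exact hadj _ (by omega)
    · simp only
      split_ifs with h
      · exact hS t h1 (by omega)
      · exact hS _ (by omega) (by omega)

theorem exists_min_join {p : ℕ} {a b : V} (h : ∃ k ≤ p, Join G S k a b) (hab : a ≠ b) :
    ∃ k, 1 ≤ k ∧ k ≤ p ∧ ∃ x, Geo G S k a b x := by
  have h' : ∃ k, Join G S k a b := let ⟨k, _, h⟩ := h; ⟨k, h⟩
  refine ⟨Nat.find h', ?_, ?_, exists_geo (Nat.find_spec h') fun l hl => Nat.find_min h' hl⟩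
  · rw [Nat.one_le_iff_ne_zero]
    intro h0
    have := Nat.find_spec h'
    rw [h0, Join.zero_iff] at this
    exact hab this
  · obtain ⟨k, hk, hj⟩ := h
    exact (Nat.find_min' h' hj).trans hk

/-- Vertices of the same color in `R` are not joined by walks with interior in `S`. -/
def Uniq {K : Type*} (G : SimpleGraph V) (c : V → K) (S : V → Prop) (R : Finset K) : Prop :=
  (∀ v, S v → c v ∉ R) ∧ ∀ a b, c a = c b → c a ∈ R → Linked G S a b → a = b

/-- If two vertices in the color `β` are never joined by walks with interior in `S`, then at most
one such vertex occurs on a walk with interior in `S` and the color `β`. -/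
theorem linked_insert {T S' : V → Prop} (hT : ∀ a b, T a → T b → Linked G S a b → a = b)
    (hS' : ∀ v, S' v → S v ∨ T v) {u v : V} (h : Linked G S' u v) :
    Linked G S u v ∨ ∃ a, T a ∧ Linked G S u a ∧ Linked G S a v := by
  refine Linked.rec_left (M := fun u => Linked G S u v ∨ ∃ a, T a ∧ Linked G S u a ∧ Linked G S a v)
    (Or.inl (Linked.refl v)) (fun a h => Or.inl (Linked.of_adj h)) (fun a b hab hb _ hM => ?_) h
  rcases hS' b hb with hb | hb
  · rcases hM with hM | ⟨w, hw, h1, h2⟩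
    · exact Or.inl (hM.cons hab hb)
    · exact Or.inr ⟨w, hw, h1.cons hab hb, h2⟩
  · rcases hM with hM | ⟨w, hw, h1, h2⟩
    · exact Or.inr ⟨b, hb, Linked.of_adj hab, hM⟩
    · obtain rfl := hT b w hb hw h1
      exact Or.inr ⟨b, hb, Linked.of_adj hab, h2⟩

theorem eq_of_linked_insert {T S' : V → Prop} (hT : ∀ a b, T a → T b → Linked G S a b → a = b)
    (hS' : ∀ v, S' v → S v ∨ T v) {u v : V} (hu : T u) (hv : T v) (h : Linked G S' u v) :
    u = v := by
  rcases linked_insert hT hS' h with h | ⟨a, ha, h1, h2⟩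
  · exact hT u v hu hv h
  · exact (hT u a hu ha h1).trans (hT a v ha hv h2)

end

/-- Two vertices with colors in `R` are adjacent when they are joined by a walk of length at most
`p` with interior in `S`. -/
def shortGraph {V K : Type*} (G : SimpleGraph V) (c : V → K) (S : V → Prop) (R : Finset K)
    (p : ℕ) : SimpleGraph V where
  Adj u v := u ≠ v ∧ c u ∈ R ∧ c v ∈ R ∧ ∃ k ≤ p, Join G S k u v
  symm := ⟨fun _ _ h => ⟨h.1.symm, h.2.2.1, h.2.1, h.2.2.2.imp fun _ h' => ⟨h'.1, h'.2.symm⟩⟩⟩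
  loopless := ⟨fun _ h => h.1 rfl⟩

/-- The vertices of `Q` adjacent to `v` and preceding it in the order given by `f`. -/
noncomputable def back {V : Type*} [Fintype V] (Q : SimpleGraph V) (f : V → ℕ) (v : V) : Finset V :=
  Finset.univ.filter fun u => Q.Adj u v ∧ f u < f v

theorem mem_back {V : Type*} [Fintype V] {Q : SimpleGraph V} {f : V → ℕ} {u v : V} :
    u ∈ back Q f v ↔ Q.Adj u v ∧ f u < f v := by simp [back]

theorem back_or {V : Type*} [Fintype V] {Q : SimpleGraph V} {f : V → ℕ}
    (hf : Function.Injective f) {u v : V} (h : Q.Adj u v) : u ∈ back Q f v ∨ v ∈ back Q f u := by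
  rcases lt_trichotomy (f u) (f v) with h' | h' | h'
  · exact Or.inl (mem_back.2 ⟨h, h'⟩)
  · exact absurd (hf h') h.ne
  · exact Or.inr (mem_back.2 ⟨h.symm, h'⟩)

theorem card_linked_pairs_le {V K : Type*} [LinearOrder V] [Fintype V]
    {G : SimpleGraph V} {c : V → K} {S : V → Prop} {R : Finset K} {D d : ℕ} (hD : PathBounded G D)
    (hd : Sparse G d) (hU : Uniq G c S R) (X : Finset V) (E : Finset (V × V)) (α β : K) (r : ℕ)
    (hr : 1 ≤ r) (hα : α ∈ R) (hβ : β ∈ R) (x : V × V → ℕ → V)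
    (hE : ∀ e ∈ E, e.1 ∈ X ∧ e.2 ∈ X ∧ e.1 < e.2 ∧ c e.1 = α ∧ c e.2 = β ∧
      Geo G S (r + 1) e.1 e.2 (x e)) :
    E.card ≤ 2 ^ (2 + (2 * d + 2 * d)) * (D * X.card) := by
  obtain ⟨f, hf, hback⟩ := exists_order_of_sparse hd
  change ∀ v, (back G f v).card ≤ 2 * d at hback
  have hnadj : ∀ e ∈ E, ¬ G.Adj e.1 e.2 := by
    intro e he h
    have hg := (hE e he).2.2.2.2.2
    have := (hg.geo 0 (r + 1) (by omega) le_rfl).2.1 (by rwa [hg.start, hg.finish])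
    omega
  refine fair_sampling E (fun e => {e.1, e.2}) (fun e => back G f e.1 ∪ back G f e.2) _ _ ?_ ?_ ?_
  · intro e he
    have h1 := hnadj e he
    rw [Finset.disjoint_left]
    intro v hv
    simp only [Finset.mem_insert, Finset.mem_singleton] at hv
    simp only [Finset.mem_union, mem_back]
    rcases hv with rfl | rfl
    · rintro (h | h)
      · exact h.1.ne rfl
      · exact h1 h.1
    · rintro (h | h)
      · exact h1 h.1.symm
      · exact h.1.ne rfl
  · intro e he
    refine Nat.add_le_add Finset.card_le_two ((Finset.card_union_le _ _).trans ?_)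
    exact Nat.add_le_add (hback _) (hback _)
  · intro Z
    set Y := X.filter fun v => v ∈ Z ∧ (c v = α ∨ c v = β) ∧ Disjoint (back G f v) Z with hY
    have hYR : ∀ y ∈ Y, c y ∈ R := by
      intro y hy
      rcases (Finset.mem_filter.1 hy).2.2.1 with h | h
      · exact h ▸ hα
      · exact h ▸ hβ
    have hin : ∀ e ∈ E, ∀ i, 0 < i → i < r + 1 →
        S (x e i) ∧ Linked G S e.1 (x e i) ∧ Linked G S (x e i) e.2 := by
      intro e he i h1 h2
      have hg := (hE e he).2.2.2.2.2
      exact ⟨hg.inner i h1 h2, hg.left i h2.le, hg.right i h2.le⟩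
    refine (hD r hr Y _ x ?_).trans (Nat.mul_le_mul_left _ (Finset.card_filter_le _ _))
    have hsub : ∀ e ∈ E.filter fun e => ({e.1, e.2} : Finset V) ⊆ Z ∧
        Disjoint (back G f e.1 ∪ back G f e.2) Z, e ∈ E ∧ e.1 ∈ Y ∧ e.2 ∈ Y := by
      intro e he
      rw [Finset.mem_filter, Finset.disjoint_union_left, Finset.insert_subset_iff,
        Finset.singleton_subset_iff] at he
      obtain ⟨he, ⟨h1, h2⟩, h3, h4⟩ := he
      obtain ⟨g1, g2, -, g3, g4, -⟩ := hE e he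
      exact ⟨he, Finset.mem_filter.2 ⟨g1, h1, Or.inl g3, h3⟩,
        Finset.mem_filter.2 ⟨g2, h2, Or.inr g4, h4⟩⟩
    refine ⟨fun e he => (hE e (hsub e he).1).2.2.1, fun e he => (hsub e he).2.1,
      fun e he => (hsub e he).2.2, fun e he => (hE e (hsub e he).1).2.2.2.2.2.start,
      fun e he => (hE e (hsub e he).1).2.2.2.2.2.finish,
      fun e he => (hE e (hsub e he).1).2.2.2.2.2.geo, ?_, ?_, ?_⟩
    · intro y hy z hz hyz
      simp only [hY, Finset.mem_filter] at hy hz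
      rcases back_or hf hyz with h | h
      · exact Finset.disjoint_left.1 hz.2.2.2 h hy.2.1
      · exact Finset.disjoint_left.1 hy.2.2.2 h hz.2.1
    · intro e he y hy hy1 hy2 i h1 h2
      obtain ⟨g1, g2, g3⟩ := hin e (hsub e he).1 i (by omega) (by omega)
      obtain ⟨-, -, -, gα, gβ, -⟩ := hE e (hsub e he).1
      refine ⟨fun h => hU.1 _ g1 (h ▸ hYR y hy), fun h => ?_⟩
      rcases (Finset.mem_filter.1 hy).2.2.1 with hc | hc
      · exact hy1 (hU.2 y e.1 (hc.trans gα.symm) (hYR y hy) (g2.symm.cons h g1))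
      · exact hy2 (hU.2 y e.2 (hc.trans gβ.symm) (hYR y hy) (g3.cons h g1))
    · intro e he e' he' hne i j hi1 hi2 hj1 hj2
      obtain ⟨g1, g2, g3⟩ := hin e (hsub e he).1 i (by omega) (by omega)
      obtain ⟨g1', g2', g3'⟩ := hin e' (hsub e' he').1 j (by omega) (by omega)
      obtain ⟨-, -, -, gα, gβ, -⟩ := hE e (hsub e he).1
      obtain ⟨-, -, -, gα', gβ', -⟩ := hE e' (hsub e' he').1
      have key : Linked G S (x e i) (x e' j) → False := by
        intro h
        refine hne (Prod.ext ?_ ?_)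
        · exact hU.2 _ _ (gα.trans gα'.symm) (gα ▸ hα) ((g2.trans g1 h).trans g1' g2'.symm)
        · exact hU.2 _ _ (gβ.trans gβ'.symm) (gβ ▸ hβ) (((g3.symm).trans g1 h).trans g1' g3')
      exact ⟨fun h => key (h ▸ Linked.refl _), fun h => key (Linked.of_adj h)⟩

theorem sparse_shortGraph {V K : Type*} [LinearOrder V] [Fintype V] [Fintype K]
    {G : SimpleGraph V} {c : V → K} {S : V → Prop} {R : Finset K} {D d : ℕ} (hD : PathBounded G D)
    (hd : Sparse G d) (hU : Uniq G c S R) (p : ℕ) :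
    Sparse (shortGraph G c S R p)
      (d + Fintype.card K * Fintype.card K * (p + 1) * (2 ^ (2 + (2 * d + 2 * d)) * D)) := by
  intro X
  set H := shortGraph G c S R p with hH
  have hex : ∀ e : V × V, ∃ (k : ℕ) (x : ℕ → V), H.Adj e.1 e.2 →
      1 ≤ k ∧ k ≤ p ∧ Geo G S k e.1 e.2 x := by
    intro e
    by_cases h : H.Adj e.1 e.2
    · obtain ⟨k, h1, h2, x, hx⟩ := exists_min_join h.2.2.2 h.1
      exact ⟨k, x, fun _ => ⟨h1, h2, hx⟩⟩
    · exact ⟨0, fun _ => e.1, fun h' => absurd h' h⟩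
  choose k x hkx using hex
  set F : K × K × Fin (p + 1) → Finset (V × V) := fun t => (edgesIn H X).filter fun e =>
    c e.1 = t.1 ∧ c e.2 = t.2.1 ∧ k e = t.2.2 ∧ 2 ≤ k e with hF
  have hsub : edgesIn H X ⊆ edgesIn G X ∪ Finset.univ.biUnion F := by
    intro e he
    have he' := mem_edgesIn.1 he
    obtain ⟨h1, h2, h3, h4⟩ := he'
    obtain ⟨g1, g2, g3⟩ := hkx e h4
    rw [Finset.mem_union]
    rcases Nat.lt_or_ge (k e) 2 with h | h
    · left
      refine mem_edgesIn.2 ⟨h1, h2, h3, ?_⟩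
      have := (g3.geo 0 (k e) (by omega) le_rfl).2.2 (by omega)
      rwa [g3.start, g3.finish] at this
    · right
      rw [Finset.mem_biUnion]
      exact ⟨(c e.1, c e.2, ⟨k e, by omega⟩), Finset.mem_univ _,
        Finset.mem_filter.2 ⟨he, rfl, rfl, rfl, h⟩⟩
  have hFc : ∀ t ∈ Finset.univ, (F t).card ≤ 2 ^ (2 + (2 * d + 2 * d)) * (D * X.card) := by
    rintro ⟨α, β, m⟩ -
    rcases (F (α, β, m)).eq_empty_or_nonempty with h0 | ⟨e₀, he₀⟩
    · rw [h0]; simp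
    obtain ⟨h1, h2, h3, h4, h5⟩ := Finset.mem_filter.1 he₀
    have hadj₀ := (mem_edgesIn.1 h1).2.2.2
    simp only at h2 h3 h4
    refine card_linked_pairs_le hD hd hU X _ α β ((m : ℕ) - 1) (by omega) (h2 ▸ hadj₀.2.1)
      (h3 ▸ hadj₀.2.2.1) x fun e he => ?_
    obtain ⟨g1, g2, g3, g4, g5⟩ := Finset.mem_filter.1 he
    obtain ⟨f1, f2, f3, f4⟩ := mem_edgesIn.1 g1
    simp only at g2 g3 g4
    refine ⟨f1, f2, f3, g2, g3, ?_⟩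
    have := (hkx e f4).2.2
    rwa [g4, show (m : ℕ) = m - 1 + 1 by omega] at this
  calc (edgesIn H X).card ≤ (edgesIn G X).card + (Finset.univ.biUnion F).card :=
        (Finset.card_le_card hsub).trans (Finset.card_union_le _ _)
    _ ≤ d * X.card + Fintype.card (K × K × Fin (p + 1)) *
          (2 ^ (2 + (2 * d + 2 * d)) * (D * X.card)) :=
        Nat.add_le_add (hd X) (Finset.card_biUnion_le_card_mul _ _ _ hFc)
    _ = _ := by
        rw [Fintype.card_prod, Fintype.card_prod, Fintype.card_fin]
        generalize 2 ^ (2 + (2 * d + 2 * d)) = A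
        ring

/-- Vertices of the same color are adjacent when they precede a common neighbor in `Q`. -/
def fratGraph {V K : Type*} [Fintype V] (Q : SimpleGraph V) (c : V → K) (f : V → ℕ) :
    SimpleGraph V where
  Adj u v := u ≠ v ∧ c u = c v ∧ ∃ a, u ∈ back Q f a ∧ v ∈ back Q f a
  symm := ⟨fun _ _ h => ⟨h.1.symm, h.2.1.symm, h.2.2.imp fun _ h' => h'.symm⟩⟩
  loopless := ⟨fun _ h => h.1 rfl⟩

theorem card_frat_pairs_le {V K : Type*} [LinearOrder V] [Fintype V]
    {G : SimpleGraph V} {c : V → K} {S : V → Prop} {R : Finset K} {D B p : ℕ}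
    (hD : PathBounded G D) (hU : Uniq G c S R) (hp : 1 ≤ p) {f : V → ℕ}
    (hf : Function.Injective f) (hB : ∀ v, (back (shortGraph G c S R p) f v).card ≤ B)
    (X : Finset V) (E : Finset (V × V)) (α β : K) (k l : ℕ) (hk : 1 ≤ k) (hl : 1 ≤ l)
    (hα : α ∈ R) (hβ : β ∈ R) (a : V × V → V) (x y : V × V → ℕ → V)
    (hE : ∀ e ∈ E, e.1 ∈ X ∧ e.2 ∈ X ∧ e.1 < e.2 ∧ c e.1 = β ∧ c e.2 = β ∧ c (a e) = α ∧
      e.1 ∈ back (shortGraph G c S R p) f (a e) ∧ e.2 ∈ back (shortGraph G c S R p) f (a e) ∧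
      Geo G S k e.1 (a e) (x e) ∧ Geo G S l (a e) e.2 (y e)) :
    E.card ≤ 2 ^ (3 + (B + B + B)) * (D * X.card) := by
  rcases E.eq_empty_or_nonempty with rfl | ⟨e₀, he₀⟩
  · simp
  have hαβ : α ≠ β := by
    rintro rfl
    obtain ⟨-, -, -, h1, -, h2, h3, -, h4, -⟩ := hE e₀ he₀
    exact (mem_back.1 h3).1.ne (hU.2 _ _ (h1.trans h2.symm) (h1 ▸ hα)
      (h4.finish ▸ h4.left k le_rfl))
  set H := shortGraph G c S R p with hH
  have hsame : ∀ u v, c u = β → c v = β → Linked G S u v → u = v := fun u v hu hv =>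
    hU.2 u v (hu.trans hv.symm) (hu ▸ hβ)
  have hsame' : ∀ u v, c u = α → c v = α → Linked G S u v → u = v := fun u v hu hv =>
    hU.2 u v (hu.trans hv.symm) (hu ▸ hα)
  have hHlink : ∀ u v, H.Adj u v → Linked G S u v := fun u v h =>
    let ⟨k, _, hk⟩ := h.2.2.2
    ⟨k, hk⟩
  refine fair_sampling E (fun e => {e.1, e.2, a e})
    (fun e => back H f e.1 ∪ back H f e.2 ∪ back H f (a e) \ {e.1, e.2}) _ _ ?_ ?_ ?_
  · intro e he
    obtain ⟨-, -, hlt, h1, h2, h3, h4, h5, -⟩ := hE e he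
    have hno : ∀ u v, c u = β → c v = β → u ∉ back H f v := fun u v hu hv h =>
      (mem_back.1 h).1.ne (hsame u v hu hv (hHlink u v (mem_back.1 h).1))
    have h4' := (mem_back.1 h4).2
    have h5' := (mem_back.1 h5).2
    rw [Finset.disjoint_left]
    intro v hv
    simp only [Finset.mem_insert, Finset.mem_singleton] at hv
    simp only [Finset.mem_union, Finset.mem_sdiff, Finset.mem_insert, Finset.mem_singleton]
    rcases hv with rfl | rfl | rfl
    · rintro ((h | h) | h)
      · exact hno _ _ h1 h1 h
      · exact hno _ _ h1 h2 h
      · exact h.2 (Or.inl rfl)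
    · rintro ((h | h) | h)
      · exact hno _ _ h2 h1 h
      · exact hno _ _ h2 h2 h
      · exact h.2 (Or.inr rfl)
    · rintro ((h | h) | h)
      · exact lt_asymm h4' (mem_back.1 h).2
      · exact lt_asymm h5' (mem_back.1 h).2
      · exact (mem_back.1 h.1).1.ne rfl
  · intro e he
    refine Nat.add_le_add Finset.card_le_three ((Finset.card_union_le _ _).trans ?_)
    refine Nat.add_le_add ((Finset.card_union_le _ _).trans (Nat.add_le_add (hB _) (hB _))) ?_
    exact (Finset.card_le_card Finset.sdiff_subset).trans (hB _)
  · intro Z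
    set Y := X.filter fun v => v ∈ Z ∧ c v = β ∧ Disjoint (back H f v) Z with hY
    have hYβ : ∀ v ∈ Y, c v = β := fun v hv => (Finset.mem_filter.1 hv).2.2.1
    set r := k + l - 1 with hr
    set w : V × V → ℕ → V := fun e t => if t ≤ k then x e t else y e (t - k) with hw
    have hin : ∀ e ∈ E, ∀ i, 0 < i → i < r + 1 →
        (S (w e i) ∧ Linked G S (w e i) (a e) ∧
          (Linked G S (w e i) e.1 ∨ Linked G S (w e i) e.2)) ∨ w e i = a e := by
      intro e he i h1 h2
      obtain ⟨-, -, -, -, -, -, -, -, hx, hy⟩ := hE e he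
      rcases lt_trichotomy i k with h | h | h
      · left
        rw [show w e i = x e i from if_pos h.le]
        exact ⟨hx.inner i h1 h, hx.right i h.le, Or.inl (hx.left i h.le).symm⟩
      · right
        rw [show w e i = x e i from if_pos h.le, h, hx.finish]
      · left
        rw [show w e i = y e (i - k) from if_neg (by omega)]
        exact ⟨hy.inner _ (by omega) (by omega), (hy.left _ (by omega)).symm,
          Or.inr (hy.right _ (by omega))⟩
    refine (hD r (by omega) Y _ w ?_).trans (Nat.mul_le_mul_left _ (Finset.card_filter_le _ _))
    have hsub : ∀ e ∈ E.filter fun e => ({e.1, e.2, a e} : Finset V) ⊆ Z ∧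
        Disjoint (back H f e.1 ∪ back H f e.2 ∪ back H f (a e) \ {e.1, e.2}) Z,
        e ∈ E ∧ e.1 ∈ Y ∧ e.2 ∈ Y ∧ a e ∈ Z ∧ ∀ v ∈ back H f (a e), v ∈ Z → v = e.1 ∨ v = e.2 := by
      intro e he
      rw [Finset.mem_filter, Finset.disjoint_union_left, Finset.disjoint_union_left,
        Finset.insert_subset_iff, Finset.insert_subset_iff, Finset.singleton_subset_iff] at he
      obtain ⟨he, ⟨h1, h2, h3⟩, ⟨h4, h5⟩, h6⟩ := he
      obtain ⟨g1, g2, -, g3, g4, -⟩ := hE e he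
      refine ⟨he, Finset.mem_filter.2 ⟨g1, h1, g3, h4⟩,
        Finset.mem_filter.2 ⟨g2, h2, g4, h5⟩, h3, fun v hv hvZ => ?_⟩
      by_contra hcon
      refine Finset.disjoint_left.1 h6 (Finset.mem_sdiff.2 ⟨hv, ?_⟩) hvZ
      simpa using hcon
    refine ⟨fun e he => (hE e (hsub e he).1).2.2.1, fun e he => (hsub e he).2.1,
      fun e he => (hsub e he).2.2.1, ?_, ?_, ?_, ?_, ?_, ?_⟩
    · intro e he
      obtain ⟨-, -, -, -, -, -, -, -, hx, hy⟩ := hE e (hsub e he).1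
      rw [show w e 0 = x e 0 from if_pos (Nat.zero_le _), hx.start]
    · intro e he
      obtain ⟨-, -, -, -, -, -, -, -, hx, hy⟩ := hE e (hsub e he).1
      rw [show w e (r + 1) = y e (r + 1 - k) from if_neg (by omega),
        show r + 1 - k = l by omega, hy.finish]
    · intro e he i j hij hj
      obtain ⟨-, -, hlt, h1, h2, h3, h4, h5, hx, hy⟩ := hE e (hsub e he).1
      rcases Nat.lt_or_ge k j with hkj | hjk
      · rw [show w e j = y e (j - k) from if_neg (by omega)]
        rcases Nat.lt_or_ge i k with hik | hki
        · rw [show w e i = x e i from if_pos hik.le]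
          have key : Linked G S (x e i) (y e (j - k)) → False := by
            intro h
            have g1 : Linked G S e.1 (y e (j - k)) := by
              rcases Nat.eq_zero_or_pos i with h0 | h0
              · rwa [h0, hx.start] at h
              · exact (hx.left i hik.le).trans (hx.inner i h0 hik) h
            have g2 : Linked G S e.1 e.2 := by
              rcases Nat.lt_or_ge (j - k) l with h0 | h0
              · exact g1.trans (hy.inner _ (by omega) h0) (hy.right _ h0.le)
              · rwa [show j - k = l by omega, hy.finish] at g1
            exact hlt.ne (hsame _ _ h1 h2 g2)
          exact ⟨fun h => key (h ▸ Linked.refl _),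
            fun h => absurd (Linked.of_adj h) key, fun h => absurd h (by omega)⟩
        · have hwi : w e i = y e (i - k) := by
            rcases Nat.eq_or_lt_of_le hki with h0 | h0
            · rw [show w e i = x e i from if_pos (by omega), ← h0, hx.finish, Nat.sub_self,
                hy.start]
            · exact if_neg (by omega)
          rw [hwi]
          have := hy.geo (i - k) (j - k) (by omega) (by omega)
          exact ⟨this.1, this.2.trans (by omega)⟩
      · rw [show w e j = x e j from if_pos hjk, show w e i = x e i from if_pos (by omega)]
        exact hx.geo i j hij hjk
    · intro u hu v hv huv
      exact huv.ne (hsame u v (hYβ u hu) (hYβ v hv) (Linked.of_adj huv))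
    · intro e he u hu hu1 hu2 i hi1 hi2
      obtain ⟨he, he1, he2, haZ, hback⟩ := hsub e he
      obtain ⟨-, -, hlt, h1, h2, h3, h4, h5, -⟩ := hE e he
      rcases hin e he i (by omega) (by omega) with ⟨g1, -, g2⟩ | g
      · refine ⟨fun h => hU.1 _ g1 (h ▸ (hYβ u hu).symm ▸ hβ), fun h => ?_⟩
        rcases g2 with g2 | g2
        · exact hu1 (hsame _ _ (hYβ u hu) h1 (g2.cons h g1))
        · exact hu2 (hsame _ _ (hYβ u hu) h2 (g2.cons h g1))
      · rw [g]
        refine ⟨fun h => hαβ (h3.symm.trans (h ▸ hYβ u hu)), fun h => ?_⟩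
        have hadj : H.Adj u (a e) := ⟨h.ne, (hYβ u hu).symm ▸ hβ, h3.symm ▸ hα, 1, hp,
          Join.one_iff.2 h⟩
        have hu' := (Finset.mem_filter.1 hu).2
        rcases back_or hf hadj with h' | h'
        · rcases hback u h' hu'.1 with h6 | h6
          · exact hu1 h6
          · exact hu2 h6
        · exact Finset.disjoint_left.1 hu'.2.2 h' haZ
    · intro e he e' he' hne i j hi1 hi2 hj1 hj2
      obtain ⟨he, he1, he2, haZ, hback⟩ := hsub e he
      obtain ⟨he', he1', he2', haZ', hback'⟩ := hsub e' he'
      obtain ⟨-, -, hlt, -, -, h3, h4, h5, -⟩ := hE e he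
      obtain ⟨-, -, hlt', -, -, h3', h4', h5', -⟩ := hE e' he'
      have hane : a e ≠ a e' := by
        intro h
        rw [← h] at h4' h5'
        have g1 := hback _ h4' (Finset.mem_filter.1 he1').2.1
        have g2 := hback _ h5' (Finset.mem_filter.1 he2').2.1
        rcases g1 with g1 | g1 <;> rcases g2 with g2 | g2
        · rw [g1, g2] at hlt'; exact lt_irrefl _ hlt'
        · exact hne (Prod.ext g1.symm g2.symm)
        · rw [g1, g2] at hlt'; exact lt_asymm hlt hlt'
        · rw [g1, g2] at hlt'; exact lt_irrefl _ hlt'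
      have key : Linked G S (w e i) (w e' j) → False := by
        intro h
        have g1 : Linked G S (a e) (w e' j) := by
          rcases hin e he i (by omega) (by omega) with ⟨g1, g2, -⟩ | g
          · exact g2.symm.trans g1 h
          · rwa [g] at h
        have g2 : Linked G S (a e) (a e') := by
          rcases hin e' he' j (by omega) (by omega) with ⟨g3, g4, -⟩ | g
          · exact g1.trans g3 g4
          · rwa [g] at g1
        exact hane (hsame' _ _ h3 h3' g2)
      exact ⟨fun h => key (h ▸ Linked.refl _), fun h => key (Linked.of_adj h)⟩

theorem sparse_fratGraph {V K : Type*} [LinearOrder V] [Fintype V] [Fintype K]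
    {G : SimpleGraph V} {c : V → K} {S : V → Prop} {R : Finset K} {D B p : ℕ}
    (hD : PathBounded G D) (hU : Uniq G c S R) (hp : 1 ≤ p) {f : V → ℕ}
    (hf : Function.Injective f) (hB : ∀ v, (back (shortGraph G c S R p) f v).card ≤ B) :
    Sparse (fratGraph (shortGraph G c S R p) c f)
      (Fintype.card K * Fintype.card K * ((p + 1) * (p + 1)) * (2 ^ (3 + (B + B + B)) * D)) := by
  intro X
  set H := shortGraph G c S R p with hH
  set Q := fratGraph H c f with hQ
  have hgeo : ∀ u v, H.Adj u v → ∃ k, 1 ≤ k ∧ k ≤ p ∧ ∃ x, Geo G S k u v x := fun u v h =>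
    exists_min_join h.2.2.2 h.1
  have hex : ∀ e : V × V, ∃ (a : V) (k l : ℕ) (x y : ℕ → V), Q.Adj e.1 e.2 →
      e.1 ∈ back H f a ∧ e.2 ∈ back H f a ∧ 1 ≤ k ∧ k ≤ p ∧ Geo G S k e.1 a x ∧
      1 ≤ l ∧ l ≤ p ∧ Geo G S l a e.2 y := by
    intro e
    by_cases h : Q.Adj e.1 e.2
    · obtain ⟨-, -, a, h1, h2⟩ := h
      obtain ⟨k, hk1, hk2, x, hx⟩ := hgeo _ _ (mem_back.1 h1).1
      obtain ⟨l, hl1, hl2, y, hy⟩ := hgeo _ _ (mem_back.1 h2).1.symm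
      exact ⟨a, k, l, x, y, fun _ => ⟨h1, h2, hk1, hk2, hx, hl1, hl2, hy⟩⟩
    · exact ⟨e.1, 0, 0, fun _ => e.1, fun _ => e.1, fun h' => absurd h' h⟩
  choose a k l x y hxy using hex
  set F : K × K × Fin (p + 1) × Fin (p + 1) → Finset (V × V) := fun t =>
    (edgesIn Q X).filter fun e =>
      c (a e) = t.1 ∧ c e.1 = t.2.1 ∧ k e = t.2.2.1 ∧ l e = t.2.2.2 with hF
  have hsub : edgesIn Q X ⊆ Finset.univ.biUnion F := by
    intro e he
    obtain ⟨h1, h2, h3, h4⟩ := mem_edgesIn.1 he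
    obtain ⟨-, -, -, g1, -, -, g2, -⟩ := hxy e h4
    rw [Finset.mem_biUnion]
    exact ⟨(c (a e), c e.1, ⟨k e, by omega⟩, ⟨l e, by omega⟩), Finset.mem_univ _,
      Finset.mem_filter.2 ⟨he, rfl, rfl, rfl, rfl⟩⟩
  have hFc : ∀ t ∈ Finset.univ, (F t).card ≤ 2 ^ (3 + (B + B + B)) * (D * X.card) := by
    rintro ⟨α, β, m, n⟩ -
    rcases (F (α, β, m, n)).eq_empty_or_nonempty with h0 | ⟨e₀, he₀⟩
    · rw [h0]; simp
    obtain ⟨h1, h2, h3, h4, h5⟩ := Finset.mem_filter.1 he₀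
    obtain ⟨g1, g2, g3, g4, g5, g6, g7, g8⟩ := hxy e₀ (mem_edgesIn.1 h1).2.2.2
    simp only at h2 h3 h4 h5
    refine card_frat_pairs_le hD hU hp hf hB X _ α β (m : ℕ) (n : ℕ) (h4 ▸ g3) (h5 ▸ g6)
      (h2 ▸ (mem_back.1 g1).1.2.2.1) (h3 ▸ (mem_back.1 g1).1.2.1) a x y fun e he => ?_
    obtain ⟨k1, k2, k3, k4, k5⟩ := Finset.mem_filter.1 he
    obtain ⟨f1, f2, f3, f4⟩ := mem_edgesIn.1 k1
    simp only at k2 k3 k4 k5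
    obtain ⟨l1, l2, l3, l4, l5, l6, l7, l8⟩ := hxy e f4
    exact ⟨f1, f2, f3, k3, f4.2.1.symm.trans k3, k2, l1, l2, k4 ▸ l5, k5 ▸ l8⟩
  calc (edgesIn Q X).card ≤ (Finset.univ.biUnion F).card := Finset.card_le_card hsub
    _ ≤ Fintype.card (K × K × Fin (p + 1) × Fin (p + 1)) *
          (2 ^ (3 + (B + B + B)) * (D * X.card)) := Finset.card_biUnion_le_card_mul _ _ _ hFc
    _ = _ := by
        rw [Fintype.card_prod, Fintype.card_prod, Fintype.card_prod, Fintype.card_fin]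
        generalize 2 ^ (3 + (B + B + B)) = A
        ring

/-- The vertices reached from `v` by descending paths of `Q` with at least one and at most `t`
edges. -/
noncomputable def anc {V : Type*} [Fintype V] (Q : SimpleGraph V) (f : V → ℕ) : ℕ → V → Finset V
  | 0, _ => ∅
  | t + 1, v => back Q f v ∪ (back Q f v).biUnion (anc Q f t)

/-- There is a descending path with `t` edges starting at `v`, all of whose further vertices have
colors in `I`. -/
def Desc {V L : Type*} [Fintype V] (Q : SimpleGraph V) (f : V → ℕ) (κ : V → L) (I : Finset L) :
    ℕ → V → Prop
  | 0, _ => True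
  | t + 1, v => ∃ u ∈ back Q f v, κ u ∈ I ∧ Desc Q f κ I t u

section
variable {V L : Type*} [Fintype V] {Q : SimpleGraph V} {f : V → ℕ}

theorem exists_card_anc_le (B p : ℕ) : ∃ A : ℕ, ∀ {V : Type*} [Fintype V] (Q : SimpleGraph V)
    (f : V → ℕ), (∀ v, (back Q f v).card ≤ B) → ∀ v, (anc Q f p v).card ≤ A := by
  induction p with
  | zero => exact ⟨0, fun Q f _ v => by simp [anc]⟩
  | succ p ih =>
    obtain ⟨A, hA⟩ := ih
    refine ⟨B + B * A, fun Q f hB v => ?_⟩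
    refine (Finset.card_union_le _ _).trans (Nat.add_le_add (hB v) ?_)
    exact (Finset.card_biUnion_le_card_mul _ _ A fun u _ => hA Q f hB u).trans
      (Nat.mul_le_mul_right _ (hB v))

theorem lt_of_mem_anc {t : ℕ} {u v : V} (h : u ∈ anc Q f t v) : f u < f v := by
  induction t generalizing v with
  | zero => simp [anc] at h
  | succ t ih =>
    simp only [anc, Finset.mem_union, Finset.mem_biUnion] at h
    rcases h with h | ⟨w, hw, h⟩
    · exact (mem_back.1 h).2
    · exact (ih h).trans (mem_back.1 hw).2

theorem anc_mono {s t : ℕ} (hst : s ≤ t) {u v : V} (h : u ∈ anc Q f s v) : u ∈ anc Q f t v := by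
  induction t generalizing s v with
  | zero => obtain rfl : s = 0 := by omega
            exact h
  | succ t ih =>
    rcases s with _ | s
    · simp [anc] at h
    · simp only [anc, Finset.mem_union, Finset.mem_biUnion] at h ⊢
      exact h.imp_right fun ⟨w, hw, h⟩ => ⟨w, hw, ih (by omega) h⟩

theorem Desc.exists_colors {p : ℕ} {κ : V → L} (hκ : ∀ v, ∀ u ∈ anc Q f p v, κ u ≠ κ v)
    {I : Finset L} {t : ℕ} (ht : t ≤ p) {v : V} (h : Desc Q f κ I t v) :
    ∃ M ⊆ I, M.card = t ∧ ∀ x ∈ M, ∃ u ∈ anc Q f t v, κ u = x := by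
  induction t generalizing v with
  | zero => exact ⟨∅, by simp⟩
  | succ t ih =>
    obtain ⟨u, hu, huI, h⟩ := h
    obtain ⟨M, hMI, hMc, hM⟩ := ih (by omega) h
    have hnot : κ u ∉ M := by
      intro h'
      obtain ⟨w, hw, he⟩ := hM _ h'
      exact hκ u w (anc_mono (by omega) hw) he
    refine ⟨insert (κ u) M, Finset.insert_subset huI hMI, by
      rw [Finset.card_insert_of_notMem hnot, hMc], fun x hx => ?_⟩
    rcases Finset.mem_insert.1 hx with rfl | hx
    · exact ⟨u, Finset.mem_union_left _ hu, rfl⟩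
    · obtain ⟨w, hw, he⟩ := hM x hx
      exact ⟨w, Finset.mem_union_right _ (Finset.mem_biUnion.2 ⟨u, hu, hw⟩), he⟩

theorem exists_heights {p : ℕ} {κ : V → L} (hκ : ∀ v, ∀ u ∈ anc Q f p v, κ u ≠ κ v) :
    ∃ h : V → Finset L → Fin (p + 1), ∀ I : Finset L, I.card ≤ p → ∀ u v, κ v ∈ I → κ u ∈ I →
      u ∈ back Q f v → h u I < h v I := by
  refine ⟨fun v I => ⟨Nat.findGreatest (fun t => Desc Q f κ I t v) p,
    Nat.lt_succ_of_le (Nat.findGreatest_le p)⟩, fun I hI u v hv hu huv => ?_⟩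
  rw [Fin.lt_def]
  simp only
  set t := Nat.findGreatest (fun t => Desc Q f κ I t u) p with ht
  have htp : t ≤ p := Nat.findGreatest_le p
  have hdesc : Desc Q f κ I t u :=
    Nat.findGreatest_spec (P := fun t => Desc Q f κ I t u) (Nat.zero_le p) trivial
  have hlt : t < p := by
    obtain ⟨M, hMI, hMc, hM⟩ := hdesc.exists_colors hκ htp
    have hnot : κ u ∉ M := by
      intro h'
      obtain ⟨w, hw, he⟩ := hM _ h'
      exact hκ u w (anc_mono htp hw) he
    have := Finset.card_le_card (Finset.insert_subset hu hMI)
    rw [Finset.card_insert_of_notMem hnot] at this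
    omega
  have : t + 1 ≤ Nat.findGreatest (fun t => Desc Q f κ I t v) p :=
    Nat.le_findGreatest hlt ⟨u, huv, hu, hdesc⟩
  omega

end

theorem exists_short_of_tags {V K X : Type*} {G : SimpleGraph V} {c : V → K} {S : V → Prop}
    {R : Finset K} {p : ℕ} (hU : Uniq G c S R) {tag : V → Finset (K × Fin (p + 1))}
    (htag : ∀ v t, t ∈ tag v ↔ ∃ k ≤ (t.2 : ℕ), ∃ w, c w = t.1 ∧ Join G S k v w)
    {c' : V → X} (hc' : ∀ u v, c' u = c' v → tag u = tag v) {T : Finset X} (hT : T.card < p)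
    {S' : V → Prop} (hS' : ∀ v, S' v → S v ∧ c' v ∈ T) {a b : V} (hb : c b ∈ R)
    (h : Linked G S' a b) : ∃ k ≤ p, Join G S k a b := by
  by_contra hcon
  obtain ⟨k, x, rfl, rfl, hadj, hS⟩ := h
  set N : ℕ → V → Prop := fun j v => ∃ l ≤ j, Join G S l v (x k) with hN
  have hmono : ∀ j l v, j ≤ l → N j v → N l v := fun j l v hjl ⟨m, hm, h⟩ => ⟨m, hm.trans hjl, h⟩
  have hex : ∀ j, j < p → ∃ i, 0 < i ∧ i < k ∧ ¬ N j (x i) ∧ N (j + 1) (x i) := by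
    intro j hj
    have h1 : ∃ i, N j (x i) := ⟨k, 0, Nat.zero_le _, Join.zero_iff.2 rfl⟩
    have h2 := Nat.find_spec h1
    have h3 : Nat.find h1 ≤ k := Nat.find_min' h1 ⟨0, Nat.zero_le _, Join.zero_iff.2 rfl⟩
    have h4 : Nat.find h1 ≠ 0 := by
      intro h0
      rw [h0] at h2
      exact hcon (hmono _ _ _ hj.le h2)
    obtain ⟨i, hi⟩ := Nat.exists_eq_succ_of_ne_zero h4
    have h5 := Nat.find_min h1 (m := i) (by omega)
    rw [hi] at h2 h3
    have h6 : N (j + 1) (x i) := by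
      rcases Nat.lt_or_ge (i + 1) k with h | h
      · obtain ⟨l, hl, hlj⟩ := h2
        exact ⟨l + 1, by omega, hlj.cons (hadj i (by omega)) (hS' _ (hS _ (by omega) h)).1⟩
      · have hik : i + 1 = k := by omega
        exact ⟨1, by omega, Join.one_iff.2 (hik ▸ hadj i (by omega))⟩
    refine ⟨i, Nat.pos_of_ne_zero fun h0 => ?_, by omega, h5, h6⟩
    rw [h0] at h6
    exact hcon (hmono _ _ _ hj h6)
  choose! i hi using hex
  have hlt : ∀ j l, j < l → l < p → c' (x (i j)) ≠ c' (x (i l)) := by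
    intro j l hjl hl he
    obtain ⟨-, -, -, h1⟩ := hi j (by omega)
    obtain ⟨h2, h3, h4, -⟩ := hi l hl
    obtain ⟨m, hm, hmj⟩ := h1
    have : (c (x k), (⟨j + 1, by omega⟩ : Fin (p + 1))) ∈ tag (x (i j)) :=
      (htag _ _).2 ⟨m, hm, x k, rfl, hmj⟩
    rw [hc' _ _ he, htag] at this
    obtain ⟨q, hq, w, hw, hqj⟩ := this
    have hSl := (hS' _ (hS _ h2 h3)).1
    have hlk : Linked G S (x (i l)) (x k) :=
      (linked_right hadj hS h3.le).mono fun v hv => (hS' v hv).1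
    have := hU.2 w (x k) hw (by rw [hw]; exact hb) ((Linked.symm ⟨q, hqj⟩).trans hSl hlk)
    rw [this] at hqj
    exact h4 ⟨q, le_trans hq hjl, hqj⟩
  obtain ⟨j, hj, l, hl, hne, he⟩ := Finset.exists_ne_map_eq_of_card_lt_of_maps_to
    (s := Finset.range p) (t := T) (by rwa [Finset.card_range]) (f := fun j => c' (x (i j)))
    (fun j hj => by
      obtain ⟨h1, h2, -⟩ := hi j (Finset.mem_range.1 (Finset.mem_coe.1 hj))
      exact Finset.mem_coe.2 (hS' _ (hS _ h1 h2)).2)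
  rw [Finset.mem_range] at hj hl
  rcases lt_or_gt_of_ne hne with h | h
  · exact hlt j l h hl he
  · exact hlt l j h hj he.symm

theorem exists_refinement (K : Type) [Fintype K] (p D d : ℕ) (hp : 1 ≤ p) :
    ∃ T : Type, Finite T ∧ Nonempty T ∧ ∀ {V : Type} [LinearOrder V] [Fintype V] (G : SimpleGraph V)
      (c : V → K) (S : V → Prop) (R : Finset K), PathBounded G D → Sparse G d → Uniq G c S R →
      ∃ τ : V → T, ∀ {X : Type} [DecidableEq X] (c' : V → X) (π : X → K) (θ : X → T),
        (∀ v, π (c' v) = c v) →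
        (∀ v, θ (c' v) = τ v) → ∀ J : Finset X, J.card ≤ p →
        (∀ v, c' v ∈ J → c v ∉ R → S v) → (J.filter fun x => π x ∈ R).Nonempty →
        ∃ α ∈ J.filter fun x => π x ∈ R,
          Uniq G c' (fun v => c' v ∈ J ∧ c' v ∉ (J.filter fun x => π x ∈ R).erase α)
            ((J.filter fun x => π x ∈ R).erase α) := by
  set C := d + Fintype.card K * Fintype.card K * (p + 1) * (2 ^ (2 + (2 * d + 2 * d)) * D) with hC
  set B := 2 * C with hB
  set F := Fintype.card K * Fintype.card K * ((p + 1) * (p + 1)) *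
    (2 ^ (3 + (B + B + B)) * D) with hF
  obtain ⟨A, hA⟩ := exists_card_anc_le.{0} B p
  refine ⟨Finset (K × Fin (p + 1)) × Fin (2 * F + 1) × Fin (A + 1) ×
    (Finset (K × Fin (A + 1)) → Fin (p + 1)), inferInstance, inferInstance, ?_⟩
  intro V _ _ G c S R hD hd hU
  set H := shortGraph G c S R p with hH
  obtain ⟨f, hf, hback⟩ := exists_order_of_sparse (sparse_shortGraph hD hd hU p)
  change ∀ v, (back H f v).card ≤ B at hback
  obtain ⟨g, hg, hgback⟩ := exists_order_of_sparse (sparse_fratGraph hD hU hp hf hback)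
  change ∀ v, (back (fratGraph H c f) g v).card ≤ 2 * F at hgback
  obtain ⟨φ, hφ⟩ := exists_greedy g _ _ (fun v u hu => (mem_back.1 hu).2) hgback
  obtain ⟨ψ, hψ⟩ := exists_greedy f _ _ (fun v u hu => lt_of_mem_anc hu) (hA H f hback)
  set κ : V → K × Fin (A + 1) := fun v => (c v, ψ v) with hκ
  obtain ⟨h, hh⟩ := exists_heights (Q := H) (f := f) (p := p) (κ := κ)
    fun v u hu he => hψ v u hu (congrArg Prod.snd he)
  set tag : V → Finset (K × Fin (p + 1)) := fun v => Finset.univ.filter fun t =>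
    ∃ k ≤ (t.2 : ℕ), ∃ w, c w = t.1 ∧ Join G S k v w with htag
  refine ⟨fun v => (tag v, φ v, ψ v, h v), ?_⟩
  intro X _ c' π θ hπ hθ J hJ hJS hne
  set R' := J.filter fun x => π x ∈ R with hR'
  have hc : ∀ u v, c' u = c' v → c u = c v := fun u v he => by rw [← hπ, ← hπ, he]
  have hτ : ∀ u v, c' u = c' v → tag u = tag v ∧ φ u = φ v := by
    intro u v he
    have := hθ u
    rw [he, hθ v] at this
    exact ⟨(congrArg Prod.fst this).symm, (congrArg (fun t => t.2.1) this).symm⟩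
  set I : Finset (K × Fin (A + 1)) := J.image fun x => (π x, (θ x).2.2.1) with hI
  have hIc : I.card ≤ p := Finset.card_image_le.trans hJ
  have hκI : ∀ v, c' v ∈ J → κ v ∈ I := by
    intro v hv
    refine Finset.mem_image.2 ⟨c' v, hv, ?_⟩
    rw [hπ, hθ]
  obtain ⟨α, hα, hmax⟩ := Finset.exists_max_image R' (fun x => (θ x).2.2.2 I) hne
  refine ⟨α, hα, fun v hv => hv.2, ?_⟩
  have hαJ := Finset.mem_filter.1 hα
  intro u v huv huR hlink
  by_contra hne'
  set S' : V → Prop := fun v => c' v ∈ J \ R' with hS'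
  have hS'S : ∀ v, S' v → S v := by
    intro v hv
    obtain ⟨h1, h2⟩ := Finset.mem_sdiff.1 hv
    exact hJS v h1 fun h3 => h2 (Finset.mem_filter.2 ⟨h1, by rwa [hπ]⟩)
  have hlow : ∀ a b, c a = c b → c a ∈ R → Linked G S' a b → a = b := fun a b h1 h2 h3 =>
    hU.2 a b h1 h2 (h3.mono hS'S)
  have hcR : ∀ w, c' w ∈ R' → c w ∈ R := fun w hw => hπ w ▸ (Finset.mem_filter.1 hw).2
  have huR' := Finset.mem_of_mem_erase huR
  rcases linked_insert (S := S') (T := fun w => c' w = α) (S' := _)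
    (fun a b ha hb hab => hlow a b (hc a b (ha.trans hb.symm)) (hcR a (ha ▸ hα)) hab)
    (fun w hw => by
      obtain ⟨h1, h2⟩ := hw
      by_cases h3 : c' w = α
      · exact Or.inr h3
      · exact Or.inl (Finset.mem_sdiff.2 ⟨h1, fun h4 => h2 (Finset.mem_erase.2 ⟨h3, h4⟩)⟩)) hlink
    with hl | ⟨a, ha, h1, h2⟩
  · exact hne' (hlow u v (hc u v huv) (hcR u huR') hl)
  · have hTc : (J \ R').card < p := by
      have h3 := Finset.card_sdiff_add_card_eq_card (Finset.filter_subset (fun x => π x ∈ R) J)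
      have h4 := hne.card_pos
      rw [← hR'] at h3
      omega
    have key : ∀ w, c' w ∈ R'.erase α → Linked G S' w a → w ∈ back H f a := by
      intro w hw hwa
      obtain ⟨hw1, hw2⟩ := Finset.mem_erase.1 hw
      have hwa' : w ≠ a := fun he => hw1 (he ▸ ha)
      have hadj : H.Adj w a := by
        refine ⟨hwa', hcR w hw2, hcR a (ha ▸ hα), ?_⟩
        exact exists_short_of_tags hU (tag := tag) (fun v t => by simp [htag])
          (fun u v he => (hτ u v he).1) hTc (fun v hv => ⟨hS'S v hv, hv⟩) (hcR a (ha ▸ hα)) hwa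
      rcases back_or hf hadj with h3 | h3
      · exact h3
      · have h4 := hh I hIc a w (hκI w (Finset.mem_filter.1 hw2).1) (hκI a (ha ▸ hαJ.1)) h3
        have h5 := hmax _ hw2
        rw [← ha, hθ, hθ] at h5
        exact absurd h4 (not_lt.2 h5)
    have h3 := key u huR h1
    have h4 := key v (huv ▸ huR) h2.symm
    have hQ : (fratGraph H c f).Adj u v := ⟨hne', hc u v huv, a, h3, h4⟩
    have h5 := (hτ u v huv).2
    rcases back_or hg hQ with h6 | h6
    · exact hφ _ _ h6 h5
    · exact hφ _ _ h6 h5.symm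

/-- Any two distinct vertices of color `β` lie in different components of the subgraph induced by
the colors in `J`. -/
def Centered {V K : Type*} (G : SimpleGraph V) (c : V → K) (J : Finset K) (β : K) : Prop :=
  ∀ u v, c u = β → c v = β → Linked G (fun w => c w ∈ J) u v → u = v

theorem exists_stage (p D d k : ℕ) (hp : 1 ≤ p) (j : ℕ) : ∃ K : Type, Finite K ∧
    ∀ {V : Type} [LinearOrder V] [Fintype V] (G : SimpleGraph V), PathBounded G D → Sparse G d →
      G.Colorable k → ∃ c : V → K, ∀ J : Finset K, J.Nonempty → J.card ≤ p →
        (∃ β ∈ J, Centered G c J β) ∨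
        ∃ R ⊆ J, R.Nonempty ∧ Uniq G c (fun v => c v ∈ J ∧ c v ∉ R) R ∧ j + R.card ≤ J.card := by
  induction j with
  | zero =>
    refine ⟨Fin k, inferInstance, fun G _ _ ⟨c⟩ => ⟨c, fun J hJ _ => Or.inr
      ⟨J, subset_rfl, hJ, ⟨fun v hv => hv.2, fun a b hab _ h => ?_⟩,
      (Nat.zero_add _).le⟩⟩⟩
    revert hab
    refine Linked.rec_left (M := fun a => c a = c b → a = b) (fun _ => rfl)
      (fun a h hab => absurd hab (c.valid h)) (fun a w _ hw => ?_) h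
    exact absurd hw.1 hw.2
  | succ j ih =>
    obtain ⟨K, hK, hcol⟩ := ih
    have := Fintype.ofFinite K
    obtain ⟨T, hT, hT0, href⟩ := exists_refinement K p D d hp
    refine ⟨K × (Finset K × Finset K → T), inferInstance, fun {V} _ _ G hD hd hk => ?_⟩
    obtain ⟨c, hc⟩ := hcol G hD hd hk
    have hex : ∀ JR : Finset K × Finset K, ∃ τ : V → T,
        Uniq G c (fun v => c v ∈ JR.1 ∧ c v ∉ JR.2) JR.2 →
        ∀ {X : Type} [DecidableEq X] (c' : V → X) (π : X → K) (θ : X → T), (∀ v, π (c' v) = c v) →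
        (∀ v, θ (c' v) = τ v) → ∀ J : Finset X, J.card ≤ p →
        (∀ v, c' v ∈ J → c v ∉ JR.2 → c v ∈ JR.1 ∧ c v ∉ JR.2) →
        (J.filter fun x => π x ∈ JR.2).Nonempty →
        ∃ α ∈ J.filter fun x => π x ∈ JR.2,
          Uniq G c' (fun v => c' v ∈ J ∧ c' v ∉ (J.filter fun x => π x ∈ JR.2).erase α)
            ((J.filter fun x => π x ∈ JR.2).erase α) := by
      intro JR
      by_cases h : Uniq G c (fun v => c v ∈ JR.1 ∧ c v ∉ JR.2) JR.2
      · obtain ⟨τ, hτ⟩ := href G c (fun v => c v ∈ JR.1 ∧ c v ∉ JR.2) JR.2 hD hd h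
        exact ⟨τ, fun _ => hτ⟩
      · exact ⟨fun _ => hT0.some, fun h' => absurd h' h⟩
    choose τ hτ using hex
    refine ⟨fun v => (c v, fun JR => τ JR v), fun J' hJ' hJ'p => ?_⟩
    set c' : V → K × (Finset K × Finset K → T) := fun v => (c v, fun JR => τ JR v) with hc'
    set J := J'.image Prod.fst with hJdef
    have hmemJ : ∀ v, c' v ∈ J' → c v ∈ J := fun v hv => Finset.mem_image.2 ⟨c' v, hv, rfl⟩
    rcases hc J (hJ'.image _) (Finset.card_image_le.trans hJ'p) with
      ⟨β, hβ, hcen⟩ | ⟨R, hRJ, hR, hU, hj⟩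
    · left
      obtain ⟨x, hx, rfl⟩ := Finset.mem_image.1 hβ
      exact ⟨x, hx, fun u v hu hv h =>
        hcen u v (congrArg Prod.fst hu) (congrArg Prod.fst hv) (h.mono hmemJ)⟩
    · set R' := J'.filter fun x => x.1 ∈ R with hR'
      have hR'ne : R'.Nonempty := by
        obtain ⟨β, hβ⟩ := hR
        obtain ⟨x, hx, rfl⟩ := Finset.mem_image.1 (hRJ hβ)
        exact ⟨x, Finset.mem_filter.2 ⟨hx, hβ⟩⟩
      obtain ⟨α, hα, hU'⟩ := hτ (J, R) hU c' Prod.fst (fun x => x.2 (J, R)) (fun _ => rfl)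
        (fun _ => rfl) J' hJ'p (fun v hv hvR => ⟨hmemJ v hv, hvR⟩) hR'ne
      change α ∈ R' at hα
      change Uniq G c' (fun v => c' v ∈ J' ∧ c' v ∉ R'.erase α) (R'.erase α) at hU'
      obtain ⟨hαJ, hαR⟩ := Finset.mem_filter.1 hα
      rcases (R'.erase α).eq_empty_or_nonempty with h0 | hne
      · left
        refine ⟨α, hαJ, fun u v hu hv h => ?_⟩
        refine eq_of_linked_insert (S := fun v => c v ∈ J ∧ c v ∉ R) (T := fun v => c' v = α)
          (fun a b ha hb hab => hU.2 a b ?_ ?_ hab) (fun w hw => ?_) hu hv h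
        · exact congrArg Prod.fst (ha.trans hb.symm)
        · rwa [← ha] at hαR
        · by_cases hwR : c w ∈ R
          · right
            by_contra hne
            have : c' w ∈ R'.erase α := Finset.mem_erase.2 ⟨hne, Finset.mem_filter.2 ⟨hw, hwR⟩⟩
            rw [h0] at this
            simp at this
          · exact Or.inl ⟨hmemJ w hw, hwR⟩
      · right
        have hsub : R' ⊆ J' := Finset.filter_subset _ _
        refine ⟨R'.erase α, (Finset.erase_subset _ _).trans hsub, hne, hU', ?_⟩
        have h1 : (J \ R).card ≤ (J' \ R').card := by
          refine (Finset.card_le_card ?_).trans (Finset.card_image_le (f := Prod.fst))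
          intro x hx
          obtain ⟨hx1, hx2⟩ := Finset.mem_sdiff.1 hx
          obtain ⟨y, hy, rfl⟩ := Finset.mem_image.1 hx1
          exact Finset.mem_image.2 ⟨y, Finset.mem_sdiff.2
            ⟨hy, fun h => hx2 (Finset.mem_filter.1 h).2⟩, rfl⟩
        have h2 := Finset.card_sdiff_add_card_eq_card hsub
        have h3 := Finset.card_sdiff_add_card_eq_card hRJ
        have h4 := Finset.card_erase_add_one hα
        omega

theorem exists_centered_coloring (p D d k : ℕ) (hp : 1 ≤ p) : ∃ K : Type, Finite K ∧
    ∀ {V : Type} [LinearOrder V] [Fintype V] (G : SimpleGraph V), PathBounded G D → Sparse G d →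
      G.Colorable k → ∃ c : V → K, ∀ J : Finset K, J.Nonempty → J.card ≤ p →
        ∃ β ∈ J, Centered G c J β := by
  obtain ⟨K, hK, h⟩ := exists_stage p D d k hp p
  refine ⟨K, hK, fun G hD hd hk => ?_⟩
  obtain ⟨c, hc⟩ := h G hD hd hk
  refine ⟨c, fun J hJ hJp => (hc J hJ hJp).resolve_right ?_⟩
  rintro ⟨R, -, hR, -, hp'⟩
  have h2 := hR.card_pos
  omega

theorem exists_forest_of_centered {V K : Type*} [Finite V] {G : SimpleGraph V} {c : V → K} {p : ℕ}
    (h : ∀ J : Finset K, J.Nonempty → J.card ≤ p → ∃ β ∈ J, Centered G c J β) (n : ℕ) :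
    ∀ I : Finset K, I.card = n → n ≤ p → ∃ r : V → V → Prop,
      (∀ u v, r u v → c u ∈ I ∧ c v ∈ I ∧ Linked G (fun w => c w ∈ I) u v) ∧
      (∀ v, c v ∈ I → r v v) ∧ (∀ u v, r u v → r v u → u = v) ∧
      (∀ u v w, r u v → r v w → r u w) ∧ (∀ u v w, r u w → r v w → r u v ∨ r v u) ∧
      (∀ u v, c u ∈ I → c v ∈ I → G.Adj u v → r u v ∨ r v u) ∧
      ∀ v, {u | r u v}.ncard ≤ n := by
  induction n with
  | zero =>
    intro I hI _
    rw [Finset.card_eq_zero] at hI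
    subst hI
    exact ⟨fun _ _ => False, by simp⟩
  | succ n ih =>
    intro I hI hn
    obtain ⟨β, hβ, hcen⟩ := h I (Finset.card_pos.1 (by omega)) (by omega)
    obtain ⟨r, h1, h2, h3, h4, h5, h6, h7⟩ := ih (I.erase β)
      (by rw [Finset.card_erase_of_mem hβ]; omega) (by omega)
    set L : V → V → Prop := fun u v => c u ∈ I ∧ c v ∈ I ∧ Linked G (fun w => c w ∈ I) u v with hL
    have hrL : ∀ u v, r u v → L u v := fun u v huv =>
      let ⟨a, b, d⟩ := h1 u v huv
      ⟨Finset.mem_of_mem_erase a, Finset.mem_of_mem_erase b,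
        d.mono fun w hw => Finset.mem_of_mem_erase hw⟩
    have hsymm : ∀ u v, L u v → L v u := fun u v ⟨a, b, d⟩ => ⟨b, a, d.symm⟩
    have htrans : ∀ u v w, L u v → L v w → L u w := fun u v w ⟨a, b, d⟩ ⟨_, b', d'⟩ =>
      ⟨a, b', d.trans b d'⟩
    have hl : ∀ u v, r u v → c u ≠ β := fun u v huv => (Finset.mem_erase.1 (h1 u v huv).1).1
    have hr : ∀ u v, r u v → c v ≠ β := fun u v huv => (Finset.mem_erase.1 (h1 u v huv).2.1).1
    have heq : ∀ u v, c u = β → c v = β → L u v → u = v := fun u v hu hv huv =>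
      hcen u v hu hv huv.2.2
    refine ⟨fun u v => r u v ∨ (c u = β ∧ L u v), ?_, ?_, ?_, ?_, ?_, ?_, ?_⟩
    · rintro u v (h | h)
      · exact hrL u v h
      · exact h.2
    · intro v hv
      by_cases hvβ : c v = β
      · exact Or.inr ⟨hvβ, hv, hv, Linked.refl v⟩
      · exact Or.inl (h2 v (Finset.mem_erase.2 ⟨hvβ, hv⟩))
    · rintro u v (huv | huv) (hvu | hvu)
      · exact h3 u v huv hvu
      · exact absurd hvu.1 (hr u v huv)
      · exact absurd huv.1 (hr v u hvu)
      · exact heq u v huv.1 hvu.1 huv.2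
    · rintro u v w (huv | huv) (hvw | hvw)
      · exact Or.inl (h4 u v w huv hvw)
      · exact absurd hvw.1 (hr u v huv)
      · exact Or.inr ⟨huv.1, htrans _ _ _ huv.2 (hrL _ _ hvw)⟩
      · exact Or.inr ⟨huv.1, htrans _ _ _ huv.2 hvw.2⟩
    · rintro u v w (huw | huw) (hvw | hvw)
      · exact (h5 u v w huw hvw).imp Or.inl Or.inl
      · exact Or.inr (Or.inr ⟨hvw.1, htrans _ _ _ hvw.2 (hsymm _ _ (hrL _ _ huw))⟩)
      · exact Or.inl (Or.inr ⟨huw.1, htrans _ _ _ huw.2 (hsymm _ _ (hrL _ _ hvw))⟩)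
      · exact Or.inl (Or.inr ⟨huw.1, htrans _ _ _ huw.2 (hsymm _ _ hvw.2)⟩)
    · intro u v hu hv huv
      by_cases huβ : c u = β
      · exact Or.inl (Or.inr ⟨huβ, hu, hv, Linked.of_adj huv⟩)
      by_cases hvβ : c v = β
      · exact Or.inr (Or.inr ⟨hvβ, hv, hu, Linked.of_adj huv.symm⟩)
      · exact (h6 u v (Finset.mem_erase.2 ⟨huβ, hu⟩) (Finset.mem_erase.2 ⟨hvβ, hv⟩) huv).imp
          Or.inl Or.inl
    · intro v
      have hs : {u | c u = β ∧ L u v}.ncard ≤ 1 := by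
        rw [Set.ncard_le_one_iff]
        intro a b ha hb
        exact heq a b ha.1 hb.1 (htrans _ _ _ ha.2 (hsymm _ _ hb.2))
      calc {u | r u v ∨ (c u = β ∧ L u v)}.ncard
          ≤ {u | r u v}.ncard + {u | c u = β ∧ L u v}.ncard := Set.ncard_union_le _ _
        _ ≤ n + 1 := Nat.add_le_add (h7 v) hs

theorem treeDepthLE_of_centered {V K : Type*} [Finite V] {G : SimpleGraph V} {c : V → K} {p : ℕ}
    (h : ∀ J : Finset K, J.Nonempty → J.card ≤ p → ∃ β ∈ J, Centered G c J β) (I : Finset K)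
    (hI : I.card ≤ p) : TreeDepthLE (G.induce {v | c v ∈ I}) I.card := by
  obtain ⟨r, -, h2, h3, h4, h5, h6, h7⟩ := exists_forest_of_centered h I.card I rfl hI
  refine ⟨fun u v => r u v, ⟨fun v => h2 v v.2, fun u v huv hvu => Subtype.ext (h3 _ _ huv hvu),
    fun u v w => h4 u v w, fun u v w => h5 u v w⟩, fun u v huv => h6 _ _ u.2 v.2 huv,
    fun v => le_trans ?_ (h7 v)⟩
  rw [← Set.ncard_image_of_injective _ Subtype.val_injective]
  refine Set.ncard_le_ncard ?_
  rintro _ ⟨u, hu, rfl⟩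
  exact hu

theorem IsSubgraphOf.trans {U V W : Type*} {F : SimpleGraph U} {G : SimpleGraph V}
    {H : SimpleGraph W} (h : IsSubgraphOf F G) (h' : IsSubgraphOf G H) : IsSubgraphOf F H := by
  obtain ⟨f, hf⟩ := h
  obtain ⟨g, hg⟩ := h'
  exact ⟨g.comp f, hg.comp hf⟩

theorem IsSubgraphOf.le_card {V : Type*} [Fintype V] {n : ℕ} {H : SimpleGraph (Fin n)}
    {G : SimpleGraph V} (h : IsSubgraphOf H G) : n ≤ Fintype.card V := by
  obtain ⟨f, hf⟩ := h
  simpa using Fintype.card_le_of_injective f hf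

theorem bddAbove_cliques {V : Type*} [Fintype V] (G : SimpleGraph V) :
    BddAbove {m | IsSubgraphOf (⊤ : SimpleGraph (Fin m)) G} :=
  ⟨Fintype.card V, fun _ h => IsSubgraphOf.le_card h⟩

theorem le_omegaNum {V : Type*} [Fintype V] {G : SimpleGraph V} {m : ℕ}
    (h : IsSubgraphOf (⊤ : SimpleGraph (Fin m)) G) : m ≤ omegaNum G :=
  le_csSup (bddAbove_cliques G) h

theorem omegaNum_mono {V W : Type*} [Fintype W] {G : SimpleGraph V} {H : SimpleGraph W}
    (h : IsSubgraphOf G H) : omegaNum G ≤ omegaNum H :=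
  csSup_le' fun _ hm => le_omegaNum (IsSubgraphOf.trans hm h)

theorem MemTM.le_card {V : Type*} [Fintype V] {r n : ℕ} {H : SimpleGraph (Fin n)}
    {G : SimpleGraph V} (h : MemTM r G H) : n ≤ Fintype.card V := by
  obtain ⟨t, -, f, hf⟩ := h
  simpa using Fintype.card_le_of_injective (fun v => f (Sum.inl v)) (hf.comp Sum.inl_injective)

theorem omegaNum_le_omegaTM {V : Type*} [Fintype V] {r n : ℕ} {H : SimpleGraph (Fin n)}
    {G : SimpleGraph V} (h : MemTM r G H) : omegaNum H ≤ omegaTM r G := by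
  refine le_csSup ⟨Fintype.card V, ?_⟩ ⟨n, H, h, rfl⟩
  rintro _ ⟨k, F, hF, rfl⟩
  refine le_trans (csSup_le' fun m hm => ?_) (MemTM.le_card hF)
  simpa using IsSubgraphOf.le_card hm

theorem isSubgraphOf_subdiv_zero {n : ℕ} (H : SimpleGraph (Fin n)) {t : Edges H → ℕ}
    (ht : ∀ e, t e = 0) : IsSubgraphOf H (Subdiv H t) := by
  refine ⟨⟨Sum.inl, fun {u v} huv => ?_⟩, Sum.inl_injective⟩
  refine (SimpleGraph.fromRel_adj _ _ _).2 ⟨fun h => huv.ne (Sum.inl_injective h), ?_⟩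
  rcases lt_or_gt_of_ne huv.ne with h | h
  · exact Or.inl ⟨⟨h, huv⟩, ht _⟩
  · exact Or.inr ⟨⟨h, huv.symm⟩, ht _⟩

theorem memTM_self (r : ℕ) {n : ℕ} (G : SimpleGraph (Fin n)) : MemTM r G G := by
  refine ⟨fun _ => 0, fun _ => Nat.zero_le _, ⟨Sum.elim id fun x => x.2.elim0, fun {a b} hab => ?_⟩,
    fun a b hab => ?_⟩
  · obtain ⟨-, h⟩ := (SimpleGraph.fromRel_adj _ _ _).1 hab
    rcases a with a | a
    · rcases b with b | b
      · rcases h with ⟨h, -⟩ | ⟨h, -⟩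
        · exact h.2
        · exact h.2.symm
      · exact b.2.elim0
    · exact a.2.elim0
  · rcases a with a | a
    · rcases b with b | b
      · exact congrArg _ hab
      · exact b.2.elim0
    · exact a.2.elim0

theorem omegaTM_zero_le {V : Type*} [Fintype V] (G : SimpleGraph V) :
    omegaTM 0 G ≤ omegaNum G := by
  refine csSup_le' ?_
  rintro _ ⟨k, H, ⟨t, ht, h⟩, rfl⟩
  exact omegaNum_mono ((isSubgraphOf_subdiv_zero H fun e => Nat.le_zero.1 (ht e)).trans h)

theorem memTM_top_of_biclique {V : Type*} {G : SimpleGraph V} {A B : Finset V} {r m : ℕ}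
    (hr : 1 ≤ r) (hA : m ≤ A.card) (hB : m * m ≤ B.card) (hAB : ∀ a ∈ A, ∀ b ∈ B, G.Adj a b) :
    MemTM r G (⊤ : SimpleGraph (Fin m)) := by
  set α : Fin m → V := fun i => A.equivFin.symm (Fin.castLE hA i) with hα
  set β : Fin m × Fin m → V := fun i => B.equivFin.symm (Fin.castLE hB (finProdFinEquiv i)) with hβ
  have hαi : Function.Injective α := Subtype.val_injective.comp
    (A.equivFin.symm.injective.comp (Fin.castLE_injective hA))
  have hβi : Function.Injective β := Subtype.val_injective.comp
    (B.equivFin.symm.injective.comp ((Fin.castLE_injective hB).comp finProdFinEquiv.injective))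
  have hadj : ∀ i j, G.Adj (α i) (β j) := fun i j => hAB _ (Subtype.prop _) _ (Subtype.prop _)
  refine ⟨fun _ => 1, fun _ => hr, ⟨Sum.elim α fun x => β x.1.1, fun {a b} hab => ?_⟩,
    fun a b hab => ?_⟩
  · obtain ⟨-, h⟩ := (SimpleGraph.fromRel_adj _ _ _).1 hab
    rcases a with a | ⟨a, i⟩
    · rcases b with b | ⟨b, j⟩
      · rcases h with ⟨_, h⟩ | ⟨_, h⟩
        · exact absurd h one_ne_zero
        · exact absurd h one_ne_zero
      · exact hadj _ _
    · rcases b with b | ⟨b, j⟩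
      · exact (hadj _ _).symm
      · rcases h with ⟨-, h⟩ | ⟨-, h⟩
        · have hj : (j : ℕ) < 1 := j.2
          omega
        · have hi : (i : ℕ) < 1 := i.2
          omega
  · rcases a with a | ⟨a, i⟩
    · rcases b with b | ⟨b, j⟩
      · exact congrArg _ (hαi hab)
      · exact absurd hab (hadj _ _).ne
    · rcases b with b | ⟨b, j⟩
      · exact absurd hab (hadj _ _).ne'
      · obtain rfl : a = b := Subtype.ext (hβi hab)
        rw [Subsingleton.elim i j]

theorem chiP_le_of_centered {V K : Type*} [Finite V] [Finite K] {G : SimpleGraph V} {c : V → K}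
    {p : ℕ} (h : ∀ J : Finset K, J.Nonempty → J.card ≤ p → ∃ β ∈ J, Centered G c J β) :
    chiP G p ≤ Nat.card K := by
  set e := Finite.equivFin K with he
  refine Nat.sInf_le ⟨fun v => e (c v), fun I hI => ?_⟩
  refine treeDepthLE_of_centered (fun J hJ hJp => ?_) I hI
  obtain ⟨β, hβ, hcen⟩ := h (J.map e.symm.toEmbedding) (hJ.map) (by rwa [Finset.card_map])
  refine ⟨e β, ?_, fun u v hu hv huv => hcen u v (e.injective hu) (e.injective hv)
    (huv.mono fun w hw => ?_)⟩
  · simpa [Finset.mem_map_equiv] using hβ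
  · simpa [Finset.mem_map_equiv] using hw

theorem chi_le_chiP_one {n : ℕ} (H : SimpleGraph (Fin n)) : chi H ≤ chiP H 1 := by
  have hne : {N | ∃ c : Fin n → Fin N, ∀ I : Finset (Fin N), I.card ≤ 1 →
      TreeDepthLE (H.induce {v | c v ∈ I}) I.card}.Nonempty :=
    ⟨n, id, treeDepthLE_of_centered fun J ⟨β, hβ⟩ _ => ⟨β, hβ, fun u v hu hv _ => hu.trans hv.symm⟩⟩
  obtain ⟨c, hc⟩ := Nat.sInf_mem hne
  refine Nat.sInf_le ⟨SimpleGraph.Coloring.mk c fun {u v} huv he => ?_⟩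
  obtain ⟨r, ⟨hr, -⟩, hadj, hcard⟩ := hc {c u} (by simp)
  set u' : {w | c w ∈ ({c u} : Finset _)} := ⟨u, Finset.mem_singleton_self _⟩ with hu'
  set v' : {w | c w ∈ ({c u} : Finset _)} := ⟨v, Finset.mem_singleton.2 he.symm⟩ with hv'
  have key : ∀ x y, x ≠ y → ¬ r x y := by
    intro x y hxy h
    have h1 := hcard y
    rw [Finset.card_singleton, Set.ncard_le_one_iff] at h1
    exact hxy (h1 h (hr y))
  have hne' : u' ≠ v' := fun h => huv.ne (congrArg Subtype.val h)
  rcases hadj u' v' huv with h | h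
  · exact key _ _ hne' h
  · exact key _ _ hne'.symm h

theorem chiP_one_le {V : Type*} [Finite V] {G : SimpleGraph V} {k : ℕ} (h : G.Colorable k) :
    chiP G 1 ≤ k := by
  obtain ⟨c⟩ := h
  have := chiP_le_of_centered (G := G) (c := c) (p := 1) fun J ⟨β, hβ⟩ hJ => by
    refine ⟨β, hβ, fun u v hu hv huv => ?_⟩
    have hJβ : ∀ x ∈ J, x = β := fun x hx => Finset.card_le_one.1 hJ x hx β hβ
    revert hu
    refine Linked.rec_left (M := fun u => c u = β → u = v) (fun _ => rfl)
      (fun a ha hau => absurd (hau.trans hv.symm) (c.valid ha))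
      (fun a b hab hb _ _ ha => absurd (ha.trans (hJβ _ hb).symm) (c.valid hab)) huv
  simpa using this

theorem chiBounded_of_weakly {C : GraphClass} (hHer : Hereditary C) (h : WeaklyChiPBounded C 1) :
    ChiBounded C := by
  obtain ⟨g, hg⟩ := h
  refine ⟨fun w => ∑ i ∈ Finset.range (w + 1), g i, fun n G hG m H hH => ?_⟩
  calc chi H ≤ chiP H 1 := chi_le_chiP_one H
    _ ≤ g (omegaTM 0 H) := hg H (hHer G H hG hH)
    _ ≤ _ := Finset.single_le_sum (f := g) (fun _ _ => Nat.zero_le _)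
      (Finset.mem_range.2 (Nat.lt_succ_of_le (omegaTM_zero_le H)))

theorem weakly_of_chiBounded {C : GraphClass} (hC : ChiBounded C)
    (hClosed : ∀ (r : ℕ) ⦃n m : ℕ⦄ (G : SimpleGraph (Fin n)) (H : SimpleGraph (Fin m)),
      G ∈ C n → IsInducedSubgraphOf (Subdiv H (fun _ => r)) G → H ∈ C m) {p : ℕ} (hp : 1 ≤ p) :
    WeaklyChiPBounded C p := by
  obtain ⟨D, hD⟩ := exists_pathBounded hC hClosed
  obtain ⟨f, hf⟩ := hC
  have hcol : ∀ {n : ℕ} (G : SimpleGraph (Fin n)), G ∈ C n →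
      G.Colorable (∑ i ∈ Finset.range (omegaTM (p - 1) G + 1), f i) := by
    intro n G hG
    refine (colorable_chi G).mono ((hf G hG G ⟨Embedding.refl⟩).trans ?_)
    exact Finset.single_le_sum (f := f) (fun _ _ => Nat.zero_le _)
      (Finset.mem_range.2 (Nat.lt_succ_of_le (omegaNum_le_omegaTM (memTM_self _ G))))
  rcases Nat.eq_or_lt_of_le hp with rfl | hp2
  · exact ⟨fun w => ∑ i ∈ Finset.range (w + 1), f i, fun n G hG => chiP_one_le (hcol G hG)⟩
  have hex : ∀ w, ∃ N, ∀ ⦃n : ℕ⦄ (G : SimpleGraph (Fin n)), G ∈ C n → omegaTM (p - 1) G = w →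
      chiP G p ≤ N := by
    intro w
    obtain ⟨d, hd⟩ := exists_sparse.{0} D (∑ i ∈ Finset.range (w + 1), f i) ((w + 1) * (w + 1))
    obtain ⟨K, hK, hcen⟩ := exists_centered_coloring p D d (∑ i ∈ Finset.range (w + 1), f i) hp
    refine ⟨Nat.card K, fun n G hG hw => ?_⟩
    have hk := hcol G hG
    rw [hw] at hk
    have hsparse : Sparse G d := by
      refine hd G (hD G hG) ?_ ?_
      · obtain ⟨c⟩ := hk
        exact ⟨c, fun u v huv => c.valid huv⟩
      · rintro ⟨A, B, hA, hB, hAB⟩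
        have h1 := omegaNum_le_omegaTM (memTM_top_of_biclique (r := p - 1) (by omega)
          ((Nat.le_mul_self (w + 1)).trans hA) hB hAB)
        have h2 := le_omegaNum (G := (⊤ : SimpleGraph (Fin (w + 1))))
          ⟨Hom.id, Function.injective_id⟩
        omega
    obtain ⟨c, hc⟩ := hcen G (hD G hG) hsparse hk
    exact chiP_le_of_centered hc
  choose g hg using hex
  exact ⟨g, fun n G hG => hg _ G hG rfl⟩

end

/-- A class closed under induced topological minors (in particular
hereditary) is weakly `χ_p`-bounded for every positive `p` iff it is `χ`-bounded. -/
theorem itm_closed_weakly_iff_chiBounded (C : GraphClass) (hHer : Hereditary C)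
    (hClosed : ∀ (r : ℕ) ⦃n m : ℕ⦄ (G : SimpleGraph (Fin n)) (H : SimpleGraph (Fin m)),
      G ∈ C n → IsInducedSubgraphOf (Subdiv H (fun _ => r)) G → H ∈ C m) :
    (∀ p : ℕ, 1 ≤ p → WeaklyChiPBounded C p) ↔ ChiBounded C := by
  constructor
  · exact fun h => chiBounded_of_weakly hHer (h 1 le_rfl)
  · exact fun h p hp => weakly_of_chiBounded h hClosed hp
end

section
/- Let 𝒞 be a hereditary class of graphs that is weakly χ_p-bounded for every positive integer p. Then 𝒞 is nowhere dense if and only if 𝒞 has bounded expansion. -/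
open SimpleGraph

/-! ## Topological minors and subgraphs -/

instance {n : ℕ} (H : SimpleGraph (Fin n)) : Finite (Edges H) :=
  inferInstanceAs (Finite {p : Fin n × Fin n // p.1 < p.2 ∧ H.Adj p.1 p.2})

/-- The map on edges induced by an order-preserving graph homomorphism. -/
def Edges.map {k m : ℕ} {K : SimpleGraph (Fin k)} {H : SimpleGraph (Fin m)}
    (φ : Fin k ↪o Fin m) (hφ : ∀ i j, K.Adj i j → H.Adj (φ i) (φ j)) (e : Edges K) : Edges H :=
  ⟨(φ e.1.1, φ e.1.2), φ.strictMono e.2.1, hφ _ _ e.2.2⟩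

theorem Edges.map_injective {k m : ℕ} {K : SimpleGraph (Fin k)} {H : SimpleGraph (Fin m)}
    (φ : Fin k ↪o Fin m) (hφ : ∀ i j, K.Adj i j → H.Adj (φ i) (φ j)) :
    Function.Injective (Edges.map φ hφ) := by
  intro e e' h
  have h2 := congrArg Subtype.val h
  simp only [Edges.map, Prod.mk.injEq, EmbeddingLike.apply_eq_iff_eq] at h2
  exact Subtype.ext (Prod.ext h2.1 h2.2)

theorem MemTM.of_orderEmbedding {W : Type*} {r k m : ℕ} {G : SimpleGraph W}
    {K : SimpleGraph (Fin k)} {H : SimpleGraph (Fin m)} (φ : Fin k ↪o Fin m)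
    (hφ : ∀ i j, K.Adj i j → H.Adj (φ i) (φ j)) (hH : MemTM r G H) : MemTM r G K := by
  obtain ⟨t, ht, f, hf⟩ := hH
  let F : (Fin k ⊕ Σ e : Edges K, Fin (t (e.map φ hφ))) → (Fin m ⊕ Σ e : Edges H, Fin (t e)) :=
    Sum.map φ (Sigma.map (Edges.map φ hφ) fun _ => id)
  have hF : Function.Injective F :=
    φ.injective.sumMap ((Edges.map_injective φ hφ).sigma_map fun _ => Function.injective_id)
  have hrel : ∀ a b, subdivRel K (fun e => t (e.map φ hφ)) a b → subdivRel H t (F a) (F b) := by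
    rintro (u | ⟨e, i⟩) (v | ⟨e', j⟩) h
    · obtain ⟨h, h0⟩ := h
      exact ⟨⟨φ.strictMono h.1, hφ _ _ h.2⟩, h0⟩
    · rcases h with ⟨rfl, h⟩ | ⟨rfl, h⟩
      · exact Or.inl ⟨rfl, h⟩
      · exact Or.inr ⟨rfl, h⟩
    · exact h.elim
    · obtain ⟨rfl, h⟩ := h
      exact ⟨rfl, h⟩
  refine ⟨fun e => t (e.map φ hφ), fun e => ht _, f.comp ⟨F, ?_⟩, hf.comp hF⟩
  rintro a b ⟨hab, h⟩
  exact ⟨hF.ne hab, h.imp (hrel _ _) (hrel _ _)⟩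

theorem MemTM.top_of_isSubgraphOf {W : Type*} {r k m : ℕ} {G : SimpleGraph W}
    {H : SimpleGraph (Fin m)} (hH : MemTM r G H)
    (hK : IsSubgraphOf (⊤ : SimpleGraph (Fin k)) H) :
    MemTM r G (⊤ : SimpleGraph (Fin k)) := by
  obtain ⟨f, hf⟩ := hK
  have hcard : (Finset.univ.image f).card = k := by
    rw [Finset.card_image_of_injective _ hf, Finset.card_fin]
  refine hH.of_orderEmbedding ((Finset.univ.image f).orderEmbOfFin hcard) fun i j hij => ?_
  obtain ⟨a, -, ha⟩ := Finset.mem_image.1 (Finset.orderEmbOfFin_mem _ hcard i)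
  obtain ⟨b, -, hb⟩ := Finset.mem_image.1 (Finset.orderEmbOfFin_mem _ hcard j)
  rw [← ha, ← hb]
  refine f.map_adj fun hab => hij ?_
  rw [hab, hb] at ha
  exact ((Finset.orderEmbOfFin _ hcard).injective ha).symm

theorem avgDeg_top {m : ℕ} (hm : m ≠ 0) : avgDeg (⊤ : SimpleGraph (Fin m)) = m - 1 := by
  have h : (⊤ : SimpleGraph (Fin m)).edgeSet.ncard = m.choose 2 := by
    rw [← SimpleGraph.coe_edgeFinset, Set.ncard_coe_finset,
      SimpleGraph.card_edgeFinset_top_eq_card_choose_two, Fintype.card_fin]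
  have hm' : (m : ℝ) ≠ 0 := Nat.cast_ne_zero.2 hm
  rw [avgDeg, h, Nat.cast_choose_two]
  field_simp

theorem BoundedExpansion.nowhereDense {C : GraphClass} (h : BoundedExpansion C) :
    NowhereDense C := by
  intro r
  obtain ⟨d, hd⟩ := h r
  refine ⟨⌈d⌉₊ + 1, fun m H hH => csSup_le' fun k hk => ?_⟩
  obtain ⟨n, G, hG, hHG⟩ := hH
  rcases eq_or_ne k 0 with rfl | hk0
  · exact Nat.zero_le _
  have hle := hd _ ⟨n, G, hG, hHG.top_of_isSubgraphOf hk⟩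
  rw [avgDeg_top hk0] at hle
  have := Nat.le_ceil d
  exact_mod_cast (by linarith : (k : ℝ) ≤ ⌈d⌉₊ + 1)

/-! ## Low tree-depth colorings bound the density of shallow topological minors -/

/-- A finite sequence of consecutively comparable elements of a forest order has a least
element. -/
theorem IsForestOrder.exists_least {V : Type*} {r : V → V → Prop} (hr : IsForestOrder r)
    (x : ℕ → V) (k : ℕ) (hx : ∀ i < k, r (x i) (x (i + 1)) ∨ r (x (i + 1)) (x i)) :
    ∃ j ≤ k, ∀ i ≤ k, r (x j) (x i) := by
  obtain ⟨hrefl, -, htrans, hcomp⟩ := hr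
  induction k with
  | zero => exact ⟨0, le_rfl, fun i hi => by rw [Nat.le_zero.1 hi]; exact hrefl _⟩
  | succ k ih =>
    obtain ⟨j, hj, hmin⟩ := ih fun i hi => hx i (by omega)
    have key : r (x j) (x (k + 1)) ∨ r (x (k + 1)) (x j) :=
      (hx k (by omega)).elim (fun h => Or.inl (htrans _ _ _ (hmin k le_rfl) h))
        fun h => hcomp _ _ _ (hmin k le_rfl) h
    rcases key with h | h
    · refine ⟨j, by omega, fun i hi => ?_⟩
      rcases Nat.le_succ_iff.1 hi with hi | rfl
      exacts [hmin i hi, h]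
    · refine ⟨k + 1, le_rfl, fun i hi => ?_⟩
      rcases Nat.le_succ_iff.1 hi with hi | rfl
      exacts [htrans _ _ _ h (hmin i hi), hrefl _]

/-- The path of `Subdiv H t` replacing the edge `e`; its vertices are the values at
`0, …, t e + 1`. -/
def subdivPath {m : ℕ} {H : SimpleGraph (Fin m)} (t : Edges H → ℕ) (e : Edges H) :
    ℕ → Fin m ⊕ Σ e : Edges H, Fin (t e)
  | 0 => Sum.inl e.1.1
  | i + 1 => if h : i < t e then Sum.inr ⟨e, i, h⟩ else Sum.inl e.1.2

theorem subdivPath_last {m : ℕ} {H : SimpleGraph (Fin m)} (t : Edges H → ℕ) (e : Edges H) :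
    subdivPath t e (t e + 1) = Sum.inl e.1.2 := by
  simp [subdivPath]

theorem subdivPath_adj {m : ℕ} {H : SimpleGraph (Fin m)} (t : Edges H → ℕ) (e : Edges H)
    {i : ℕ} (hi : i < t e + 1) :
    (Subdiv H t).Adj (subdivPath t e i) (subdivPath t e (i + 1)) := by
  have hne : e.1.1 ≠ e.1.2 := e.2.1.ne
  rw [Subdiv, SimpleGraph.fromRel_adj]
  rcases i with _ | i
  · by_cases h : 0 < t e
    · simp [subdivPath, h, subdivRel]
    · simp only [subdivPath, h, dite_false]
      exact ⟨by simpa using hne, Or.inl ⟨e.2, Nat.eq_zero_of_not_pos h⟩⟩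
  · have h1 : i < t e := by omega
    by_cases h2 : i + 1 < t e
    · simp [subdivPath, h1, h2, subdivRel]
    · have : i + 1 = t e := by omega
      simp [subdivPath, h1, this, subdivRel]

theorem eq_or_eq_of_mem_subdivPath {m : ℕ} {H : SimpleGraph (Fin m)} (t : Edges H → ℕ)
    (e : Edges H) (i : ℕ) :
    subdivPath t e i = Sum.inl e.1.1 ∨ subdivPath t e i = Sum.inl e.1.2 ∨
      ∃ j, subdivPath t e i = Sum.inr ⟨e, j⟩ := by
  rcases i with _ | i
  · exact Or.inl rfl
  · by_cases h : i < t e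
    · exact Or.inr (Or.inr ⟨⟨i, h⟩, by simp [subdivPath, h]⟩)
    · exact Or.inr (Or.inl (by simp [subdivPath, h]))

/-- An edge of `H` is determined by one of its ends together with a vertex of the
corresponding path other than that end. -/
theorem Edges.eq_of_subdivPath_eq {m : ℕ} {H : SimpleGraph (Fin m)} (t : Edges H → ℕ)
    {e e' : Edges H} {i i' : ℕ} {w : Fin m} (hw : w = e.1.1 ∨ w = e.1.2)
    (hw' : w = e'.1.1 ∨ w = e'.1.2) (hne : subdivPath t e i ≠ Sum.inl w)
    (h : subdivPath t e i = subdivPath t e' i') : e = e' := by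
  have hlt := e.2.1
  have hlt' := e'.2.1
  suffices hs : e = e' ∨ (e.1.1 = e'.1.1 ∧ e.1.2 = e'.1.2) from
    hs.elim id fun hs => Subtype.ext (Prod.ext hs.1 hs.2)
  have hne' := hne
  rw [h] at hne'
  rcases eq_or_eq_of_mem_subdivPath t e i with h1 | h1 | ⟨j, h1⟩ <;>
  rcases eq_or_eq_of_mem_subdivPath t e' i' with h2 | h2 | ⟨j', h2⟩ <;>
  rw [h1] at hne h <;> rw [h2] at hne' h <;>
  simp only [Sum.inl.injEq, Sum.inr.injEq, reduceCtorEq, Sigma.mk.injEq, ne_eq] at h hne hne'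
  case inr.inr.inr.inr => exact Or.inl h.1
  all_goals
    right
    rcases hw with rfl | rfl <;> rcases hw' with h3 | h3 <;> grind

/-- The colors of the vertices on the path replacing an edge. -/
noncomputable def pathColors {m N : ℕ} {H : SimpleGraph (Fin m)} (t : Edges H → ℕ)
    (c : (Fin m ⊕ Σ e : Edges H, Fin (t e)) → Fin N) (e : Edges H) : Finset (Fin N) :=
  (Finset.range (t e + 2)).image fun i => c (subdivPath t e i)

theorem exists_end_ancestor {n m N r : ℕ} {G : SimpleGraph (Fin n)} {H : SimpleGraph (Fin m)}
    {t : Edges H → ℕ} (ht : ∀ e, t e ≤ r) (f : Subdiv H t →g G)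
    {c : Fin n → Fin N}
    {R : ∀ I : Finset (Fin N), {v | c v ∈ I} → {v | c v ∈ I} → Prop}
    (hR : ∀ I : Finset (Fin N), I.card ≤ r + 2 → IsForestOrder (R I) ∧
      (∀ u v, (G.induce {v | c v ∈ I}).Adj u v → R I u v ∨ R I v u)) (e : Edges H) :
    ∃ (w : Fin m) (i : ℕ) (a b : {v | c v ∈ pathColors t (c ∘ f) e}),
      (w = e.1.1 ∨ w = e.1.2) ∧ subdivPath t e i ≠ Sum.inl w ∧
      (a : Fin n) = f (subdivPath t e i) ∧ (b : Fin n) = f (Sum.inl w) ∧ R _ a b := by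
  have hcard : (pathColors t (c ∘ f) e).card ≤ r + 2 :=
    Finset.card_image_le.trans (by rw [Finset.card_range]; have := ht e; omega)
  obtain ⟨hforest, hadj⟩ := hR _ hcard
  have hmem : ∀ i, i ≤ t e + 1 → c (f (subdivPath t e i)) ∈ pathColors t (c ∘ f) e := fun i hi =>
    Finset.mem_image.2 ⟨i, Finset.mem_range.2 (by omega), rfl⟩
  let x : ℕ → {v | c v ∈ pathColors t (c ∘ f) e} := fun i =>
    ⟨f (subdivPath t e (min i (t e + 1))), hmem _ (min_le_right _ _)⟩
  have hx : ∀ i ≤ t e + 1, (x i : Fin n) = f (subdivPath t e i) := fun i hi => by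
    simp only [x, min_eq_left hi]
  obtain ⟨j, hj, hmin⟩ := hforest.exists_least x (t e + 1) fun i hi => hadj _ _ <| by
    rw [SimpleGraph.comap_adj, Function.Embedding.subtype_apply,
      Function.Embedding.subtype_apply, hx i hi.le, hx (i + 1) hi]
    exact f.map_adj (subdivPath_adj t e hi)
  by_cases h : subdivPath t e j = Sum.inl e.1.1
  · refine ⟨e.1.2, j, x j, x (t e + 1), Or.inr rfl, ?_, hx j hj, ?_, hmin _ le_rfl⟩
    · rw [h]
      simpa using e.2.1.ne
    · rw [hx _ le_rfl, subdivPath_last]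
  · exact ⟨e.1.1, j, x j, x 0, Or.inl rfl, h, hx j hj, hx 0 (Nat.zero_le _),
      hmin 0 (Nat.zero_le _)⟩

theorem edgeSet_ncard_le_card_edges {m : ℕ} (H : SimpleGraph (Fin m)) :
    H.edgeSet.ncard ≤ Nat.card (Edges H) := by
  have hsub : H.edgeSet ⊆ Set.range fun e : Edges H => s(e.1.1, e.1.2) := by
    intro e
    induction e with | _ u v
    intro (h : H.Adj u v)
    rcases h.ne.lt_or_gt with huv | huv
    · exact ⟨⟨(u, v), huv, h⟩, rfl⟩
    · exact ⟨⟨(v, u), huv, h.symm⟩, Sym2.eq_swap⟩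
  exact (Set.ncard_le_ncard hsub (Set.finite_range _)).trans (Finite.card_range_le _)

theorem card_edges_le {n m N r : ℕ} {G : SimpleGraph (Fin n)} {H : SimpleGraph (Fin m)}
    {c : Fin n → Fin N}
    (hc : ∀ I : Finset (Fin N), I.card ≤ r + 2 → TreeDepthLE (G.induce {v | c v ∈ I}) I.card)
    (hH : MemTM r G H) : Nat.card (Edges H) ≤ 2 ^ N * (m * (r + 2)) := by
  classical
  obtain ⟨t, ht, f, hf⟩ := hH
  choose! R hR using hc
  choose w i a b hw hne ha hb hab using
    exists_end_ancestor (R := R) ht f fun I hI => ⟨(hR I hI).1, (hR I hI).2.1⟩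
  let A : Finset (Fin N) × Fin m → Finset (Fin n) := fun p =>
    {y | ∃ a b : {v | c v ∈ p.1}, (a : Fin n) = y ∧ (b : Fin n) = f (Sum.inl p.2) ∧ R p.1 a b}
  have hA : ∀ p : Finset (Fin N) × Fin m, p.1.card ≤ r + 2 → (A p).card ≤ r + 2 := by
    rintro ⟨I, v⟩ hI
    by_cases hv : c (f (Sum.inl v)) ∈ I
    · have hsub : (A (I, v) : Set (Fin n)) ⊆
          Subtype.val '' {u | R I u ⟨f (Sum.inl v), hv⟩} := by
        intro y hy
        obtain ⟨a, b, rfl, hb, hab⟩ := (Finset.mem_filter.1 (Finset.mem_coe.1 hy)).2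
        obtain rfl : b = ⟨f (Sum.inl v), hv⟩ := Subtype.ext hb
        exact ⟨a, hab, rfl⟩
      rw [← Set.ncard_coe_finset]
      exact (Set.ncard_le_ncard hsub (Set.toFinite _)).trans
        ((Set.ncard_image_le (Set.toFinite _)).trans (((hR I hI).2.2 _).trans hI))
    · have : A (I, v) = ∅ := by
        refine Finset.filter_eq_empty_iff.2 ?_
        rintro y - ⟨a, b, -, hb, -⟩
        have hbI : c b ∈ I := b.2
        exact hv (hb ▸ hbI)
      simp [this]
  have := Fintype.ofFinite (Edges H)
  let P : Finset (Finset (Fin N) × Fin m) := {p | p.1.card ≤ r + 2}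
  calc Nat.card (Edges H) = (Finset.univ : Finset (Edges H)).card := by
        rw [Nat.card_eq_fintype_card, Finset.card_univ]
    _ ≤ (P.sigma A).card := by
        refine Finset.card_le_card_of_injOn
          (fun e => ⟨(pathColors t (c ∘ f) e, w e), f (subdivPath t e (i e))⟩) ?_ ?_
        · intro e _
          refine Finset.mem_coe.2 (Finset.mem_sigma.2 ⟨?_, ?_⟩)
          · refine Finset.mem_filter.2 ⟨Finset.mem_univ _, Finset.card_image_le.trans ?_⟩
            have := ht e
            rw [Finset.card_range]
            omega
          · exact Finset.mem_filter.2
              ⟨Finset.mem_univ _, a e, b e, ha e, hb e, hab e⟩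
        · intro e _ e' _ h
          simp only [Sigma.mk.injEq, Prod.mk.injEq] at h
          exact Edges.eq_of_subdivPath_eq t (hw e) (h.1.2 ▸ hw e') (hne e) (hf (eq_of_heq h.2))
    _ = ∑ p ∈ P, (A p).card := Finset.card_sigma _ _
    _ ≤ P.card * (r + 2) :=
        Finset.sum_le_card_nsmul _ _ _ fun p hp => hA p (Finset.mem_filter.1 hp).2
    _ ≤ 2 ^ N * m * (r + 2) := by
        gcongr
        refine (Finset.card_le_univ _).trans ?_
        simp
    _ = 2 ^ N * (m * (r + 2)) := by ring

theorem exists_chiP_coloring {n : ℕ} (G : SimpleGraph (Fin n)) (p : ℕ) :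
    ∃ c : Fin n → Fin (chiP G p), ∀ I : Finset (Fin (chiP G p)), I.card ≤ p →
      TreeDepthLE (G.induce {v | c v ∈ I}) I.card := by
  refine Nat.sInf_mem (s := {N | ∃ c : Fin n → Fin N, ∀ I : Finset (Fin N), I.card ≤ p →
    TreeDepthLE (G.induce {v | c v ∈ I}) I.card}) ⟨n, id, fun I _ => ?_⟩
  refine ⟨fun u v => u ≤ v, ⟨fun _ => le_rfl, fun _ _ => le_antisymm, fun _ _ _ => le_trans,
    fun _ _ _ _ _ => le_total _ _⟩, fun _ _ _ => le_total _ _, fun v => ?_⟩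
  refine (Set.ncard_le_card _).trans ?_
  simp

theorem avgDeg_le_of_chiP_le {n m N r : ℕ} {G : SimpleGraph (Fin n)} {H : SimpleGraph (Fin m)}
    (hN : chiP G (r + 2) ≤ N) (hH : MemTM r G H) : avgDeg H ≤ 2 * (2 ^ N * (r + 2)) := by
  obtain ⟨c, hc⟩ := exists_chiP_coloring G (r + 2)
  have hle : H.edgeSet.ncard ≤ 2 ^ N * (m * (r + 2)) :=
    (edgeSet_ncard_le_card_edges H).trans <| (card_edges_le hc hH).trans <| by gcongr; norm_num
  have hle' : (H.edgeSet.ncard : ℝ) ≤ 2 ^ N * (m * (r + 2)) := by exact_mod_cast hle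
  refine div_le_of_le_mul₀ (Nat.cast_nonneg _) (by positivity) ?_
  linarith

theorem NowhereDense.boundedExpansion {C : GraphClass}
    (hW : ∀ p : ℕ, 1 ≤ p → WeaklyChiPBounded C p) (h : NowhereDense C) :
    BoundedExpansion C := by
  intro r
  obtain ⟨g, hg⟩ := hW (r + 2) (by omega)
  obtain ⟨c, hc⟩ := h (r + 1)
  refine ⟨2 * (2 ^ (Finset.range (c + 1)).sup g * (r + 2)), fun m H hH => ?_⟩
  obtain ⟨n, G, hG, hHG⟩ := hH
  refine avgDeg_le_of_chiP_le ((hg G hG).trans (Finset.le_sup (Finset.mem_range.2 ?_))) hHG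
  refine Nat.lt_succ_of_le (csSup_le' ?_)
  rintro _ ⟨k, K, hK, rfl⟩
  exact hc K ⟨n, G, hG, hK⟩

/-- A hereditary class that is weakly `χ_p`-bounded for every positive `p`
is nowhere dense iff it has bounded expansion. -/
theorem nowhereDense_iff_boundedExpansion (C : GraphClass) (hC : Hereditary C)
    (hW : ∀ p : ℕ, 1 ≤ p → WeaklyChiPBounded C p) :
    NowhereDense C ↔ BoundedExpansion C :=
  ⟨NowhereDense.boundedExpansion hW, BoundedExpansion.nowhereDense⟩
end
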